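/- arXiv:math/0502271 — 2 statements merged into one kernel-verified Lean document; each statement's English description precedes it below -/
import Mathlib

section
/- Let (W,S) be a Coxeter system satisfying conditions (0) and (1) of the main theorem. Then every maximal spherical subset T of S is either such that (W_T,T) is a strong even Coxeter system, or T = {s,t} with m(s,t) odd; in either case the finite Coxeter group W_T is rigid. -/
open Subgroup

/-- `S` is a Coxeter generating set for the group `W`: there is a Coxeter matrix on `S` and a
Coxeter system on `W` whose simple reflections are exactly the elements of `S`. -/
def IsCoxGenSet {W : Type*} [Group W] (S : Set W) : Prop :=
  S.Finite ∧ ∃ (M : CoxeterMatrix S) (cs : CoxeterSystem M W), ∀ s : S, cs.simple s = (s : W)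

/-- `T` is a spherical subset of the generating set `S`: the parabolic subgroup `W_T` is finite. -/
def IsSpherical {W : Type*} [Group W] (S T : Set W) : Prop :=
  T ⊆ S ∧ ((Subgroup.closure T : Subgroup W) : Set W).Finite

/-- `T` is a maximal spherical subset of `S`. -/
def IsMaxSpherical {W : Type*} [Group W] (S T : Set W) : Prop :=
  IsSpherical S T ∧ ∀ U : Set W, IsSpherical S U → T ⊆ U → U = T

/-- `T` is independent: all pairwise orders `m(s,t)` equal `2`. -/
def IsIndep {W : Type*} [Group W] (T : Set W) : Prop :=
  ∀ s ∈ T, ∀ t ∈ T, s ≠ t → orderOf (s * t) = 2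

/-- `T` is a maximal independent subset of `Sb`. -/
def IsMaxIndep {W : Type*} [Group W] (Sb T : Set W) : Prop :=
  IsIndep T ∧ T ⊆ Sb ∧ ∀ U : Set W, IsIndep U → U ⊆ Sb → T ⊆ U → U = T

/-- all pairwise orders lie in `{2} ∪ 4ℕ` (with `orderOf = 0` meaning `∞`). -/
def IsStrongEvenSet {W : Type*} [Group W] (T : Set W) : Prop :=
  ∀ s ∈ T, ∀ t ∈ T, s ≠ t → (orderOf (s * t) = 2 ∨ 4 ∣ orderOf (s * t))

/-- all pairwise orders are even (with `orderOf = 0` meaning `∞`). -/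
def IsEvenSet {W : Type*} [Group W] (T : Set W) : Prop :=
  ∀ s ∈ T, ∀ t ∈ T, s ≠ t → Even (orderOf (s * t))

/-- `S̄`: the union of all maximal spherical subsets `T` of `S` with `(W_T, T)` strong even. -/
def Sbar {W : Type*} [Group W] (S : Set W) : Set W :=
  ⋃₀ {T | IsMaxSpherical S T ∧ IsStrongEvenSet T}

/-- Condition (0): even orders lie in `{2} ∪ 4ℕ`. -/
def Cond0 {W : Type*} [Group W] (S : Set W) : Prop :=
  ∀ s ∈ S, ∀ t ∈ S, s ≠ t → Even (orderOf (s * t)) →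
    (orderOf (s * t) = 2 ∨ 4 ∣ orderOf (s * t))

/-- Condition (1): odd-order pairs are maximal spherical subsets. -/
def Cond1 {W : Type*} [Group W] (S : Set W) : Prop :=
  ∀ s ∈ S, ∀ t ∈ S, s ≠ t → Odd (orderOf (s * t)) → IsMaxSpherical S {s, t}

/-- Condition (2): no three-element subset `{s,t,u}` with `m(s,t)`, `m(t,u)` both odd. -/
def Cond2 {W : Type*} [Group W] (S : Set W) : Prop :=
  ¬ ∃ s ∈ S, ∃ t ∈ S, ∃ u ∈ S, s ≠ t ∧ t ≠ u ∧ s ≠ u ∧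
    Odd (orderOf (s * t)) ∧ Odd (orderOf (t * u))

/-- Condition (3): each odd pair meets at most two maximal spherical subsets. -/
def Cond3 {W : Type*} [Group W] (S : Set W) : Prop :=
  ∀ s ∈ S, ∀ t ∈ S, s ≠ t → Odd (orderOf (s * t)) →
    ∀ T₁ T₂ T₃ : Set W,
      (IsMaxSpherical S T₁ ∧ (T₁ ∩ {s, t}).Nonempty) →
      (IsMaxSpherical S T₂ ∧ (T₂ ∩ {s, t}).Nonempty) →
      (IsMaxSpherical S T₃ ∧ (T₃ ∩ {s, t}).Nonempty) →
      T₁ = T₂ ∨ T₁ = T₃ ∨ T₂ = T₃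

/-- Conditions (0)–(3) of the main theorem. -/
def Conds {W : Type*} [Group W] (S : Set W) : Prop :=
  Cond0 S ∧ Cond1 S ∧ Cond2 S ∧ Cond3 S

/-- `A τ A'`: equality of images in the abelianization of `W'`:
`π'(φ(W_A)) = π'(W'_{A'})`. -/
def Tau {W W' : Type*} [Group W] [Group W'] (φ : W →* W') (A : Set W) (A' : Set W') : Prop :=
  Subgroup.map ((Abelianization.of).comp φ) (Subgroup.closure A) =
  Subgroup.map Abelianization.of (Subgroup.closure A')

namespace MSR

/-- Working form of a Coxeter generating set: generating involutions with the universal property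
with respect to the actual orders. -/
structure Good {G : Type} [Group G] (S : Set G) : Prop where
  fin : S.Finite
  gen : Subgroup.closure S = ⊤
  inv : ∀ a ∈ S, a * a = 1
  lift : ∀ {H : Type} [Monoid H] (f : G → H),
    (∀ a ∈ S, ∀ b ∈ S, (f a * f b) ^ orderOf (a * b) = 1) → ∃ χ : G →* H, ∀ a ∈ S, χ a = f a

theorem good_of {G : Type} [Group G] {S : Set G} (h : IsCoxGenSet S) : Good S := by
  obtain ⟨hf, M, cs, hcs⟩ := h
  have hr : Set.range cs.simple = S := by
    ext x
    constructor
    · rintro ⟨i, rfl⟩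
      rw [hcs]; exact i.2
    · intro hx
      exact ⟨⟨x, hx⟩, hcs _⟩
  refine ⟨hf, ?_, ?_, ?_⟩
  · rw [← hr]; exact cs.subgroup_closure_range_simple
  · intro a ha
    have := cs.simple_mul_simple_self ⟨a, ha⟩
    rwa [hcs] at this
  · intro H _ f hfr
    have hl : M.IsLiftable (fun i : S => f i) := by
      intro i j
      have h1 := cs.simple_mul_simple_pow i j
      rw [hcs, hcs] at h1
      obtain ⟨k, hk⟩ := orderOf_dvd_of_pow_eq_one h1
      rw [hk, pow_mul, hfr _ i.2 _ j.2, one_pow]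
    refine ⟨cs.lift ⟨_, hl⟩, fun a ha => ?_⟩
    have := cs.lift_apply_simple hl ⟨a, ha⟩
    rwa [hcs] at this

/-- The bilinear form on basis vectors. -/
noncomputable def kf {G : Type} [Group G] (a b : G) : ℝ :=
  -2 * Real.cos (Real.pi / orderOf (a * b))

/-- The coroot functional. -/
noncomputable def cor {G : Type} [Group G] (a : G) : Module.Dual ℝ (G →₀ ℝ) :=
  Finsupp.linearCombination ℝ (fun b => kf a b)

/-- The root. -/
noncomputable def rt {G : Type} [Group G] (a : G) : G →₀ ℝ := Finsupp.single a 1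

theorem cor_rt {G : Type} [Group G] (a b : G) : cor a (rt b) = kf a b := by
  simp [cor, rt]

theorem orderOf_mul_comm' {G : Type} [Group G] (a b : G) :
    orderOf (a * b) = orderOf (b * a) := by
  have : b * a = a⁻¹ * (a * b) * a := by group
  rw [this]
  have h := orderOf_injective (MulAut.conj a⁻¹).toMonoidHom (MulAut.conj a⁻¹).injective (a * b)
  simpa using h.symm

theorem kf_comm {G : Type} [Group G] (a b : G) : kf a b = kf b a := by
  unfold kf; rw [orderOf_mul_comm']

theorem cor_self {G : Type} [Group G] {a : G} (h : a * a = 1) : cor a (rt a) = 2 := by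
  rw [cor_rt, kf, h]; simp

open Polynomial.Chebyshev in
theorem refl_pow {G : Type} [Group G] {a b : G} (ha : a * a = 1) (hb : b * b = 1) :
    (Module.reflection (cor_self ha) * Module.reflection (cor_self hb)) ^ orderOf (a * b) = 1 := by
  obtain ⟨m, hm⟩ : ∃ m, m = orderOf (a * b) := ⟨_, rfl⟩
  rw [← hm]
  rcases Nat.lt_or_ge m 3 with h3 | h3
  · interval_cases m
    · simp
    · have : a * b = 1 := orderOf_eq_one_iff.mp hm.symm
      have : a = b := by
        rw [← mul_left_inj b, hb, this]
      subst this
      rw [pow_one]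
      ext z : 1
      exact Module.involutive_reflection (cor_self ha) z
    · have h1 : cor a (rt b) = 0 := by rw [cor_rt, kf, ← hm]; simp
      have h2 : cor b (rt a) = 0 := by rw [cor_rt, kf_comm, kf, ← hm]; simp
      apply LinearEquiv.ext
      intro z
      rw [pow_two]
      simp only [LinearEquiv.mul_apply, Module.reflection_apply, map_sub, map_smul, h1, h2,
        cor_self ha, cor_self hb, LinearEquiv.coe_one, id_eq]
      module
  · apply LinearEquiv.ext
    intro z
    have hm0 : (0 : ℝ) < m := by positivity
    have hm3 : (3 : ℝ) ≤ m := by exact_mod_cast h3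
    have ht : 2 * Real.cos (2 * Real.pi / m) = cor a (rt b) * cor b (rt a) - 2 := by
      rw [cor_rt, cor_rt, kf_comm b a, kf, ← hm, mul_div_assoc, Real.cos_two_mul]; ring
    rw [Module.reflection_mul_reflection_pow_apply _ _ m z _ ht]
    have hs : Real.sin (2 * Real.pi / m) ≠ 0 := by
      apply ne_of_gt
      apply Real.sin_pos_of_pos_of_lt_pi
      · positivity
      · rw [div_lt_iff₀ hm0]
        nlinarith [Real.pi_pos]
    have hS (n : ℤ) : (S ℝ n).eval (2 * Real.cos (2 * Real.pi / m)) =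
        Real.sin ((n + 1) * (2 * Real.pi / m)) / Real.sin (2 * Real.pi / m) := by
      rw [eq_div_iff hs]; exact S_two_mul_real_cos _ _
    rcases Nat.even_or_odd' m with ⟨k, hk | hk⟩
    · have e1 : ((m : ℤ) - 2) / 2 = (k : ℤ) - 1 := by lia
      have e2 : ((m : ℤ) - 1) / 2 = (k : ℤ) - 1 := by lia
      have z1 : (S ℝ ((k : ℤ) - 1)).eval (2 * Real.cos (2 * Real.pi / m)) = 0 := by
        rw [hS]
        have : (((k : ℤ) - 1 : ℤ) + 1 : ℝ) * (2 * Real.pi / m) = Real.pi := by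
          have : (m : ℝ) = 2 * k := by exact_mod_cast hk
          have hk0 : (k : ℝ) ≠ 0 := by
            intro h; rw [h] at this; linarith
          rw [this]; push_cast; field_simp; ring
        rw [this]; simp
      rw [e1, e2, z1]
      simp
    · have e1 : ((m : ℤ) - 2) / 2 = (k : ℤ) - 1 := by lia
      have e2 : ((m : ℤ) - 1) / 2 = (k : ℤ) := by lia
      have e3 : ((m : ℤ) - 3) / 2 = (k : ℤ) - 1 := by lia
      have e4 : (m : ℤ) / 2 = (k : ℤ) := by lia
      have z1 : (S ℝ (k : ℤ)).eval (2 * Real.cos (2 * Real.pi / m)) +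
          (S ℝ ((k : ℤ) - 1)).eval (2 * Real.cos (2 * Real.pi / m)) = 0 := by
        rw [hS, hS, ← add_div]
        have : (((k : ℤ) : ℝ) + 1) * (2 * Real.pi / m) =
            2 * Real.pi - (((k : ℤ) - 1 : ℤ) + 1 : ℝ) * (2 * Real.pi / m) := by
          have : (m : ℝ) = 2 * k + 1 := by exact_mod_cast hk
          have hk0 : (2 * k + 1 : ℝ) ≠ 0 := by positivity
          rw [this]; push_cast; field_simp; ring
        rw [this, Real.sin_two_pi_sub]; simp
      rw [e1, e2, e3, e4, z1]
      simp

/-- The geometric representation. -/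
theorem geom {G : Type} [Group G] {S : Set G} (h : Good S) :
    ∃ ρ : G →* ((G →₀ ℝ) ≃ₗ[ℝ] (G →₀ ℝ)), ∀ a ∈ S, ∀ v, ρ a v = v - cor a v • rt a := by
  classical
  obtain ⟨ρ, hρ⟩ := h.lift (H := ((G →₀ ℝ) ≃ₗ[ℝ] (G →₀ ℝ)))
    (fun a => if ha : a * a = 1 then Module.reflection (cor_self ha) else 1) (by
      intro a ha b hb
      simp only [h.inv a ha, h.inv b hb, dif_pos]
      exact refl_pow (h.inv a ha) (h.inv b hb))
  refine ⟨ρ, fun a ha v => ?_⟩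
  rw [hρ a ha]
  simp only [h.inv a ha, dif_pos]
  exact Module.reflection_apply _ _

theorem Good.ne_one {G : Type} [Group G] {S : Set G} (h : Good S) {a : G} (ha : a ∈ S) :
    a ≠ 1 := by
  obtain ⟨ρ, hρ⟩ := geom h
  intro h1
  have := hρ a ha (rt a)
  rw [cor_self (h.inv a ha), h1] at this
  have h2 := congrArg (fun v => v 1) this
  norm_num [rt] at h2

theorem kf_bound {G : Type} [Group G] {a b : G} {n : ℕ} (hn : 0 < n)
    (hab : n ≤ orderOf (a * b)) : kf a b ≤ -2 * Real.cos (Real.pi / n) := by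
  unfold kf
  have hn' : (0 : ℝ) < n := by exact_mod_cast hn
  have h2 : (n : ℝ) ≤ orderOf (a * b) := by exact_mod_cast hab
  have : Real.cos (Real.pi / n) ≤ Real.cos (Real.pi / orderOf (a * b)) := by
    apply Real.cos_le_cos_of_nonneg_of_le_pi
    · positivity
    · rw [div_le_iff₀ hn']
      have : (1 : ℝ) ≤ n := by exact_mod_cast hn
      nlinarith [Real.pi_pos]
    · exact div_le_div_of_nonneg_left Real.pi_pos.le hn' h2
  linarith

theorem kf_nonpos {G : Type} [Group G] {a b : G} (h : orderOf (a * b) ≠ 1) : kf a b ≤ 0 := by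
  rcases Nat.eq_zero_or_pos (orderOf (a * b)) with h0 | h0
  · unfold kf; rw [h0]; simp
  · have := kf_bound (a := a) (b := b) (n := 2) (by norm_num) (by omega)
    simpa using this

theorem kf_gt {G : Type} [Group G] {a b : G} (h : orderOf (a * b) ≠ 0) : -2 < kf a b := by
  unfold kf
  have hn' : (0 : ℝ) < orderOf (a * b) := by exact_mod_cast Nat.pos_of_ne_zero h
  have : Real.cos (Real.pi / orderOf (a * b)) < Real.cos 0 := by
    apply Real.cos_lt_cos_of_nonneg_of_le_pi le_rfl
    · rw [div_le_iff₀ hn']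
      have : (1 : ℝ) ≤ orderOf (a * b) := by exact_mod_cast Nat.pos_of_ne_zero h
      nlinarith [Real.pi_pos]
    · positivity
  simp at this
  linarith

theorem inv_mul_eq_one {G : Type} [Group G] {a b : G} (hb : b * b = 1)
    (h : a * b = 1) : a = b := by
  rw [← mul_left_inj b, hb, h]

theorem comm_iff {G : Type} [Group G] {a b : G} (ha : a * a = 1) (hb : b * b = 1) :
    Commute a b ↔ (a * b) ^ 2 = 1 := by
  have ha' : a⁻¹ = a := inv_eq_of_mul_eq_one_left ha
  have hb' : b⁻¹ = b := inv_eq_of_mul_eq_one_left hb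
  constructor
  · intro h
    have h' : a * b = b * a := h
    rw [pow_two]
    calc a * b * (a * b) = a * b * (b * a) := by rw [h']
      _ = a * (b * b) * a := by group
      _ = 1 := by rw [hb, mul_one, ha]
  · intro h
    have h1 : a * b = (a * b)⁻¹ := by
      rw [eq_inv_iff_mul_eq_one, ← pow_two, h]
    show a * b = b * a
    rw [h1, mul_inv_rev, ha', hb']

theorem order_ge_three {G : Type} [Group G] [Finite G] {a b : G} (ha : a * a = 1) (hb : b * b = 1)
    (h : ¬ Commute a b) : 3 ≤ orderOf (a * b) := by
  by_contra hlt
  have hp := orderOf_pos (a * b)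
  apply h
  rw [comm_iff ha hb, ← orderOf_dvd_iff_pow_eq_one]
  have : orderOf (a * b) = 1 ∨ orderOf (a * b) = 2 := by omega
  rcases this with h | h <;> rw [h]
  exact one_dvd _

/-- Commutators along two adjacent edges do not commute. -/
theorem triple_ne {G : Type} [Group G] [Finite G] {S : Set G} (h : Good S) {a b c : G}
    (ha : a ∈ S) (hb : b ∈ S) (hc : c ∈ S) (hac : a ≠ c)
    (hab : ¬ Commute a b) (hbc : ¬ Commute b c) : ¬ Commute ((a * b) ^ 2) ((b * c) ^ 2) := by
  classical
  obtain ⟨ρ, hρ⟩ := geom h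
  intro hcomm
  have hab' : a ≠ b := by rintro rfl; exact hab (Commute.refl _)
  have hbc' : b ≠ c := by rintro rfl; exact hbc (Commute.refl _)
  have o1 := order_ge_three (h.inv a ha) (h.inv b hb) hab
  have o2 := order_ge_three (h.inv b hb) (h.inv c hc) hbc
  have haa : cor a (rt a) = 2 := cor_self (h.inv a ha)
  have hbb : cor b (rt b) = 2 := cor_self (h.inv b hb)
  have hcc : cor c (rt c) = 2 := cor_self (h.inv c hc)
  obtain ⟨j, hj⟩ : ∃ j, j = -kf a b := ⟨_, rfl⟩
  obtain ⟨k, hk⟩ : ∃ k, k = -kf b c := ⟨_, rfl⟩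
  obtain ⟨l, hl⟩ : ∃ l, l = -kf a c := ⟨_, rfl⟩
  have h1 : cor a (rt b) = -j := by rw [cor_rt, hj]; ring
  have h2 : cor b (rt a) = -j := by rw [cor_rt, kf_comm, hj]; ring
  have h3 : cor b (rt c) = -k := by rw [cor_rt, hk]; ring
  have h4 : cor c (rt b) = -k := by rw [cor_rt, kf_comm, hk]; ring
  have h5 : cor a (rt c) = -l := by rw [cor_rt, hl]; ring
  have h6 : cor c (rt a) = -l := by rw [cor_rt, kf_comm, hl]; ring
  have j1 : 1 ≤ j := by
    have := kf_bound (by norm_num) o1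
    simp at this; linarith
  have k1 : 1 ≤ k := by
    have := kf_bound (by norm_num) o2
    simp at this; linarith
  have l0 : 0 ≤ l := by
    have : kf a c ≤ 0 := kf_nonpos (fun h1 => hac
      (inv_mul_eq_one (h.inv c hc) (orderOf_eq_one_iff.mp h1)))
    linarith
  have j2 : j < 2 := by
    have := kf_gt (a := a) (b := b) (by omega)
    linarith
  have hj4 : j ^ 2 - 4 ≠ 0 := by nlinarith
  have hj0 : j ≠ 0 := by linarith
  -- the vector `w`
  obtain ⟨w, hw⟩ : ∃ w : G →₀ ℝ, w = (1 / (j ^ 2 - 4)) • rt a +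
    ((j ^ 2 - 2) / (j * (j ^ 2 - 4))) • rt b := ⟨_, rfl⟩
  have hA : ρ ((a * b) ^ 2) w = w + rt a := by
    rw [hw, pow_two]
    simp only [map_mul, LinearEquiv.mul_apply, hρ a ha, hρ b hb, map_add, map_sub, map_smul,
      h1, h2, haa, hbb, smul_eq_mul]
    match_scalars <;> field_simp <;> ring
  have hAc : ∀ v, (ρ ((a * b) ^ 2) v) c = v c := by
    intro v
    rw [pow_two]
    simp only [map_mul, LinearEquiv.mul_apply, hρ a ha, hρ b hb]
    simp [rt, hac, hbc']
  have hC : (ρ ((b * c) ^ 2) (rt a)) c = k * (j + l * k) := by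
    have : ρ ((b * c) ^ 2) (rt a) = rt a + ((j + l * k) + (k * (k * (j + l * k)) - (j + l * k))
        - (l * k + (j + l * k) - k * l) + j) • rt b + (k * (j + l * k)) • rt c := by
      rw [pow_two]
      simp only [map_mul, LinearEquiv.mul_apply, hρ b hb, hρ c hc, map_add, map_sub, map_smul,
        h2, h3, h4, h6, hcc, hbb, smul_eq_mul]
      match_scalars <;> ring
    rw [this]
    simp [rt, hac, hbc']
  have e : ρ ((a * b) ^ 2) (ρ ((b * c) ^ 2) w) = ρ ((b * c) ^ 2) (ρ ((a * b) ^ 2) w) := by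
    rw [← LinearEquiv.mul_apply, ← LinearEquiv.mul_apply, ← map_mul, ← map_mul, hcomm.eq]
  have e2 := congrArg (fun v => v c) e
  simp only [hAc, hA, map_add, Finsupp.add_apply, hC] at e2
  have : 0 < k * (j + l * k) := by positivity
  linarith

/-- A finite subgroup contains no path with labels at least `4`. -/
theorem triple_inf {G : Type} [Group G] {S : Set G} (h : Good S) {a b c : G}
    (ha : a ∈ S) (hb : b ∈ S) (hc : c ∈ S) (hac : a ≠ c)
    (hab : 4 ≤ orderOf (a * b)) (hbc : 4 ≤ orderOf (b * c)) (K : Subgroup G) [Finite K]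
    (haK : a ∈ K) (hbK : b ∈ K) (hcK : c ∈ K) : False := by
  classical
  obtain ⟨ρ, hρ⟩ := geom h
  have hab' : a ≠ b := by
    rintro rfl
    rw [h.inv a ha] at hab; simp at hab
  have hbc' : b ≠ c := by
    rintro rfl
    rw [h.inv b hb] at hbc; simp at hbc
  have := Fintype.ofFinite K
  let D : (G →₀ ℝ) → (G →₀ ℝ) → ℝ := fun v w => v a * w a + v b * w b + v c * w c
  let Q : (G →₀ ℝ) → (G →₀ ℝ) → ℝ := fun v w => ∑ g : K, D (ρ g v) (ρ g w)
  have Qinv : ∀ x ∈ K, ∀ v w, Q (ρ x v) (ρ x w) = Q v w := by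
    intro x hx v w
    refine Fintype.sum_equiv (Equiv.mulRight (⟨x, hx⟩ : K)) _ _ ?_
    intro g
    simp
  have Qadd : ∀ u v w, Q (u + v) w = Q u w + Q v w := by
    intro u v w
    simp only [Q, D, ← Finset.sum_add_distrib]
    refine Finset.sum_congr rfl fun g _ => ?_
    simp; ring
  have Qsmul : ∀ (r : ℝ) v w, Q (r • v) w = r * Q v w := by
    intro r v w
    simp only [Q, D, Finset.mul_sum]
    refine Finset.sum_congr rfl fun g _ => ?_
    simp; ring
  have Qsymm : ∀ v w, Q v w = Q w v := by
    intro v w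
    simp only [Q, D]
    refine Finset.sum_congr rfl fun g _ => ?_
    ring
  have Qpos : ∀ v, 0 < D v v → 0 < Q v v := by
    intro v hv
    refine Finset.sum_pos' (fun g _ => ?_) ⟨1, Finset.mem_univ _, ?_⟩
    · simp only [D]; nlinarith [mul_self_nonneg ((ρ g v) a), mul_self_nonneg ((ρ g v) b),
        mul_self_nonneg ((ρ g v) c)]
    · simpa using hv
  have key : ∀ x ∈ S, x ∈ K → ∀ v, 2 * Q v (rt x) = cor x v * Q (rt x) (rt x) := by
    intro x hx hxK v
    have h1 := Qinv x hxK v (rt x)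
    rw [hρ x hx, hρ x hx, cor_self (h.inv x hx)] at h1
    have e1 : rt x - (2 : ℝ) • rt x = (-1 : ℝ) • rt x := by module
    have e2 : v - cor x v • rt x = v + (- cor x v) • rt x := by module
    rw [e1, Qsymm, Qsmul, Qsymm, e2, Qadd, Qsmul] at h1
    linarith
  have na : 0 < Q (rt a) (rt a) := Qpos _ (by simp [D, rt, hab', hac])
  have nb : 0 < Q (rt b) (rt b) := Qpos _ (by simp [D, rt, hbc', hab', hab'.symm])
  have s2 : Real.sqrt 2 * Real.sqrt 2 = 2 := Real.mul_self_sqrt (by norm_num)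
  have s0 : 0 < Real.sqrt 2 := by positivity
  have kab : kf a b ≤ - Real.sqrt 2 := by
    have := kf_bound (by norm_num) hab
    simp [Real.cos_pi_div_four] at this; linarith
  have kbc : kf b c ≤ - Real.sqrt 2 := by
    have := kf_bound (by norm_num) hbc
    simp [Real.cos_pi_div_four] at this; linarith
  have kac : kf a c ≤ 0 := kf_nonpos (fun h1 => hac
      (inv_mul_eq_one (h.inv c hc) (orderOf_eq_one_iff.mp h1)))
  have q1 := key a ha haK (rt b)
  have q2 := key b hb hbK (rt a)
  have q3 := key b hb hbK (rt c)
  have q4 := key c hc hcK (rt b)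
  have q5 := key c hc hcK (rt a)
  rw [cor_rt] at q1 q2 q3 q4 q5
  rw [kf_comm b a] at q2
  rw [kf_comm c b] at q4
  rw [kf_comm c a] at q5
  have nab : Q (rt a) (rt a) = Q (rt b) (rt b) := by
    have : kf a b * Q (rt a) (rt a) = kf a b * Q (rt b) (rt b) := by
      rw [← q1, ← q2, Qsymm]
    exact mul_left_cancel₀ (by linarith) this
  have nbc : Q (rt b) (rt b) = Q (rt c) (rt c) := by
    have : kf b c * Q (rt b) (rt b) = kf b c * Q (rt c) (rt c) := by
      rw [← q3, ← q4, Qsymm]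
    exact mul_left_cancel₀ (by linarith) this
  obtain ⟨v, hv⟩ : ∃ v : G →₀ ℝ, v = rt a + Real.sqrt 2 • rt b + rt c := ⟨_, rfl⟩
  have p : 0 < Q v v := Qpos _ (by
    have : v a = 1 := by simp [hv, rt, hab', hac, hab'.symm, hac.symm]
    simp only [D]
    rw [this]
    nlinarith [mul_self_nonneg (v b), mul_self_nonneg (v c)])
  have Qadd' : ∀ u v w, Q w (u + v) = Q w u + Q w v := by
    intro u v w; rw [Qsymm, Qadd, Qsymm u, Qsymm v]
  have Qsmul' : ∀ (r : ℝ) v w, Q w (r • v) = r * Q w v := by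
    intro r v w; rw [Qsymm, Qsmul, Qsymm v]
  have ex : Q v v = Q (rt a) (rt a) + 2 * Q (rt b) (rt b) + Q (rt c) (rt c)
      + Real.sqrt 2 * (2 * Q (rt a) (rt b)) + Real.sqrt 2 * (2 * Q (rt c) (rt b))
      + 2 * Q (rt a) (rt c) := by
    rw [hv]
    simp only [Qadd, Qadd', Qsmul, Qsmul']
    rw [Qsymm (rt b) (rt a), Qsymm (rt c) (rt a), Qsymm (rt b) (rt c)]
    linear_combination (Q (rt b) (rt b)) * s2
  rw [q2, q3, q5, ← nbc, nab] at ex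
  have : Real.sqrt 2 * kf a b ≤ -2 := by nlinarith
  have : Real.sqrt 2 * kf b c ≤ -2 := by nlinarith
  have : Q v v = Q (rt b) (rt b) *
      (4 + Real.sqrt 2 * kf a b + Real.sqrt 2 * kf b c + kf a c) := by rw [ex]; ring
  nlinarith

end MSR

namespace MSR

open scoped commutatorElement

/-- Every noncommuting pair commutes with the remaining elements. -/
def NoTriple {G : Type} [Group G] (S : Set G) : Prop :=
  ∀ s ∈ S, ∀ t ∈ S, ∀ u ∈ S, ¬ Commute s t → u ≠ s → u ≠ t → Commute u s ∧ Commute u t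

theorem comm_of_gen {G H : Type} [Group G] [Group H] {S : Set G} (gen : closure S = ⊤)
    (q : G →* H) (h : ∀ s ∈ S, ∀ t ∈ S, Commute (q s) (q t)) : ∀ x y, Commute (q x) (q y) := by
  have h1 : ∀ y, ∀ s ∈ S, Commute (q s) (q y) := by
    intro y s hs
    have hy : y ∈ closure S := gen ▸ mem_top y
    induction hy using closure_induction with
    | mem y hy => exact h s hs y hy
    | one => simp
    | mul a b _ _ ha hb => rw [map_mul]; exact ha.mul_right hb
    | inv a _ ha => rw [map_inv]; exact ha.inv_right
  intro x y
  have hx : x ∈ closure S := gen ▸ mem_top x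
  induction hx using closure_induction with
  | mem x hx => exact h1 y x hx
  | one => simp
  | mul a b _ _ ha hb => rw [map_mul]; exact ha.mul_left hb
  | inv a _ ha => rw [map_inv]; exact ha.inv_left

theorem sq_eq_comm {G : Type} [Group G] {a b : G} (ha : a * a = 1) (hb : b * b = 1) :
    (a * b) ^ 2 = ⁅a, b⁆ := by
  have ha' : a⁻¹ = a := inv_eq_of_mul_eq_one_left ha
  have hb' : b⁻¹ = b := inv_eq_of_mul_eq_one_left hb
  rw [commutatorElement_def, ha', hb', pow_two]; group

theorem metab {G : Type} [Group G] {T : Set G} (gen : closure T = ⊤)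
    (inv : ∀ a ∈ T, a * a = 1) (hN : NoTriple T) (x y z w : G) :
    Commute ⁅x, y⁆ ⁅z, w⁆ := by
  let X : Set G := {g | ∃ s ∈ T, ∃ t ∈ T, g = (s * t) ^ 2}
  have hsw : ∀ s ∈ T, ∀ t ∈ T, (t * s) ^ 2 = ((s * t) ^ 2)⁻¹ := by
    intro s hs t ht
    rw [← inv_pow, mul_inv_rev, inv_eq_of_mul_eq_one_left (inv s hs),
      inv_eq_of_mul_eq_one_left (inv t ht)]
  have hc : ∀ p ∈ X, ∀ q ∈ X, p * q = q * p := by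
    rintro _ ⟨s, hs, t, ht, rfl⟩ _ ⟨u, hu, v, hv, rfl⟩
    show Commute _ _
    by_cases hst : Commute s t
    · rw [(comm_iff (inv s hs) (inv t ht)).mp hst]; exact Commute.one_left _
    by_cases huv : Commute u v
    · rw [(comm_iff (inv u hu) (inv v hv)).mp huv]; exact Commute.one_right _
    have hne : u ≠ v := by rintro rfl; exact huv (Commute.refl _)
    have Nu := hN s hs t ht u hu hst
    have Nv := hN s hs t ht v hv hst
    by_cases h1 : u = s
    · by_cases h2 : v = t
      · rw [h1, h2]
      · exact absurd ((Nv (by rw [← h1]; exact hne.symm) h2).1.symm) (by rwa [← h1])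
    by_cases h2 : u = t
    · by_cases h3 : v = s
      · rw [h2, h3, hsw s hs t ht]; exact (Commute.refl _).inv_right
      · exact absurd ((Nv h3 (by rw [← h2]; exact hne.symm)).2.symm) (by rwa [← h2])
    have Nu' := Nu h1 h2
    by_cases h3 : v = s
    · exact absurd Nu'.1 (by rwa [← h3])
    by_cases h4 : v = t
    · exact absurd Nu'.2 (by rwa [← h4])
    have Nv' := Nv h3 h4
    exact ((Nu'.1.symm.mul_left Nu'.2.symm).mul_right (Nv'.1.symm.mul_left Nv'.2.symm)).pow_pow _ _
  let A := closure X
  have hAc : ∀ p ∈ A, ∀ q ∈ A, Commute p q := by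
    have h1 : A ≤ centralizer (A : Set G) := by
      refine (closure_le _).mpr ?_
      intro p hp
      have h2 : A ≤ centralizer ({p} : Set G) := by
        refine (closure_le _).mpr ?_
        intro q hq
        rw [SetLike.mem_coe, mem_centralizer_singleton_iff]
        exact hc q hq p hp
      rw [SetLike.mem_coe, mem_centralizer_iff]
      intro q hq
      exact mem_centralizer_singleton_iff.mp (h2 hq)
    intro p hp q hq
    exact ((mem_centralizer_iff.mp (h1 hp)) q hq).symm
  have hcj : ∀ u ∈ T, ∀ p ∈ A, u * p * u⁻¹ ∈ A := by
    intro u hu p hp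
    have h1 : A ≤ A.comap (MulAut.conj u).toMonoidHom := by
      refine (closure_le _).mpr ?_
      rintro _ ⟨s, hs, t, ht, rfl⟩
      rw [SetLike.mem_coe, mem_comap]
      show u * (s * t) ^ 2 * u⁻¹ ∈ A
      by_cases hst : Commute s t
      · rw [(comm_iff (inv s hs) (inv t ht)).mp hst]; simp
      have hs' := inv s hs
      have ht' := inv t ht
      by_cases h1 : u = s
      · have : u * (s * t) ^ 2 * u⁻¹ = (t * s) ^ 2 := by
          rw [h1, inv_eq_of_mul_eq_one_left hs', pow_two, pow_two]
          calc s * (s * t * (s * t)) * s = (s * s) * (t * s * t * s) := by group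
            _ = _ := by rw [hs', one_mul]; group
        rw [this]
        exact subset_closure ⟨t, ht, s, hs, rfl⟩
      by_cases h2 : u = t
      · have : u * (s * t) ^ 2 * u⁻¹ = (t * s) ^ 2 := by
          rw [h2, inv_eq_of_mul_eq_one_left ht', pow_two, pow_two]
          calc t * (s * t * (s * t)) * t = (t * s * t * s) * (t * t) := by group
            _ = _ := by rw [ht', mul_one]; group
        rw [this]
        exact subset_closure ⟨t, ht, s, hs, rfl⟩
      have h3 := hN s hs t ht u hu hst h1 h2
      have : u * (s * t) ^ 2 = (s * t) ^ 2 * u := ((h3.1.mul_right h3.2).pow_right 2)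
      rw [this, mul_inv_cancel_right]
      exact subset_closure ⟨s, hs, t, ht, rfl⟩
    exact h1 hp
  have hAn : A.Normal := by
    have : T ⊆ (normalizer (A : Set G) : Subgroup G) := by
      intro u hu
      rw [SetLike.mem_coe, mem_normalizer_iff]
      intro p
      refine ⟨hcj u hu p, fun h => ?_⟩
      have := hcj u hu _ h
      have e : u * (u * p * u⁻¹) * u⁻¹ = p := by
        rw [inv_eq_of_mul_eq_one_left (inv u hu)]
        calc u * (u * p * u) * u = (u * u) * p * (u * u) := by group
          _ = p := by rw [inv u hu]; group
      rwa [e] at this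
    rw [← normalizer_eq_top_iff, eq_top_iff, ← gen]
    exact (closure_le _).mpr this
  have hq : ∀ x y : G, ⁅x, y⁆ ∈ A := by
    intro x y
    have := comm_of_gen gen (QuotientGroup.mk' A) (by
      intro s hs t ht
      rw [commute_iff_eq, ← map_mul, ← map_mul]
      apply QuotientGroup.eq.mpr
      have : (s * t)⁻¹ * (t * s) = (t * s) ^ 2 := by
        rw [mul_inv_rev, inv_eq_of_mul_eq_one_left (inv s hs),
          inv_eq_of_mul_eq_one_left (inv t ht), pow_two]
      rw [this]
      exact subset_closure ⟨t, ht, s, hs, rfl⟩) x y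
    rw [← QuotientGroup.eq_one_iff, ← QuotientGroup.mk'_apply, map_commutatorElement]
    exact commutatorElement_eq_one_iff_commute.mpr this
  exact hAc _ (hq _ _) _ (hq _ _)

theorem noTriple_of_good {G : Type} [Group G] [Finite G] {T S : Set G} (gen : closure T = ⊤)
    (inv : ∀ a ∈ T, a * a = 1) (hN : NoTriple T) (hS : Good S) : NoTriple S := by
  have key : ∀ a ∈ S, ∀ b ∈ S, ∀ c ∈ S, a ≠ c → ¬ Commute a b → Commute b c := by
    intro a ha b hb c hc hac hab
    by_contra hbc
    apply triple_ne hS ha hb hc hac hab hbc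
    rw [sq_eq_comm (hS.inv a ha) (hS.inv b hb), sq_eq_comm (hS.inv b hb) (hS.inv c hc)]
    exact metab gen inv hN _ _ _ _
  intro s hs t ht u hu hst h1 h2
  exact ⟨(key t ht s hs u hu h2.symm (fun h => hst h.symm)).symm,
    (key s hs t ht u hu h1.symm hst).symm⟩

theorem refl_zpow {G : Type} [Group G] {s t : G} (hs : s * s = 1) (ht : t * t = 1) (k : ℤ) :
    s * (s * t) ^ k = (s * t) ^ (-k) * s := by
  have : SemiconjBy s (s * t) (s * t)⁻¹ := by
    show s * (s * t) = (s * t)⁻¹ * s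
    rw [mul_inv_rev, inv_mul_cancel_right, ← mul_assoc, hs, one_mul,
      inv_eq_of_mul_eq_one_left ht]
  have h := this.zpow_right k
  rw [inv_zpow, ← zpow_neg] at h
  exact h

theorem dih_elem {G : Type} [Group G] {s t x : G} (hs : s * s = 1) (ht : t * t = 1)
    (hx : x ∈ closure {s, t}) : ∃ k : ℤ, x = (s * t) ^ k ∨ x = (s * t) ^ k * s := by
  have hs' : s⁻¹ = s := inv_eq_of_mul_eq_one_left hs
  induction hx using closure_induction with
  | mem x hx =>
    rcases hx with rfl | rfl
    · exact ⟨0, Or.inr (by simp)⟩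
    · exact ⟨-1, Or.inr (by simp [inv_eq_of_mul_eq_one_left ht])⟩
  | one => exact ⟨0, Or.inl (by simp)⟩
  | mul a b _ _ ha hb =>
    obtain ⟨i, hi⟩ := ha
    obtain ⟨j, hj⟩ := hb
    rcases hi with rfl | rfl <;> rcases hj with rfl | rfl
    · exact ⟨i + j, Or.inl (by rw [zpow_add])⟩
    · exact ⟨i + j, Or.inr (by rw [zpow_add, mul_assoc])⟩
    · exact ⟨i - j, Or.inr (by rw [mul_assoc, refl_zpow hs ht, ← mul_assoc, ← zpow_add,
        sub_eq_add_neg])⟩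
    · exact ⟨i - j, Or.inl (by rw [mul_assoc, ← mul_assoc s, refl_zpow hs ht, mul_assoc _ s s, hs,
        mul_one, ← zpow_add, sub_eq_add_neg])⟩
  | inv a _ ha =>
    obtain ⟨i, rfl | rfl⟩ := ha
    · exact ⟨-i, Or.inl (by rw [zpow_neg])⟩
    · exact ⟨i, Or.inr (by rw [mul_inv_rev, ← zpow_neg, hs', refl_zpow hs ht, neg_neg])⟩

theorem dih_rot {G : Type} [Group G] {s t x : G} {k : ℤ} (hs : s * s = 1) (ht : t * t = 1)
    (h : (s * t) ^ k * (s * t) ^ k = 1) (hx : x ∈ closure {s, t}) : Commute ((s * t) ^ k) x := by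
  have h1 : (s * t) ^ (-k) = (s * t) ^ k := by
    rw [zpow_neg]; exact inv_eq_of_mul_eq_one_left h
  have h2 : Commute ((s * t) ^ k) s := by
    have := refl_zpow hs ht k
    rw [h1] at this
    exact this.symm
  obtain ⟨j, rfl | rfl⟩ := dih_elem hs ht hx
  · exact (Commute.refl _).zpow_zpow _ _
  · exact ((Commute.refl _).zpow_zpow _ _).mul_right h2

theorem dih_order {G : Type} [Group G] {x y c d : G} (hx : x * x = 1) (hy : y * y = 1)
    (hc : c ∈ closure {x, y}) (hd : d ∈ closure {x, y}) (hcc : c * c = 1) (hdd : d * d = 1)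
    (hcd : ¬ Commute c d) : orderOf (c * d) ∣ orderOf (x * y) := by
  obtain ⟨i, hi⟩ := dih_elem hx hy hc
  obtain ⟨j, hj⟩ := dih_elem hx hy hd
  rcases hi with hi | hi
  · rw [hi] at hcc hcd
    exact absurd (dih_rot hx hy hcc hd) hcd
  rcases hj with hj | hj
  · rw [hj] at hdd hcd
    exact absurd (dih_rot hx hy hdd hc).symm hcd
  apply orderOf_dvd_of_mem_zpowers
  refine ⟨i - j, ?_⟩
  rw [hi, hj]
  show (x * y) ^ (i - j) = _
  rw [mul_assoc, ← mul_assoc x, refl_zpow hx hy, mul_assoc _ x x, hx,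
        mul_one, ← zpow_add, sub_eq_add_neg]

theorem odd_pair {G : Type} [Group G] [Finite G] {s t : G} (gen : closure {s, t} = ⊤)
    (hs : s * s = 1) (ht : t * t = 1) (hst : s ≠ t) (hodd : Odd (orderOf (s * t)))
    {S : Set G} (hS : Good S) : ∃ a b, a ≠ b ∧ ¬ Commute a b ∧ S = {a, b} := by
  have hr : ∀ k : ℤ, (s * t) ^ k * (s * t) ^ k = 1 → (s * t) ^ k = 1 := by
    intro k hk
    have h1 : orderOf ((s * t) ^ k) ∣ 2 := by
      rw [orderOf_dvd_iff_pow_eq_one, pow_two, hk]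
    have h2 : orderOf ((s * t) ^ k) ∣ orderOf (s * t) :=
      orderOf_dvd_of_mem_zpowers ⟨k, rfl⟩
    have h3 : (orderOf (s * t)).Coprime 2 := Nat.coprime_two_right.mpr hodd
    rw [← orderOf_eq_one_iff]
    exact Nat.dvd_one.mp (h3 ▸ Nat.dvd_gcd h2 h1)
  have hinv : ∀ c : G, c * c = 1 → c ≠ 1 → ∃ k : ℤ, c = (s * t) ^ k * s := by
    intro c hc hc1
    obtain ⟨k, hk | hk⟩ := dih_elem hs ht (gen ▸ mem_top c)
    · rw [hk] at hc hc1
      exact absurd (hr k hc) hc1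
    · exact ⟨k, hk⟩
  have hnc : ∀ c d : G, c * c = 1 → d * d = 1 → c ≠ 1 → d ≠ 1 → c ≠ d → ¬ Commute c d := by
    intro c d hc hd hc1 hd1 hne hcd
    obtain ⟨i, hi⟩ := hinv c hc hc1
    obtain ⟨j, hj⟩ := hinv d hd hd1
    have e : c * d = (s * t) ^ (i - j) := by
      rw [hi, hj, mul_assoc, ← mul_assoc s, refl_zpow hs ht, mul_assoc _ s s, hs,
        mul_one, ← zpow_add, sub_eq_add_neg]
    have h2 := (comm_iff hc hd).mp hcd
    rw [e, pow_two] at h2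
    have h3 := hr _ h2
    rw [← e] at h3
    exact hne (inv_mul_eq_one hd h3)
  have s1 : s ≠ 1 := by
    rintro rfl
    have : orderOf (1 * t) ∣ 2 := by
      rw [orderOf_dvd_iff_pow_eq_one, pow_two, one_mul, ht]
    have h3 : (orderOf (1 * t)).Coprime 2 := Nat.coprime_two_right.mpr hodd
    have h4 := Nat.dvd_one.mp (h3 ▸ Nat.dvd_gcd dvd_rfl this)
    rw [orderOf_eq_one_iff, one_mul] at h4
    exact hst h4.symm
  have t1 : t ≠ 1 := by
    rintro rfl
    have : orderOf (s * 1) ∣ 2 := by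
      rw [orderOf_dvd_iff_pow_eq_one, pow_two, mul_one, hs]
    have h3 : (orderOf (s * 1)).Coprime 2 := Nat.coprime_two_right.mpr hodd
    have h4 := Nat.dvd_one.mp (h3 ▸ Nat.dvd_gcd dvd_rfl this)
    rw [orderOf_eq_one_iff, mul_one] at h4
    exact hst h4
  have hN : NoTriple ({s, t} : Set G) := by
    intro a ha b hb c hc hab h1 h2
    have hne : a ≠ b := by rintro rfl; exact hab (Commute.refl _)
    exfalso
    rcases ha with rfl | rfl <;> rcases hb with rfl | rfl <;> rcases hc with rfl | rfl <;>
      simp_all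
  have hNS := noTriple_of_good gen (by rintro a (rfl | rfl) <;> assumption) hN hS
  have hex : ∃ a ∈ S, ∃ b ∈ S, ¬ Commute a b := by
    by_contra hcon
    push Not at hcon
    have := comm_of_gen hS.gen (MonoidHom.id G) hcon s t
    exact hnc s t hs ht s1 t1 hst this
  obtain ⟨a, ha, b, hb, hab⟩ := hex
  refine ⟨a, b, ?_, hab, ?_⟩
  · rintro rfl; exact hab (Commute.refl _)
  · apply Set.Subset.antisymm
    · intro c hc
      by_contra hcc
      simp only [Set.mem_insert_iff, Set.mem_singleton_iff, not_or] at hcc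
      exact hnc c a (hS.inv c hc) (hS.inv a ha) (hS.ne_one hc) (hS.ne_one ha) hcc.1
        (hNS a ha b hb c hc hab hcc.1 hcc.2).1
    · rintro c (rfl | rfl) <;> assumption

theorem odd_match {G : Type} [Group G] [Finite G] {s t : G} (gen : closure {s, t} = ⊤)
    (hs : s * s = 1) (ht : t * t = 1) (hst : s ≠ t) (hodd : Odd (orderOf (s * t)))
    {S₁ S₂ : Set G} (h₁ : Good S₁) (h₂ : Good S₂) :
    ∃ ψ : S₁ ≃ S₂, ∀ a b : S₁, orderOf ((a : G) * b) = orderOf ((ψ a : G) * ψ b) := by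
  classical
  obtain ⟨a, b, hab, cab, e₁⟩ := odd_pair gen hs ht hst hodd h₁
  obtain ⟨c, d, hcd, ccd, e₂⟩ := odd_pair gen hs ht hst hodd h₂
  have ia := h₁.inv a (by simp [e₁])
  have ib := h₁.inv b (by simp [e₁])
  have ic := h₂.inv c (by simp [e₂])
  have id := h₂.inv d (by simp [e₂])
  have ho : orderOf (a * b) = orderOf (c * d) := by
    apply Nat.dvd_antisymm
    · exact dih_order ic id (by rw [← e₂, h₂.gen]; trivial) (by rw [← e₂, h₂.gen]; trivial)
        ia ib cab
    · exact dih_order ia ib (by rw [← e₁, h₁.gen]; trivial) (by rw [← e₁, h₁.gen]; trivial)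
        ic id ccd
  subst e₁
  subst e₂
  have ψ : ∃ ψ : ({a, b} : Set G) ≃ ({c, d} : Set G), (ψ ⟨a, by simp⟩ : G) = c ∧
      (ψ ⟨b, by simp⟩ : G) = d := by
    refine ⟨⟨fun x => if (x : G) = a then ⟨c, by simp⟩ else ⟨d, by simp⟩,
      fun x => if (x : G) = c then ⟨a, by simp⟩ else ⟨b, by simp⟩, ?_, ?_⟩, ?_, ?_⟩
    · rintro ⟨x, rfl | rfl⟩ <;> simp [hab.symm, hcd.symm]
    · rintro ⟨x, rfl | rfl⟩ <;> simp [hab.symm, hcd.symm]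
    · simp
    · simp [hab.symm]
  obtain ⟨ψ, p1, p2⟩ := ψ
  refine ⟨ψ, ?_⟩
  rintro ⟨x, rfl | rfl⟩ ⟨y, rfl | rfl⟩
  · rw [p1]; simp only []; rw [ia, ic]
  · rw [p1, p2]; exact ho
  · rw [p1, p2, orderOf_mul_comm' d c, ← ho]; exact orderOf_mul_comm' _ _
  · rw [p2]; simp only []; rw [ib, id]

end MSR

namespace MSR

theorem order_two {G : Type} [Group G] {a b : G} (ha : a * a = 1) (hb : b * b = 1)
    (hne : a ≠ b) (h : Commute a b) : orderOf (a * b) = 2 :=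
  orderOf_eq_prime ((comm_iff ha hb).mp h) (fun h1 => hne (inv_mul_eq_one hb h1))

/-- Homomorphisms supported on a single edge. -/
theorem edge_lift {G H : Type} [Group G] [Group H] {S : Set G} (hS : Good S) (hN : NoTriple S)
    {a b : G} (ha : a ∈ S) (hb : b ∈ S) (hab : ¬ Commute a b) {A B : H} (hA : A * A = 1)
    (hB : B * B = 1) (hAB : (A * B) ^ orderOf (a * b) = 1) :
    ∃ χ : G →* H, χ a = A ∧ χ b = B ∧ ∀ c ∈ S, c ≠ a → c ≠ b → χ c = 1 := by
  classical
  have hne : a ≠ b := by rintro rfl; exact hab (Commute.refl _)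
  have hA2 : A ^ 2 = 1 := by rw [pow_two, hA]
  have hB2 : B ^ 2 = 1 := by rw [pow_two, hB]
  have hBA : (B * A) ^ orderOf (b * a) = 1 := by
    rw [orderOf_mul_comm']
    have : B * A = (A * B)⁻¹ := by
      rw [mul_inv_rev, inv_eq_of_mul_eq_one_left hA, inv_eq_of_mul_eq_one_left hB]
    rw [this, inv_pow, hAB, inv_one]
  have hoth : ∀ c ∈ S, c ≠ a → c ≠ b → orderOf (a * c) = 2 ∧ orderOf (b * c) = 2 ∧
      orderOf (c * a) = 2 ∧ orderOf (c * b) = 2 := by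
    intro c hc h1 h2
    have h := hN a ha b hb c hc hab h1 h2
    have i1 := hS.inv a ha
    have i2 := hS.inv b hb
    have i3 := hS.inv c hc
    exact ⟨order_two i1 i3 h1.symm h.1.symm, order_two i2 i3 h2.symm h.2.symm,
      order_two i3 i1 h1 h.1, order_two i3 i2 h2 h.2⟩
  obtain ⟨χ, hχ⟩ := hS.lift (fun x => if x = a then A else if x = b then B else 1) (by
    intro x hx y hy
    by_cases xa : x = a
    · subst xa
      by_cases ya : y = x
      · subst ya; simp [hA]
      by_cases yb : y = b
      · subst yb; simpa [ya] using hAB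
      simp [ya, yb, (hoth y hy ya yb).1, hA2]
    by_cases xb : x = b
    · subst xb
      by_cases ya : y = a
      · subst ya; simpa [xa] using hBA
      by_cases yb : y = x
      · subst yb; simp [xa, hB]
      simp [ya, yb, xa, (hoth y hy ya yb).2.1, hB2]
    have h := (hoth x hx xa xb).2.2
    by_cases ya : y = a
    · subst ya; simp [xa, xb, h.1, hA2]
    by_cases yb : y = b
    · subst yb; simp [xa, xb, ya, h.2, hB2]
    simp [xa, xb, ya, yb])
  refine ⟨χ, ?_, ?_, ?_⟩
  · rw [hχ a ha]; simp
  · rw [hχ b hb]; simp [hne.symm]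
  · intro c hc h1 h2
    rw [hχ c hc]; simp [h1, h2]

theorem decomp {G : Type} [Group G] {T : Set G} (gen : closure T = ⊤) (hN : NoTriple T)
    {s t : G} (hs : s ∈ T) (ht : t ∈ T) (hst : ¬ Commute s t) (g : G) :
    ∃ g₀ ∈ closure {s, t}, ∃ g' : G, (∀ x ∈ closure {s, t}, Commute g' x) ∧ g = g₀ * g' := by
  have hg : g ∈ closure T := gen ▸ mem_top g
  induction hg using closure_induction with
  | mem u hu =>
    by_cases h1 : u = s
    · exact ⟨u, subset_closure (by simp [h1]), 1, fun _ _ => Commute.one_left _, by simp⟩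
    by_cases h2 : u = t
    · exact ⟨u, subset_closure (by simp [h2]), 1, fun _ _ => Commute.one_left _, by simp⟩
    have h := hN s hs t ht u hu hst h1 h2
    refine ⟨1, one_mem _, u, ?_, by simp⟩
    intro x hx
    induction hx using closure_induction with
    | mem x hx => rcases hx with rfl | rfl; exacts [h.1, h.2]
    | one => simp
    | mul a b _ _ ha hb => exact ha.mul_right hb
    | inv a _ ha => exact ha.inv_right
  | one => exact ⟨1, one_mem _, 1, fun _ _ => Commute.one_left _, by simp⟩
  | mul a b _ _ ha hb =>
    obtain ⟨a₀, ha₀, a', ha', rfl⟩ := ha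
    obtain ⟨b₀, hb₀, b', hb', rfl⟩ := hb
    refine ⟨a₀ * b₀, mul_mem ha₀ hb₀, a' * b', fun x hx => (ha' x hx).mul_left (hb' x hx), ?_⟩
    have : a' * b₀ = b₀ * a' := ha' b₀ hb₀
    calc a₀ * a' * (b₀ * b') = a₀ * (a' * b₀) * b' := by group
      _ = _ := by rw [this]; group
  | inv a _ ha =>
    obtain ⟨a₀, ha₀, a', ha', rfl⟩ := ha
    refine ⟨a₀⁻¹, inv_mem ha₀, a'⁻¹, fun x hx => (ha' x hx).inv_left, ?_⟩
    rw [mul_inv_rev]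
    exact ((ha' _ (inv_mem ha₀)).inv_left)

theorem nat_aux {d e Q : ℕ} (h : d ∣ 2 ^ e * Q) (h4 : ¬ 4 ∣ d) (hQ : Odd Q) : d ∣ 2 * Q := by
  have hd : d ≠ 0 := by rintro rfl; exact h4 (dvd_zero _)
  obtain ⟨f, q, hq, rfl⟩ := Nat.exists_eq_two_pow_mul_odd hd
  have h1 : q ∣ Q := by
    have : q ∣ 2 ^ e * Q := (Dvd.intro_left _ rfl).trans h
    exact (Nat.Coprime.pow_right e (Nat.coprime_two_right.mpr hq)).dvd_of_dvd_mul_left this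
  have h2 : f ≤ 1 := by
    by_contra hf
    apply h4
    have : 2 ^ 2 ∣ 2 ^ f := pow_dvd_pow 2 (by omega)
    exact (this.trans (Dvd.intro _ rfl))
  exact mul_dvd_mul (by simpa using pow_dvd_pow 2 h2) h1

theorem four_dvd {G : Type} [Group G] [Finite G] {T S : Set G} (gen : closure T = ⊤)
    (inv : ∀ a ∈ T, a * a = 1) (hN : NoTriple T)
    (h4 : ∀ s ∈ T, ∀ t ∈ T, ¬ Commute s t → 4 ∣ orderOf (s * t))
    (hS : Good S) (hNS : NoTriple S) :
    ∀ a ∈ S, ∀ b ∈ S, ¬ Commute a b → 4 ∣ orderOf (a * b) := by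
  intro a ha b hb hab
  by_contra hm
  obtain ⟨p, pa, pb, po⟩ := edge_lift hS hNS ha hb hab (hS.inv a ha) (hS.inv b hb)
    (pow_orderOf_eq_one _)
  have hpr : ∀ g, p g ∈ closure {a, b} := by
    intro g
    have hg : g ∈ closure S := hS.gen ▸ mem_top g
    induction hg using closure_induction with
    | mem c hc =>
      by_cases h1 : c = a
      · rw [h1, pa]; exact subset_closure (by simp)
      by_cases h2 : c = b
      · rw [h2, pb]; exact subset_closure (by simp)
      rw [po c hc h1 h2]; exact one_mem _
    | one => rw [map_one]; exact one_mem _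
    | mul x y _ _ hx hy => rw [map_mul]; exact mul_mem hx hy
    | inv x _ hx => rw [map_inv]; exact inv_mem hx
  have hpi : ∀ x ∈ closure {a, b}, p x = x := by
    intro x hx
    induction hx using closure_induction with
    | mem x hx => rcases hx with rfl | rfl <;> assumption
    | one => simp
    | mul x y _ _ hx hy => rw [map_mul, hx, hy]
    | inv x _ hx => rw [map_inv, hx]
  have hcj : ∀ g, ∀ x ∈ closure {a, b}, g * x * g⁻¹ = p g * x * (p g)⁻¹ := by
    intro g
    have hg : g ∈ closure S := hS.gen ▸ mem_top g
    induction hg using closure_induction with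
    | mem c hc =>
      intro x hx
      by_cases h1 : c = a
      · rw [h1, pa]
      by_cases h2 : c = b
      · rw [h2, pb]
      rw [po c hc h1 h2]
      have h := hNS a ha b hb c hc hab h1 h2
      have : Commute c x := by
        induction hx using closure_induction with
        | mem x hx => rcases hx with rfl | rfl; exacts [h.1, h.2]
        | one => simp
        | mul a b _ _ ha hb => exact ha.mul_right hb
        | inv a _ ha => exact ha.inv_right
      rw [this.eq]; group
    | one => intro x hx; simp
    | mul g h _ _ hg hh =>
      intro x hx
      have e : g * h * x * (g * h)⁻¹ = g * (h * x * h⁻¹) * g⁻¹ := by group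
      rw [e, hh x hx, hg _ (mul_mem (mul_mem (hpr h) hx) (inv_mem (hpr h))), map_mul]
      group
    | inv g _ hg =>
      intro x hx
      have := hg ((p g)⁻¹ * x * p g) (mul_mem (mul_mem (inv_mem (hpr g)) hx) (hpr g))
      have e : p g * ((p g)⁻¹ * x * p g) * (p g)⁻¹ = x := by group
      rw [e] at this
      rw [map_inv]
      calc g⁻¹ * x * g⁻¹⁻¹ = g⁻¹ * (g * ((p g)⁻¹ * x * p g) * g⁻¹) * g := by
            rw [this, inv_inv]
        _ = _ := by group
  obtain ⟨s, hs, t, ht, hst⟩ : ∃ s ∈ T, ∃ t ∈ T, ¬ Commute (p s) (p t) := by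
    by_contra hcon
    push Not at hcon
    have := comm_of_gen gen p hcon a b
    rw [pa, pb] at this
    exact hab this
  have hst' : ¬ Commute s t := fun h => hst (h.map p)
  have is := inv s hs
  have it := inv t ht
  have ips : p s * p s = 1 := by rw [← map_mul, is, map_one]
  have ipt : p t * p t = 1 := by rw [← map_mul, it, map_one]
  have d1 : orderOf (p s * p t) ∣ orderOf (a * b) :=
    dih_order (hS.inv a ha) (hS.inv b hb) (hpr s) (hpr t) ips ipt hst
  have d2 : orderOf (p s * p t) ∣ orderOf (s * t) := by
    rw [← map_mul]; exact orderOf_map_dvd p _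
  have n4 := h4 s hs t ht hst'
  obtain ⟨e, Q, hQ, hn⟩ := Nat.exists_eq_two_pow_mul_odd (orderOf_pos (s * t)).ne'
  have d3 : orderOf (p s * p t) ∣ 2 * Q := by
    rw [hn] at d2
    exact nat_aux d2 (fun h => hm (h.trans d1)) hQ
  have hw : (p s * p t) ^ (Q : ℤ) * (p s * p t) ^ (Q : ℤ) = 1 := by
    rw [zpow_natCast, ← pow_add, ← two_mul]
    exact orderOf_dvd_iff_pow_eq_one.mp d3
  have c1 : Commute s (p s) := by
    have := hcj s (p s) (hpr s)
    rw [mul_inv_cancel_right] at this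
    exact mul_inv_eq_iff_eq_mul.mp this
  have c2 : Commute ((s * t) ^ (Q : ℤ)) (p s) := by
    have := hcj ((s * t) ^ (Q : ℤ)) (p s) (hpr s)
    have h2 := dih_rot (x := p s) ips ipt hw (subset_closure (by simp))
    rw [map_zpow, map_mul, h2.eq, mul_inv_cancel_right] at this
    exact mul_inv_eq_iff_eq_mul.mp this
  obtain ⟨g₀, hg₀, g', hg', hgg⟩ := decomp gen hN hs ht hst' (p s)
  have hsm : s ∈ closure {s, t} := subset_closure (by simp)
  have htm : t ∈ closure {s, t} := subset_closure (by simp)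
  have hg : g₀ = p s * g'⁻¹ := by rw [hgg]; group
  have c3 : Commute s g₀ := by
    rw [hg]; exact c1.mul_right (hg' s hsm).symm.inv_right
  have c4 : Commute ((s * t) ^ (Q : ℤ)) g₀ := by
    rw [hg]; exact c2.mul_right (hg' _ (zpow_mem (mul_mem hsm htm) _)).symm.inv_right
  have c5 : Commute g₀ t := by
    obtain ⟨k, hk | hk⟩ := dih_elem is it hg₀
    · rw [hk] at c3 ⊢
      have h1 := refl_zpow is it k
      rw [c3.eq] at h1
      have h2 := mul_right_cancel h1
      refine dih_rot is it ?_ htm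
      nth_rewrite 1 [h2]
      rw [← zpow_add]; simp
    · exfalso
      rw [hk] at c4
      have h1 : (s * t) ^ k * s * (s * t) ^ (Q : ℤ) = (s * t) ^ k * ((s * t) ^ (-(Q : ℤ)) * s) := by
        rw [mul_assoc, refl_zpow is it]
      rw [← c4.eq, ← mul_assoc, ← mul_assoc, ← zpow_add, ← zpow_add] at h1
      have h2 := mul_right_cancel h1
      have h3 : (s * t) ^ (2 * Q) = 1 := by
        rw [← zpow_natCast]
        have : ((2 * Q : ℕ) : ℤ) = (Q + k) - (k + -(Q : ℤ)) := by push_cast; ring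
        rw [this, zpow_sub, h2, mul_inv_cancel]
      have h5 := n4.trans (orderOf_dvd_iff_pow_eq_one.mpr h3)
      obtain ⟨q, rfl⟩ := hQ
      omega
  have c6 : Commute (p s) t := by
    rw [hgg]; exact c5.mul_left (hg' t htm)
  have c7 := c6.map p
  rw [hpi _ (hpr s)] at c7
  exact hst c7

end MSR

namespace MSR

open scoped commutatorElement

/-- The map of dihedral groups induced by a map of rotation groups. -/
def dmap {m n : ℕ} (f : ZMod m →+ ZMod n) : DihedralGroup m →* DihedralGroup n where
  toFun x := match x with
    | .r i => .r (f i)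
    | .sr i => .sr (f i)
  map_one' := by
    rw [DihedralGroup.one_def]; simp
  map_mul' x y := by
    cases x <;> cases y <;> simp

@[simp] theorem dmap_r {m n : ℕ} (f : ZMod m →+ ZMod n) (i : ZMod m) :
    dmap f (.r i) = .r (f i) := rfl

@[simp] theorem dmap_sr {m n : ℕ} (f : ZMod m →+ ZMod n) (i : ZMod m) :
    dmap f (.sr i) = .sr (f i) := rfl

theorem comm_sr {m : ℕ} {i j : ZMod m} :
    Commute (DihedralGroup.sr i) (DihedralGroup.sr j) ↔ 2 * (j - i) = 0 := by
  rw [commute_iff_eq]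
  simp only [DihedralGroup.sr_mul_sr, DihedralGroup.r.injEq]
  constructor
  · intro h; linear_combination h
  · intro h; linear_combination h

theorem comm_r_sr {m : ℕ} {i j : ZMod m} :
    Commute (DihedralGroup.r i) (DihedralGroup.sr j) ↔ 2 * i = 0 := by
  rw [commute_iff_eq]
  simp only [DihedralGroup.r_mul_sr, DihedralGroup.sr_mul_r, DihedralGroup.sr.injEq]
  constructor
  · intro h; linear_combination -h
  · intro h; linear_combination -h

theorem comm_r_r {m : ℕ} {i j : ZMod m} :
    Commute (DihedralGroup.r i) (DihedralGroup.r j) := by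
  rw [commute_iff_eq]
  simp [add_comm]

theorem r_central {m : ℕ} {i : ZMod m} (h : 2 * i = 0) (w : DihedralGroup m) :
    Commute (DihedralGroup.r i) w := by
  cases w with
  | r j => exact comm_r_r
  | sr j => exact comm_r_sr.mpr h

theorem dih_central {m : ℕ} {x y z : DihedralGroup m} (hxy : ¬ Commute x y) (h1 : Commute z x)
    (h2 : Commute z y) (w : DihedralGroup m) : Commute z w := by
  cases z with
  | r i =>
    cases x with
    | r j =>
      cases y with
      | r k => exact absurd comm_r_r hxy
      | sr k => exact r_central (comm_r_sr.mp h2) w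
    | sr j => exact r_central (comm_r_sr.mp h1) w
  | sr i =>
    exfalso
    cases x with
    | r j => exact hxy (r_central (comm_r_sr.mp h1.symm) y)
    | sr j =>
      cases y with
      | r k => exact hxy (r_central (comm_r_sr.mp h2.symm) _).symm
      | sr k =>
        rw [comm_sr] at h1 h2 hxy
        apply hxy
        linear_combination h2 - h1

theorem d4_comm : ∀ x y : DihedralGroup 4, ¬ x * y = y * x →
    x * y * x⁻¹ * y⁻¹ = DihedralGroup.r 2 := by decide

set_option maxRecDepth 100000 in
theorem d4_mul : ∀ x y z : DihedralGroup 4,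
    x * y * z * (x * y)⁻¹ * z⁻¹ = (x * z * x⁻¹ * z⁻¹) * (y * z * y⁻¹ * z⁻¹) := by decide

theorem d4_inv : ∀ x z : DihedralGroup 4,
    x⁻¹ * z * (x⁻¹)⁻¹ * z⁻¹ = (x * z * x⁻¹ * z⁻¹)⁻¹ := by decide

/-- The commutator pairing. -/
def lam {G : Type} [Group G] (χ : G →* DihedralGroup 4) : G → G → DihedralGroup 4 :=
  fun x y => ⁅χ x, χ y⁆

theorem lam_one_iff {G : Type} [Group G] (χ : G →* DihedralGroup 4) (x y : G) :
    lam χ x y = 1 ↔ Commute (χ x) (χ y) := commutatorElement_eq_one_iff_commute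

theorem lam_mul {G : Type} [Group G] (χ : G →* DihedralGroup 4) (x y z : G) :
    lam χ (x * y) z = lam χ x z * lam χ y z := by
  simp only [lam, commutatorElement_def, map_mul]
  exact d4_mul _ _ _

theorem lam_inv {G : Type} [Group G] (χ : G →* DihedralGroup 4) (x z : G) :
    lam χ x⁻¹ z = (lam χ x z)⁻¹ := by
  simp only [lam, commutatorElement_def, map_inv]
  exact d4_inv _ _

theorem lam_swap {G : Type} [Group G] (χ : G →* DihedralGroup 4) (x z : G) :
    lam χ x z = (lam χ z x)⁻¹ := by
  simp only [lam]
  exact (commutatorElement_inv _ _).symm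

theorem lam_eq_of_gen {G : Type} [Group G] {S : Set G} (gen : closure S = ⊤)
    (χ χ' : G →* DihedralGroup 4) (h : ∀ s ∈ S, ∀ t ∈ S, lam χ s t = lam χ' s t) :
    lam χ = lam χ' := by
  have ext1 : ∀ z : G, (∀ s ∈ S, lam χ s z = lam χ' s z) → ∀ x, lam χ x z = lam χ' x z := by
    intro z hz x
    have hx : x ∈ closure S := gen ▸ mem_top x
    induction hx using closure_induction with
    | mem s hs => exact hz s hs
    | one => simp [lam]
    | mul a b _ _ ha hb => rw [lam_mul, lam_mul, ha, hb]
    | inv a _ ha => rw [lam_inv, lam_inv, ha]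
  funext x y
  refine ext1 y (fun s hs => ?_) x
  rw [lam_swap χ, lam_swap χ']
  rw [ext1 s (fun t ht => h t ht s hs)]

/-- Key lemma: the pairing is determined by the edge. -/
theorem lam_eq {G : Type} [Group G] {S : Set G} (gen : closure S = ⊤) (hN : NoTriple S)
    {χ χ' : G →* DihedralGroup 4} {u v : G} (hu : u ∈ S) (hv : v ∈ S)
    (h : ¬ Commute (χ u) (χ v)) (h' : ¬ Commute (χ' u) (χ' v)) : lam χ = lam χ' := by
  have huv : ¬ Commute u v := fun hc => h (hc.map χ)
  have cen : ∀ ξ : G →* DihedralGroup 4, ¬ Commute (ξ u) (ξ v) → ∀ c ∈ S, c ≠ u → c ≠ v →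
      ∀ x, lam ξ c x = 1 := by
    intro ξ hξ c hc h1 h2 x
    rw [lam_one_iff]
    have := hN u hu v hv c hc huv h1 h2
    exact dih_central hξ (this.1.map ξ) (this.2.map ξ) _
  have two : ∀ ξ : G →* DihedralGroup 4, ¬ Commute (ξ u) (ξ v) →
      lam ξ u v = DihedralGroup.r 2 := fun ξ hξ => d4_comm _ _ hξ
  have slf : ∀ ξ : G →* DihedralGroup 4, ∀ x, lam ξ x x = 1 := by
    intro ξ x; rw [lam_one_iff]
  apply lam_eq_of_gen gen
  intro s hs t ht
  by_cases h1 : s ≠ u ∧ s ≠ v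
  · rw [cen χ h s hs h1.1 h1.2, cen χ' h' s hs h1.1 h1.2]
  by_cases h2 : t ≠ u ∧ t ≠ v
  · rw [lam_swap χ, lam_swap χ', cen χ h t ht h2.1 h2.2, cen χ' h' t ht h2.1 h2.2]
  have h1' : s = u ∨ s = v := by tauto
  have h2' : t = u ∨ t = v := by tauto
  rcases h1' with rfl | rfl <;> rcases h2' with rfl | rfl
  · rw [slf, slf]
  · rw [two χ h, two χ' h']
  · rw [lam_swap χ, lam_swap χ', two χ h, two χ' h']
  · rw [slf, slf]

open Classical in
/-- The invariant attached to a generator. -/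
noncomputable def ff {G : Type} [Group G] (S : Set G) (a : G) : G → G → DihedralGroup 4 :=
  if h : ∃ χ : G →* DihedralGroup 4, ∃ t ∈ S, ¬ Commute (χ a) (χ t) then lam h.choose
  else fun _ _ => 1

theorem ff_eq {G : Type} [Group G] {S : Set G} (gen : closure S = ⊤) (hN : NoTriple S)
    {a t : G} (ha : a ∈ S) (ht : t ∈ S) {χ : G →* DihedralGroup 4}
    (h : ¬ Commute (χ a) (χ t)) : ff S a = lam χ := by
  have hex : ∃ χ : G →* DihedralGroup 4, ∃ t ∈ S, ¬ Commute (χ a) (χ t) := ⟨χ, t, ht, h⟩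
  unfold ff
  rw [dif_pos hex]
  obtain ⟨u, hu, hau⟩ := hex.choose_spec
  have hat : ¬ Commute a t := fun hc => h (hc.map χ)
  have hut : u = t := by
    by_contra hne
    have h1 : u ≠ a := by rintro rfl; exact hau (Commute.refl _)
    have := (hN a ha t ht u hu hat h1 hne).1
    exact hau ((this.map _).symm)
  subst hut
  exact lam_eq gen hN ha hu hau h

theorem ff_ne_one {G : Type} [Group G] {S : Set G} {a : G} (h : ff S a ≠ fun _ _ => 1) :
    ∃ χ : G →* DihedralGroup 4, (∃ t ∈ S, ¬ Commute (χ a) (χ t)) ∧ ff S a = lam χ := by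
  unfold ff at h ⊢
  split_ifs at h ⊢ with hex
  · exact ⟨_, hex.choose_spec, rfl⟩
  · exact absurd rfl h

theorem lam_ne {G : Type} [Group G] {χ : G →* DihedralGroup 4} {x y : G}
    (h : ¬ Commute (χ x) (χ y)) : lam χ ≠ fun _ _ => 1 := by
  intro hl
  exact h ((lam_one_iff χ x y).mp (by rw [hl]))

theorem edge4 {G : Type} [Group G] {S : Set G} (hS : Good S) (hN : NoTriple S)
    (h4 : ∀ s ∈ S, ∀ t ∈ S, ¬ Commute s t → 4 ∣ orderOf (s * t)) {a b : G} (ha : a ∈ S)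
    (hb : b ∈ S) (hab : ¬ Commute a b) :
    ∃ χ : G →* DihedralGroup 4, ¬ Commute (χ a) (χ b) := by
  obtain ⟨k, hk⟩ := h4 a ha b hb hab
  obtain ⟨χ, ca, cb, -⟩ := edge_lift hS hN ha hb hab
    (A := (DihedralGroup.sr 0 : DihedralGroup 4)) (B := DihedralGroup.sr 1) (by decide) (by decide)
    (by
      rw [hk, pow_mul]
      have : (DihedralGroup.sr 0 * DihedralGroup.sr 1 : DihedralGroup 4) ^ 4 = 1 := by decide
      rw [this, one_pow])
  refine ⟨χ, ?_⟩
  rw [ca, cb, comm_sr]; decide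

theorem ff_adj {G : Type} [Group G] {S : Set G} (hS : Good S) (hN : NoTriple S)
    (h4 : ∀ s ∈ S, ∀ t ∈ S, ¬ Commute s t → 4 ∣ orderOf (s * t)) {a b : G} (ha : a ∈ S)
    (hb : b ∈ S) (hne : a ≠ b) :
    ¬ Commute a b ↔ (ff S a = ff S b ∧ ff S a ≠ fun _ _ => 1) := by
  constructor
  · intro hab
    obtain ⟨χ, hχ⟩ := edge4 hS hN h4 ha hb hab
    have e1 := ff_eq hS.gen hN ha hb hχ
    have e2 := ff_eq hS.gen hN hb ha (χ := χ) (fun h => hχ h.symm)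
    exact ⟨e1.trans e2.symm, by rw [e1]; exact lam_ne hχ⟩
  · rintro ⟨h1, h2⟩ hab
    obtain ⟨χ, ⟨t, ht, hχ⟩, e⟩ := ff_ne_one h2
    obtain ⟨χ', ⟨t', ht', hχ'⟩, e'⟩ := ff_ne_one (h1 ▸ h2)
    have hl : lam χ = lam χ' := by rw [← e, h1, e']
    have hat : ¬ Commute (χ' a) (χ' t) := by
      rw [← lam_one_iff, ← hl, lam_one_iff]; exact hχ
    have hat' : ¬ Commute a t := fun h => hat (h.map χ')
    have hbt : b ≠ t := by rintro rfl; exact hat' hab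
    have := hN a ha t ht b hb hat' hne.symm hbt
    exact hχ' (dih_central hat (this.1.map χ') (this.2.map χ') _)

theorem ff_exists {G : Type} [Group G] {S : Set G} (gen : closure S = ⊤) (hN : NoTriple S)
    {χ : G →* DihedralGroup 4} {x y : G} (h : ¬ Commute (χ x) (χ y)) :
    ∃ s ∈ S, ff S s = lam χ := by
  by_contra hcon
  apply h
  refine comm_of_gen gen χ ?_ x y
  intro s hs t ht
  by_contra hst
  exact hcon ⟨s, hs, ff_eq gen hN hs ht hst⟩

theorem ord_dvd {G : Type} [Group G] {S₁ S₂ : Set G} (hS₁ : Good S₁)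
    (hN₁ : NoTriple S₁) (hS₂ : Good S₂) (hN₂ : NoTriple S₂)
    (h4₁ : ∀ s ∈ S₁, ∀ t ∈ S₁, ¬ Commute s t → 4 ∣ orderOf (s * t))
    (h4₂ : ∀ s ∈ S₂, ∀ t ∈ S₂, ¬ Commute s t → 4 ∣ orderOf (s * t))
    {a b c d : G} (ha : a ∈ S₁) (hb : b ∈ S₁) (hab : ¬ Commute a b)
    (hc : c ∈ S₂) (hd : d ∈ S₂) (hcd : ¬ Commute c d) (hf : ff S₁ a = ff S₂ c) :
    orderOf (a * b) ∣ orderOf (c * d) := by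
  have m4 := h4₁ a ha b hb hab
  obtain ⟨m, hm⟩ : ∃ m, m = orderOf (a * b) := ⟨_, rfl⟩
  rw [← hm] at m4
  obtain ⟨χ, ca, cb, -⟩ := edge_lift hS₁ hN₁ ha hb hab
    (A := (DihedralGroup.sr 0 : DihedralGroup m)) (B := DihedralGroup.sr 1) (by simp) (by simp)
    (by rw [← hm]; simp)
  let π : DihedralGroup m →* DihedralGroup 4 := dmap (ZMod.castHom m4 (ZMod 4)).toAddMonoidHom
  have e1 : ff S₁ a = lam (π.comp χ) := by
    apply ff_eq hS₁.gen hN₁ ha hb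
    simp only [MonoidHom.comp_apply, ca, cb, π, dmap_sr]
    have z1 : (ZMod.castHom m4 (ZMod 4)).toAddMonoidHom 1 = 1 := map_one (ZMod.castHom m4 (ZMod 4))
    rw [comm_sr, z1, map_zero]
    decide
  obtain ⟨χ', hχ'⟩ := edge4 hS₂ hN₂ h4₂ hc hd hcd
  have e2 : ff S₂ c = lam χ' := ff_eq hS₂.gen hN₂ hc hd hχ'
  have hl : lam (π.comp χ) = lam χ' := by rw [← e1, hf, e2]
  have n1 : ¬ Commute (χ c) (χ d) := by
    intro h
    have : ¬ Commute (π.comp χ c) (π.comp χ d) := by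
      rw [← lam_one_iff, hl, lam_one_iff]; exact hχ'
    exact this (h.map π)
  have refl : ∀ u v, u * u = 1 → ¬ Commute (χ u) (χ v) → ∃ x, χ u = DihedralGroup.sr x := by
    intro u v hu huv
    have h1 : χ u * χ u = 1 := by rw [← map_mul, hu, map_one]
    cases hh : χ u with
    | sr x => exact ⟨x, rfl⟩
    | r i =>
      exfalso
      rw [hh] at h1 huv
      apply huv
      apply r_central
      rw [DihedralGroup.r_mul_r, DihedralGroup.one_def, DihedralGroup.r.injEq] at h1
      rw [two_mul, h1]
  obtain ⟨x, hx⟩ := refl c d (hS₂.inv c hc) n1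
  obtain ⟨y, hy⟩ := refl d c (hS₂.inv d hd) (fun h => n1 h.symm)
  obtain ⟨n, hn⟩ : ∃ n, n = orderOf (c * d) := ⟨_, rfl⟩
  have n4 := h4₂ c hc d hd hcd
  rw [← hm, ← hn]
  rw [← hn] at n4
  obtain ⟨h, hh⟩ : ∃ h, n = 2 * h := by
    obtain ⟨q, hq⟩ := n4; exact ⟨2 * q, by omega⟩
  have hxy : (n : ZMod m) * (y - x) = 0 := by
    have h1 : (χ (c * d)) ^ n = 1 := by rw [← map_pow, hn, pow_orderOf_eq_one, map_one]
    rw [map_mul, hx, hy, DihedralGroup.sr_mul_sr, DihedralGroup.r_pow, DihedralGroup.one_def,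
      DihedralGroup.r.injEq] at h1
    linear_combination h1
  let η : G →* DihedralGroup m := (dmap (AddMonoidHom.mulLeft (h : ZMod m))).comp χ
  have hcom : ∀ s ∈ S₂, ∀ t ∈ S₂, Commute (η s) (η t) := by
    have cd : Commute (η c) (η d) := by
      simp only [η, MonoidHom.comp_apply, hx, hy, dmap_sr]
      rw [comm_sr]
      simp only [AddMonoidHom.coe_mulLeft]
      rw [hh] at hxy
      push_cast at hxy
      linear_combination hxy
    have cen : ∀ s ∈ S₂, s ≠ c → s ≠ d → ∀ t, Commute (η s) (η t) := by
      intro s hs h1 h2 t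
      have := hN₂ c hc d hd s hs hcd h1 h2
      exact (dih_central n1 (this.1.map χ) (this.2.map χ) (χ t)).map
        (dmap (AddMonoidHom.mulLeft (h : ZMod m)))
    intro s hs t ht
    by_cases h1 : s ≠ c ∧ s ≠ d
    · exact cen s hs h1.1 h1.2 t
    by_cases h2 : t ≠ c ∧ t ≠ d
    · exact (cen t ht h2.1 h2.2 s).symm
    have h1' : s = c ∨ s = d := by tauto
    have h2' : t = c ∨ t = d := by tauto
    rcases h1' with rfl | rfl <;> rcases h2' with rfl | rfl
    · exact Commute.refl _
    · exact cd
    · exact cd.symm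
    · exact Commute.refl _
  have fin := comm_of_gen hS₂.gen η hcom a b
  simp only [η, MonoidHom.comp_apply, ca, cb, dmap_sr] at fin
  rw [comm_sr] at fin
  simp only [AddMonoidHom.coe_mulLeft, mul_one, mul_zero, sub_zero] at fin
  rw [← ZMod.natCast_eq_zero_iff, hh]
  push_cast
  exact fin

end MSR

namespace MSR

theorem fiber_match {α β X : Type} [Finite α] [Finite β] (f : α → X) (g : β → X) (x₀ : X)
    (hc : Nat.card α = Nat.card β)
    (hx : ∀ x, x ≠ x₀ → Nat.card {a // f a = x} = Nat.card {b // g b = x}) :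
    ∃ ψ : α ≃ β, ∀ a, g (ψ a) = f a := by
  classical
  have h0 : Nat.card {a // f a = x₀} = Nat.card {b // g b = x₀} := by
    have e : {a // ¬ f a = x₀} ≃ {b // ¬ g b = x₀} := by
      refine Equiv.ofFiberEquiv (f := fun a : {a // ¬ f a = x₀} => f a)
        (g := fun b : {b // ¬ g b = x₀} => g b) (fun x => ?_)
      by_cases h : x = x₀
      · have i1 : IsEmpty {a : {a // ¬ f a = x₀} // f a = x} :=
          ⟨fun a => a.1.2 (a.2.trans h)⟩
        have i2 : IsEmpty {b : {b // ¬ g b = x₀} // g b = x} :=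
          ⟨fun b => b.1.2 (b.2.trans h)⟩
        exact Equiv.equivOfIsEmpty _ _
      · have e1 : {a : {a // ¬ f a = x₀} // f a = x} ≃ {a // f a = x} :=
          Equiv.subtypeSubtypeEquivSubtype (p := fun a => ¬ f a = x₀) (q := fun a => f a = x)
            (fun {a} ha hb => h (ha.symm.trans hb))
        have e2 : {b : {b // ¬ g b = x₀} // g b = x} ≃ {b // g b = x} :=
          Equiv.subtypeSubtypeEquivSubtype (p := fun a => ¬ g a = x₀) (q := fun a => g a = x)
            (fun {a} ha hb => h (ha.symm.trans hb))
        exact e1.trans ((Finite.card_eq.mp (hx x h)).some.trans e2.symm)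
    have t1 := Nat.card_congr (Equiv.sumCompl (fun a => f a = x₀))
    have t2 := Nat.card_congr (Equiv.sumCompl (fun b => g b = x₀))
    have t3 := Nat.card_congr e
    rw [Nat.card_sum] at t1 t2
    omega
  have hall : ∀ x, Nonempty ({a // f a = x} ≃ {b // g b = x}) := by
    intro x
    have : Nat.card {a // f a = x} = Nat.card {b // g b = x} := by
      by_cases h : x = x₀
      · rw [h, h0]
      · exact hx x h
    exact Finite.card_eq.mp this
  exact ⟨Equiv.ofFiberEquiv (fun x => (hall x).some), fun a => Equiv.ofFiberEquiv_map _ a⟩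

theorem card_hom {G : Type} [Group G] {S : Set G} (hS : Good S)
    (h4 : ∀ s ∈ S, ∀ t ∈ S, ¬ Commute s t → 4 ∣ orderOf (s * t)) :
    Nat.card (G →* Multiplicative (ZMod 2)) = 2 ^ Nat.card S := by
  classical
  have hsq : ∀ x : Multiplicative (ZMod 2), x ^ 2 = 1 := by decide
  have : Finite S := hS.fin
  have hb : Function.Bijective (fun (χ : G →* Multiplicative (ZMod 2)) (s : S) => χ s) := by
    constructor
    · intro χ χ' h
      apply MonoidHom.eq_of_eqOn_dense hS.gen
      intro s hs
      exact congrFun h ⟨s, hs⟩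
    · intro f
      obtain ⟨χ, hχ⟩ := hS.lift (fun x => if hx : x ∈ S then f ⟨x, hx⟩ else 1) (by
        intro a ha b hb
        by_cases hab : a = b
        · subst hab
          rw [← pow_two, hsq, one_pow]
        have : 2 ∣ orderOf (a * b) := by
          by_cases hc : Commute a b
          · rw [order_two (hS.inv a ha) (hS.inv b hb) hab hc]
          · exact dvd_trans (by norm_num) (h4 a ha b hb hc)
        obtain ⟨k, hk⟩ := this
        rw [hk, pow_mul, hsq, one_pow])
      refine ⟨χ, ?_⟩
      funext s
      simp only []
      rw [hχ s s.2, dif_pos s.2]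
  rw [Nat.card_congr (Equiv.ofBijective _ hb), Nat.card_fun]
  congr 1
  simp

theorem fiber_card {G : Type} [Group G] {S : Set G} (hS : Good S) (hN : NoTriple S)
    (h4 : ∀ s ∈ S, ∀ t ∈ S, ¬ Commute s t → 4 ∣ orderOf (s * t)) {a : G} (ha : a ∈ S)
    (hne : ff S a ≠ fun _ _ => 1) : Nat.card {s : S // ff S s = ff S a} = 2 := by
  obtain ⟨χ, ⟨b, hb, hχ⟩, e⟩ := ff_ne_one hne
  have hab : ¬ Commute a b := fun h => hχ (h.map χ)
  have hab' : a ≠ b := by rintro rfl; exact hab (Commute.refl _)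
  have hfb : ff S b = ff S a := (((ff_adj hS hN h4 ha hb hab').mp hab).1).symm
  rw [Nat.card_eq_two_iff]
  refine ⟨⟨⟨a, ha⟩, rfl⟩, ⟨⟨b, hb⟩, hfb⟩, ?_, ?_⟩
  · intro h
    simp only [Subtype.mk.injEq] at h
    exact hab' h
  · rw [Set.eq_univ_iff_forall]
    rintro ⟨⟨c, hc⟩, hfc⟩
    simp only [Set.mem_insert_iff, Set.mem_singleton_iff, Subtype.mk.injEq]
    by_contra hcon
    push Not at hcon
    have h1 : ¬ Commute a c := (ff_adj hS hN h4 ha hc hcon.1.symm).mpr ⟨hfc.symm, hne⟩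
    exact h1 ((hN a ha b hb c hc hab hcon.1 hcon.2).1.symm)

theorem even_match {G : Type} [Group G] {S₁ S₂ : Set G} (h₁ : Good S₁)
    (N₁ : NoTriple S₁) (h₂ : Good S₂) (N₂ : NoTriple S₂)
    (f₁ : ∀ s ∈ S₁, ∀ t ∈ S₁, ¬ Commute s t → 4 ∣ orderOf (s * t))
    (f₂ : ∀ s ∈ S₂, ∀ t ∈ S₂, ¬ Commute s t → 4 ∣ orderOf (s * t)) :
    ∃ ψ : S₁ ≃ S₂, ∀ a b : S₁, orderOf ((a : G) * b) = orderOf ((ψ a : G) * ψ b) := by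
  have : Finite S₁ := h₁.fin
  have : Finite S₂ := h₂.fin
  have hc : Nat.card S₁ = Nat.card S₂ := by
    have := (card_hom h₁ f₁).symm.trans (card_hom h₂ f₂)
    exact Nat.pow_right_injective le_rfl this
  have half : ∀ {S S' : Set G}, Good S' → NoTriple S' →
      ∀ a : G, ff S a ≠ (fun _ _ => 1) → ∃ s ∈ S', ff S' s = ff S a := by
    intro S S' g' n' a hne
    obtain ⟨χ, ⟨t, ht, hχ⟩, e⟩ := ff_ne_one hne
    obtain ⟨s, hs, hh⟩ := ff_exists g'.gen n' hχ
    exact ⟨s, hs, hh.trans e.symm⟩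
  obtain ⟨ψ, hψ⟩ := fiber_match (fun s : S₁ => ff S₁ s) (fun s : S₂ => ff S₂ s)
    (fun _ _ => 1) hc (by
      intro x hx
      by_cases hex : ∃ a : S₁, ff S₁ a = x
      · obtain ⟨a, rfl⟩ := hex
        obtain ⟨s, hs, hh⟩ := half h₂ N₂ (a : G) hx
        rw [fiber_card h₁ N₁ f₁ a.2 hx, ← hh, fiber_card h₂ N₂ f₂ hs (by rwa [hh])]
      · have hex' : ¬ ∃ a : S₂, ff S₂ a = x := by
          rintro ⟨a, rfl⟩
          obtain ⟨s, hs, hh⟩ := half h₁ N₁ (a : G) hx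
          exact hex ⟨⟨s, hs⟩, hh⟩
        have i1 : IsEmpty {a : S₁ // ff S₁ a = x} := ⟨fun a => hex ⟨a.1, a.2⟩⟩
        have i2 : IsEmpty {a : S₂ // ff S₂ a = x} := ⟨fun a => hex' ⟨a.1, a.2⟩⟩
        rw [Nat.card_of_isEmpty, Nat.card_of_isEmpty])
  refine ⟨ψ, fun a b => ?_⟩
  by_cases hab : a = b
  · subst hab
    rw [h₁.inv _ a.2, h₂.inv _ (ψ a).2]
  have hab' : (a : G) ≠ b := fun h => hab (Subtype.ext h)
  have hψ' : (ψ a : G) ≠ ψ b := fun h => hab (ψ.injective (Subtype.ext h))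
  have k1 := ff_adj h₁ N₁ f₁ a.2 b.2 hab'
  have k2 := ff_adj h₂ N₂ f₂ (ψ a).2 (ψ b).2 hψ'
  have pa := hψ a
  have pb := hψ b
  rw [pa, pb] at k2
  have k := k1.trans k2.symm
  by_cases hcm : Commute (a : G) b
  · rw [order_two (h₁.inv _ a.2) (h₁.inv _ b.2) hab' hcm,
      order_two (h₂.inv _ (ψ a).2) (h₂.inv _ (ψ b).2) hψ' (by
        by_contra hcon
        exact (k.mpr hcon) hcm)]
  · have hcm' := k.mp hcm
    apply Nat.dvd_antisymm
    · exact ord_dvd h₁ N₁ h₂ N₂ f₁ f₂ a.2 b.2 hcm (ψ a).2 (ψ b).2 hcm' pa.symm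
    · exact ord_dvd h₂ N₂ h₁ N₁ f₂ f₁ (ψ a).2 (ψ b).2 hcm' a.2 b.2 hcm pa

end MSR

/-- Under (0) and (1), every maximal spherical subset is strong even or an odd pair,
and the corresponding finite parabolic subgroup is rigid. -/
theorem max_spherical_rigid {W : Type} [Group W] (S : Set W) (hS : IsCoxGenSet S)
    (h0 : Cond0 S) (h1 : Cond1 S) (T : Set W) (hT : IsMaxSpherical S T) :
    (IsStrongEvenSet T ∨ ∃ s t : W, s ≠ t ∧ T = {s, t} ∧ Odd (orderOf (s * t))) ∧
    (∀ S₁ S₂ : Set ↥(Subgroup.closure T), IsCoxGenSet S₁ → IsCoxGenSet S₂ →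
      ∃ ψ : S₁ ≃ S₂, ∀ a b : S₁,
        orderOf ((a : ↥(Subgroup.closure T)) * (b : ↥(Subgroup.closure T))) =
        orderOf ((ψ a : ↥(Subgroup.closure T)) * (ψ b : ↥(Subgroup.closure T)))) := by
  have hG := MSR.good_of hS
  have hTS : T ⊆ S := hT.1.1
  have hfin : Finite ↥(Subgroup.closure T) := hT.1.2
  have hgen : closure ((↑) ⁻¹' T : Set ↥(closure T)) = ⊤ := closure_closure_coe_preimage
  have hinv : ∀ a ∈ ((↑) ⁻¹' T : Set ↥(closure T)), a * a = 1 := by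
    intro a ha
    exact Subtype.ext (hG.inv a (hTS ha))
  have hsub : ∀ s ∈ T, s ∈ closure T := fun s hs => subset_closure hs
  by_cases hodd : ∃ s ∈ T, ∃ t ∈ T, s ≠ t ∧ Odd (orderOf (s * t))
  · obtain ⟨s, hs, t, ht, hst, ho⟩ := hodd
    have hTe : T = {s, t} := (h1 s (hTS hs) t (hTS ht) hst ho).2 T hT.1 (by
      rintro x (rfl | rfl) <;> assumption)
    refine ⟨Or.inr ⟨s, t, hst, hTe, ho⟩, fun S₁ S₂ h₁ h₂ => ?_⟩
    have hpre : ((↑) ⁻¹' T : Set ↥(closure T)) = {⟨s, hsub s hs⟩, ⟨t, hsub t ht⟩} := by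
      ext x
      simp only [Set.mem_preimage, Set.mem_insert_iff, Set.mem_singleton_iff, Subtype.ext_iff]
      constructor
      · intro hx
        have : (x : W) ∈ ({s, t} : Set W) := hTe ▸ hx
        exact this
      · rintro (h | h) <;> rw [h] <;> assumption
    rw [hpre] at hgen
    refine MSR.odd_match hgen (Subtype.ext (hG.inv s (hTS hs))) (Subtype.ext (hG.inv t (hTS ht)))
      (fun h => hst (congrArg Subtype.val h)) ?_ (MSR.good_of h₁) (MSR.good_of h₂)
    rw [← Subgroup.orderOf_coe]
    exact ho
  · push Not at hodd
    have hse : IsStrongEvenSet T := by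
      intro s hs t ht hst
      exact h0 s (hTS hs) t (hTS ht) hst (Nat.not_odd_iff_even.mp (hodd s hs t ht hst))
    refine ⟨Or.inl hse, fun S₁ S₂ h₁ h₂ => ?_⟩
    have h4 : ∀ s ∈ ((↑) ⁻¹' T : Set ↥(closure T)), ∀ t ∈ ((↑) ⁻¹' T : Set ↥(closure T)),
        ¬ Commute s t → 4 ∣ orderOf (s * t) := by
      intro s hs t ht hst
      have hne : (s : W) ≠ t := by
        intro h
        exact hst (by rw [Subtype.ext h])
      rcases hse s hs t ht hne with h | h
      · exfalso
        apply hst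
        rw [MSR.comm_iff (hinv s hs) (hinv t ht), ← orderOf_dvd_iff_pow_eq_one,
          ← Subgroup.orderOf_coe]
        exact dvd_of_eq h
      · rw [← Subgroup.orderOf_coe]
        exact h
    have h4' : ∀ s ∈ ((↑) ⁻¹' T : Set ↥(closure T)), ∀ t ∈ ((↑) ⁻¹' T : Set ↥(closure T)),
        ¬ Commute s t → 4 ≤ orderOf ((s : W) * t) := by
      intro s hs t ht hst
      have := Nat.le_of_dvd (orderOf_pos (s * t)) (h4 s hs t ht hst)
      rw [← Subgroup.orderOf_coe] at this
      exact this
    have hpath : ∀ a ∈ ((↑) ⁻¹' T : Set ↥(closure T)), ∀ b ∈ ((↑) ⁻¹' T : Set ↥(closure T)),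
        ∀ c ∈ ((↑) ⁻¹' T : Set ↥(closure T)), a ≠ c → ¬ Commute a b → Commute b c := by
      intro a ha b hb c hc hac hab
      by_contra hbc
      exact MSR.triple_inf hG (hTS ha) (hTS hb) (hTS hc) (fun h => hac (Subtype.ext h))
        (h4' a ha b hb hab) (h4' b hb c hc hbc) (closure T) a.2 b.2 c.2
    have hN : MSR.NoTriple ((↑) ⁻¹' T : Set ↥(closure T)) := by
      intro s hs t ht u hu hst hus hut
      exact ⟨(hpath t ht s hs u hu hut.symm (fun h => hst h.symm)).symm,
        (hpath s hs t ht u hu hus.symm hst).symm⟩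
    have g₁ := MSR.good_of h₁
    have g₂ := MSR.good_of h₂
    have N₁ := MSR.noTriple_of_good hgen hinv hN g₁
    have N₂ := MSR.noTriple_of_good hgen hinv hN g₂
    exact MSR.even_match g₁ N₁ g₂ N₂ (MSR.four_dvd hgen hinv hN h4 g₁ N₁)
      (MSR.four_dvd hgen hinv hN h4 g₂ N₂)
end

section
/- In the setting of the main theorem, the bijection ψ̄: S̄ → S̄' determined by the intersection pattern (s ∈ T iff ψ̄(s) ∈ T' for corresponding maximal spherical/maximal independent subsets T τ T') induces an isomorphism of Coxeter systems between (W_{S̄}, S̄) and (W'_{S̄'}, S̄'), i.e., m(s,t) = m'(ψ̄(s), ψ̄(t)) for all s,t ∈ S̄. -/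
open Subgroup

set_option linter.unusedSectionVars false

namespace GeoRep

variable {B : Type} [Fintype B] [DecidableEq B]

noncomputable def cc (M : CoxeterMatrix B) (i j : B) : ℝ := - Real.cos (Real.pi / (M i j : ℝ))

/-- the functional `v ↦ 2 B(α_i, v)` -/
noncomputable def fn (M : CoxeterMatrix B) (i : B) : (B → ℝ) →ₗ[ℝ] ℝ :=
  ∑ j, (2 * cc M i j) • LinearMap.proj j

/-- simple root -/
def al (i : B) : B → ℝ := Pi.single i 1

theorem fn_al (M : CoxeterMatrix B) (i j : B) : fn M i (al j) = 2 * cc M i j := by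
  simp [fn, al, Pi.single_apply]

theorem cc_self (M : CoxeterMatrix B) (i : B) : cc M i i = 1 := by
  simp [cc]

theorem cc_symm (M : CoxeterMatrix B) (i j : B) : cc M i j = cc M j i := by
  simp [cc, M.symmetric i j]

theorem fn_al_self (M : CoxeterMatrix B) (i : B) : fn M i (al i) = 2 := by
  rw [fn_al, cc_self]; norm_num

noncomputable def rf (M : CoxeterMatrix B) (i : B) : (B → ℝ) ≃ₗ[ℝ] (B → ℝ) :=
  Module.reflection (fn_al_self M i)

theorem rf_apply (M : CoxeterMatrix B) (i : B) (v : B → ℝ) :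
    rf M i v = v - fn M i v • al i := by
  simp [rf, Module.reflection_apply]

theorem rf_rel (M : CoxeterMatrix B) (i j : B) : (rf M i * rf M j) ^ M i j = 1 := by
  by_cases hij : i = j
  · subst hij
    ext v
    simp [rf_apply, fn_al_self]
    ring
  set m := M i j with hm
  have hm1 : m ≠ 1 := M.off_diagonal i j hij
  by_cases hm0 : m = 0
  · simp [hm0]
  set θ : ℝ := Real.pi / m with hθ
  have hc1 : fn M i (al j) = - (2 * Real.cos θ) := by
    rw [fn_al, cc]; ring
  have hc2 : fn M j (al i) = - (2 * Real.cos θ) := by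
    rw [fn_al, cc, M.symmetric j i]; ring
  have hmpos : (0:ℝ) < m := by exact_mod_cast Nat.pos_of_ne_zero hm0
  have hmθ : m * θ = Real.pi := by rw [hθ]; field_simp
  by_cases hm2 : m = 2
  · have hz : Real.cos θ = 0 := by rw [hθ, hm2]; push_cast; exact Real.cos_pi_div_two
    rw [hz] at hc1 hc2
    rw [hm2]
    refine LinearEquiv.ext fun v => ?_
    simp only [pow_two, LinearEquiv.mul_apply, rf_apply, map_sub, map_smul, fn_al_self, hc1, hc2,
      LinearEquiv.coe_one, id_eq]
    module
  have hm3 : 3 ≤ m := by omega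
  have hs : Real.sin (2 * θ) ≠ 0 := by
    apply ne_of_gt
    have h3 : (3:ℝ) ≤ m := by exact_mod_cast hm3
    apply Real.sin_pos_of_pos_of_lt_pi
    · positivity
    · have : 0 < θ := by positivity
      nlinarith
  set t : ℝ := 2 * Real.cos (2 * θ) with ht
  have hS (k : ℤ) : (Polynomial.Chebyshev.S ℝ k).eval t * Real.sin (2 * θ)
      = Real.sin ((k + 1) * (2 * θ)) := by
    rw [ht]; exact Polynomial.Chebyshev.S_two_mul_real_cos (2 * θ) k
  refine LinearEquiv.ext fun v => ?_
  rw [rf, rf, Module.reflection_mul_reflection_pow_apply (fn_al_self M i) (fn_al_self M j) m v t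
    (by rw [hc1, hc2, ht, Real.cos_two_mul]; ring)]
  rcases Nat.even_or_odd' m with ⟨k, hk | hk⟩
  · have e1 : ((m:ℤ) - 2) / 2 = (k:ℤ) - 1 := by omega
    have e2 : ((m:ℤ) - 1) / 2 = (k:ℤ) - 1 := by omega
    have : (Polynomial.Chebyshev.S ℝ ((k:ℤ) - 1)).eval t = 0 := by
      have h := hS ((k:ℤ) - 1)
      have h2 : (((((k:ℤ) - 1 : ℤ)) : ℝ) + 1) * (2 * θ) = Real.pi := by
        rw [← hmθ, hk]; push_cast; ring
      rw [h2, Real.sin_pi] at h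
      exact (mul_eq_zero.mp h).resolve_right hs
    rw [e1, e2, this]
    simp
  · have e1 : ((m:ℤ) - 1) / 2 = (k:ℤ) := by omega
    have e2 : ((m:ℤ) - 3) / 2 = (k:ℤ) - 1 := by omega
    have e3 : ((m:ℤ)) / 2 = (k:ℤ) := by omega
    have e4 : ((m:ℤ) - 2) / 2 = (k:ℤ) - 1 := by omega
    have : (Polynomial.Chebyshev.S ℝ (k:ℤ)).eval t + (Polynomial.Chebyshev.S ℝ ((k:ℤ) - 1)).eval t
        = 0 := by
      have h := hS ((k:ℤ) - 1)
      have h' := hS (k:ℤ)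
      have h2 : (((((k:ℤ) - 1 : ℤ)) : ℝ) + 1) * (2 * θ) = Real.pi - θ := by
        rw [← hmθ, hk]; push_cast; ring
      have h3 : (((((k:ℤ) : ℤ)) : ℝ) + 1) * (2 * θ) = θ + Real.pi := by
        rw [← hmθ, hk]; push_cast; ring
      rw [h2, Real.sin_pi_sub] at h
      rw [h3, Real.sin_add_pi] at h'
      have : ((Polynomial.Chebyshev.S ℝ (k:ℤ)).eval t +
        (Polynomial.Chebyshev.S ℝ ((k:ℤ) - 1)).eval t) * Real.sin (2 * θ) = 0 := by
        rw [add_mul, h, h']; ring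
      exact (mul_eq_zero.mp this).resolve_right hs
    rw [e1, e2, e3, e4, this]
    simp

variable {W : Type} [Group W] {M : CoxeterMatrix B} (cs : CoxeterSystem M W)

noncomputable def rho : W →* ((B → ℝ) ≃ₗ[ℝ] (B → ℝ)) := cs.lift ⟨rf M, rf_rel M⟩

theorem rho_simple (i : B) : rho cs (cs.simple i) = rf M i := cs.lift_apply_simple (rf_rel M) i

theorem rho_simple_apply (i : B) (v : B → ℝ) :
    rho cs (cs.simple i) v = v - fn M i v • al i := by
  rw [rho_simple, rf_apply]

theorem rho_simple_al (i : B) : rho cs (cs.simple i) (al i) = - al i := by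
  rw [rho_simple_apply, fn_al_self]; module

theorem exists_U (M : CoxeterMatrix B) (i j : B) (hij : i ≠ j) :
    ∃ U : ℕ → ℝ, U 0 = 0 ∧ U 1 = 1 ∧ (∀ k, U (k+2) = - (2 * cc M i j) * U (k+1) - U k) ∧
      (∀ k, (M i j = 0 ∨ k ≤ M i j) → 0 ≤ U k) ∧
      (∀ k, U (2 * k) = 0 → U (2 * k + 1) = 1 → M i j ∣ k) := by
  by_cases hm0 : M i j = 0
  · refine ⟨fun k => k, by simp, by simp, ?_, ?_, ?_⟩
    · intro k; simp [cc, hm0]; ring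
    · intro k _; positivity
    · intro k h _
      rw [hm0]
      have h' : ((2 * k : ℕ) : ℝ) = 0 := h
      have : (2 * k : ℕ) = 0 := by exact_mod_cast h'
      have : k = 0 := by omega
      simp [this]
  · set m := M i j with hm
    have hm1 : m ≠ 1 := M.off_diagonal i j hij
    have hm2 : 2 ≤ m := by omega
    set θ : ℝ := Real.pi / m with hθ
    have hmpos : (0:ℝ) < m := by exact_mod_cast Nat.pos_of_ne_zero hm0
    have hmθ : m * θ = Real.pi := by rw [hθ]; field_simp
    have hθ0 : 0 < θ := by positivity
    have hs : 0 < Real.sin θ := by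
      apply Real.sin_pos_of_pos_of_lt_pi hθ0
      have : (2:ℝ) ≤ m := by exact_mod_cast hm2
      nlinarith
    refine ⟨fun k => Real.sin (k * θ) / Real.sin θ, by simp, by simp [hs.ne'], ?_, ?_, ?_⟩
    · intro k
      have h1 : ((k + 2 : ℕ) : ℝ) * θ = ((k+1 : ℕ):ℝ) * θ + θ := by push_cast; ring
      have h2 : (k : ℝ) * θ = ((k+1 : ℕ):ℝ) * θ - θ := by push_cast; ring
      have : cc M i j = - Real.cos θ := rfl
      simp only [this, h1]
      rw [h2, Real.sin_add, Real.sin_sub]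
      field_simp
      ring
    · intro k hk
      have hk' : k ≤ m := hk.resolve_left hm0
      apply div_nonneg _ hs.le
      apply Real.sin_nonneg_of_nonneg_of_le_pi (by positivity)
      rw [← hmθ]
      have : (k:ℝ) ≤ m := by exact_mod_cast hk'
      nlinarith
    · intro k h0 h1
      have a0 : Real.sin (((2*k : ℕ):ℝ) * θ) = 0 := by
        rcases div_eq_zero_iff.mp h0 with h | h
        · exact h
        · exact absurd h hs.ne'
      have a1 : Real.sin (((2*k : ℕ):ℝ) * θ + θ) = Real.sin θ := by
        have := (div_eq_one_iff_eq hs.ne').mp h1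
        rw [← this]; congr 1; push_cast; ring
      rw [Real.sin_add, a0] at a1
      have a2 : Real.cos (((2*k : ℕ):ℝ) * θ) = 1 := by
        have : (Real.cos (((2*k : ℕ):ℝ) * θ) - 1) * Real.sin θ = 0 := by linarith
        have := (mul_eq_zero.mp this).resolve_right hs.ne'
        linarith
      obtain ⟨n, hn⟩ := (Real.cos_eq_one_iff _).mp a2
      have : (n : ℝ) * m = k := by
        have hp := Real.pi_pos
        rw [← hmθ] at hn
        push_cast at hn
        have : (n * m - k : ℝ) * (2 * θ) = 0 := by linarith
        have := (mul_eq_zero.mp this).resolve_right (by positivity)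
        linarith
      have h3 : n * (m:ℤ) = k := by exact_mod_cast this
      have : (m:ℤ) ∣ k := ⟨n, by rw [← h3]; ring⟩
      exact_mod_cast this

theorem rho_alt (i j : B) (U : ℕ → ℝ) (h0 : U 0 = 0) (h1 : U 1 = 1)
    (hU : ∀ k, U (k+2) = - (2 * cc M i j) * U (k+1) - U k) (k : ℕ) :
    rho cs (cs.wordProd (CoxeterSystem.alternatingWord i j k)) (al i) =
      if Even k then U (k+1) • al i + U k • al j else U k • al i + U (k+1) • al j := by
  induction k with
  | zero => simp [CoxeterSystem.alternatingWord, h0, h1]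
  | succ k ih =>
    rw [CoxeterSystem.alternatingWord_succ', CoxeterSystem.wordProd_cons, map_mul,
      LinearEquiv.mul_apply, ih]
    by_cases hk : Even k
    · have hk' : ¬ Even (k+1) := by simpa [Nat.even_add_one] using hk
      simp only [hk, hk', if_true, if_false]
      rw [rho_simple_apply, map_add, map_smul, map_smul, fn_al_self, fn_al, cc_symm M j i, hU]
      simp only [smul_eq_mul]
      module
    · have hk' : Even (k+1) := by simpa [Nat.even_add_one] using hk
      simp only [hk, hk', if_true, if_false]
      rw [rho_simple_apply, map_add, map_smul, map_smul, fn_al_self, fn_al, hU]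
      simp only [smul_eq_mul]
      module

theorem al_ne {i j : B} (h : i ≠ j) : (al i : B → ℝ) j = 0 := by
  simp [al, h.symm]

theorem orderOf_simple_mul (i j : B) : orderOf (cs.simple i * cs.simple j) = M i j := by
  by_cases hij : i = j
  · subst hij; simp
  apply Nat.dvd_antisymm
  · exact orderOf_dvd_of_pow_eq_one (cs.simple_mul_simple_pow i j)
  · obtain ⟨U, h0, h1, hU, hp, hd⟩ := exists_U M i j hij
    set k := orderOf (cs.simple i * cs.simple j) with hk
    have h := rho_alt cs i j U h0 h1 hU (2 * k)
    rw [CoxeterSystem.prod_alternatingWord_eq_mul_pow] at h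
    have he : Even (2 * k) := by simp
    have hk2 : 2 * k / 2 = k := by omega
    rw [if_pos he, if_pos he, hk2, hk, pow_orderOf_eq_one] at h
    rw [← hk] at h
    simp only [one_mul, map_one, LinearEquiv.coe_one, id_eq] at h
    apply hd
    · have := congrFun h j
      simp [al_ne hij] at this
      simpa [al] using this.symm
    · have := congrFun h i
      simp [al_ne (Ne.symm hij)] at this
      simpa [al] using this.symm

/-- positivity theorem -/
theorem pos_of_lt : ∀ (n : ℕ) (w : W), cs.length w = n → ∀ i : B,
    cs.length w < cs.length (w * cs.simple i) → 0 ≤ rho cs w (al i) := by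
  intro n
  induction n using Nat.strong_induction_on with
  | _ n ih =>
  intro w hw i hi
  by_cases hw1 : w = 1
  · subst hw1
    simp only [map_one, LinearEquiv.coe_one, id_eq, al]
    intro j
    by_cases h : j = i
    · subst h; simp
    · simp [h]
  obtain ⟨j, hj⟩ := cs.exists_rightDescent_of_ne_one hw1
  unfold CoxeterSystem.IsRightDescent at hj
  have hij : i ≠ j := by rintro rfl; omega
  obtain ⟨U, h0, h1, hU, hp, hd⟩ := exists_U M i j hij
  let P : ℕ → Prop := fun k => ∃ v : W,
    w = v * cs.wordProd (CoxeterSystem.alternatingWord i j k) ∧ cs.length w = cs.length v + k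
  have hP1 : P 1 := by
    refine ⟨w * cs.simple j, ?_, ?_⟩
    · simp [CoxeterSystem.alternatingWord, CoxeterSystem.wordProd]
    · rcases cs.length_mul_simple w j with h | h <;> omega
  have hbd : ∀ k, P k → k ≤ n := by
    rintro k ⟨v, _, hv⟩; omega
  classical
  obtain ⟨k, hk1, hPk, hmax⟩ : ∃ k, 1 ≤ k ∧ P k ∧ ¬ P (k+1) := by
    by_contra hcon
    push Not at hcon
    have : ∀ k, P (k+1) := by
      intro k
      induction k with
      | zero => exact hP1
      | succ k ihk => exact hcon (k+1) (by omega) ihk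
    have := hbd _ (this n)
    omega
  obtain ⟨v, hv, hlen⟩ := hPk
  have hvi : ∀ b : B, (b = i ∨ b = j) → 0 ≤ rho cs v (al b) := by
    intro b hb
    apply ih (cs.length v) (by omega) v rfl
    by_contra hlt
    have hl : cs.length (v * cs.simple b) + 1 = cs.length v := by
      rcases cs.length_mul_simple v b with h | h <;> omega
    by_cases hb2 : b = if Even k then j else i
    · apply hmax
      refine ⟨v * cs.simple b, ?_, by omega⟩
      rw [CoxeterSystem.alternatingWord_succ', CoxeterSystem.wordProd_cons, ← hb2]
      rw [mul_assoc, cs.simple_mul_simple_cancel_left]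
      exact hv
    · obtain ⟨k', rfl⟩ : ∃ k', k = k' + 1 := ⟨k-1, by omega⟩
      have hb3 : b = if Even k' then j else i := by
        by_cases he : Even k'
        · have : ¬ Even (k'+1) := by simpa [Nat.even_add_one] using he
          simp only [he, this, if_true, if_false] at hb2 ⊢
          tauto
        · have : Even (k'+1) := by simpa [Nat.even_add_one] using he
          simp only [he, this, if_true, if_false] at hb2 ⊢
          tauto
      rw [CoxeterSystem.alternatingWord_succ', CoxeterSystem.wordProd_cons, ← hb3,
        ← mul_assoc] at hv
      have := cs.length_mul_le (v * cs.simple b)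
        (cs.wordProd (CoxeterSystem.alternatingWord i j k'))
      have h2 := cs.length_wordProd_le (CoxeterSystem.alternatingWord i j k')
      rw [CoxeterSystem.length_alternatingWord] at h2
      rw [← hv] at this
      omega
  have hkm : M i j = 0 ∨ k + 1 ≤ M i j := by
    by_contra hcon
    push Not at hcon
    obtain ⟨hm0, hkm⟩ := hcon
    have hm0' : M j i ≠ 0 := by rwa [M.symmetric j i]
    have hr := cs.not_isReduced_alternatingWord j i hm0' (m := k+1)
      (by rw [M.symmetric j i]; exact hkm)
    have h2 := cs.length_wordProd_le (CoxeterSystem.alternatingWord j i (k+1))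
    unfold CoxeterSystem.IsReduced at hr
    rw [CoxeterSystem.length_alternatingWord] at h2 hr
    have h3 : w * cs.simple i = v * cs.wordProd (CoxeterSystem.alternatingWord j i (k+1)) := by
      rw [CoxeterSystem.alternatingWord_succ, CoxeterSystem.wordProd_concat, hv, mul_assoc]
    have h4 := cs.length_mul_le v (cs.wordProd (CoxeterSystem.alternatingWord j i (k+1)))
    rw [← h3] at h4
    omega
  have hUk : 0 ≤ U k := hp k (by omega)
  have hUk1 : 0 ≤ U (k+1) := hp (k+1) hkm
  rw [hv, map_mul, LinearEquiv.mul_apply, rho_alt cs i j U h0 h1 hU]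
  have hi' := hvi i (Or.inl rfl)
  have hj' := hvi j (Or.inr rfl)
  split_ifs
  · rw [map_add, map_smul, map_smul]
    exact add_nonneg (smul_nonneg hUk1 hi') (smul_nonneg hUk hj')
  · rw [map_add, map_smul, map_smul]
    exact add_nonneg (smul_nonneg hUk hi') (smul_nonneg hUk1 hj')

end GeoRep

set_option linter.unusedSectionVars false

namespace GeoRep

variable {B : Type} [Fintype B] [DecidableEq B]
variable {W : Type} [Group W] {M : CoxeterMatrix B} (cs : CoxeterSystem M W)

noncomputable def bl (M : CoxeterMatrix B) (v w : B → ℝ) : ℝ := ∑ i, v i * fn M i w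

theorem bl_al (i : B) (w : B → ℝ) : bl M (al i) w = fn M i w := by
  simp [bl, al, Pi.single_apply]

theorem fn_apply (i : B) (v : B → ℝ) : fn M i v = ∑ j, 2 * cc M i j * v j := by
  simp [fn]

theorem bl_symm (v w : B → ℝ) : bl M v w = bl M w v := by
  simp only [bl, fn_apply, Finset.mul_sum]
  rw [Finset.sum_comm]
  refine Finset.sum_congr rfl fun i _ => Finset.sum_congr rfl fun j _ => ?_
  rw [cc_symm M j i]; ring

theorem bl_sub_smul (v u w : B → ℝ) (a : ℝ) : bl M (v - a • u) w = bl M v w - a * bl M u w := by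
  simp only [bl, Pi.sub_apply, Pi.smul_apply, smul_eq_mul, Finset.mul_sum]
  rw [← Finset.sum_sub_distrib]
  refine Finset.sum_congr rfl fun i _ => ?_
  ring

theorem bl_rho (w : W) : ∀ v : B → ℝ, bl M (rho cs w v) (rho cs w v) = bl M v v := by
  induction w using cs.simple_induction_left with
  | one => intro v; simp
  | mul_simple_left w i ih =>
    intro v
    rw [map_mul, LinearEquiv.mul_apply]
    rw [← ih v]
    generalize rho cs w v = u
    rw [rho_simple_apply, bl_sub_smul, bl_symm u, bl_sub_smul, bl_al, bl_al, map_sub, map_smul,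
      fn_al_self]
    simp only [smul_eq_mul]
    ring

def IsRoot (β : B → ℝ) : Prop := ∃ (w : W) (i : B), β = rho cs w (al i)

theorem isRoot_al (i : B) : IsRoot cs (al i) := ⟨1, i, by simp⟩

variable {cs} in
theorem IsRoot.rho {β : B → ℝ} (h : IsRoot cs β) (w : W) : IsRoot cs (rho cs w β) := by
  obtain ⟨u, i, rfl⟩ := h
  exact ⟨w * u, i, by simp⟩

theorem al_ne_zero (i : B) : (al i : B → ℝ) ≠ 0 := by
  intro h
  have := congrFun h i
  simp [al] at this

variable {cs} in
theorem IsRoot.ne_zero {β : B → ℝ} (h : IsRoot cs β) : β ≠ 0 := by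
  obtain ⟨u, i, rfl⟩ := h
  simpa using al_ne_zero i

theorem neg_of_lt (w : W) (i : B) (h : cs.length (w * cs.simple i) < cs.length w) :
    rho cs w (al i) ≤ 0 := by
  have := pos_of_lt cs _ (w * cs.simple i) rfl i (by simpa using h)
  rw [map_mul, LinearEquiv.mul_apply, rho_simple_al, map_neg] at this
  simpa using this

variable {cs} in
theorem IsRoot.pos_or_neg {β : B → ℝ} (h : IsRoot cs β) : 0 ≤ β ∨ β ≤ 0 := by
  obtain ⟨u, i, rfl⟩ := h
  rcases lt_or_gt_of_ne (cs.length_mul_simple_ne u i) with h | h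
  · exact Or.inr (neg_of_lt cs u i h)
  · exact Or.inl (pos_of_lt cs _ u rfl i h)

noncomputable def lam : (B → ℝ) →ₗ[ℝ] ℝ := ∑ j, LinearMap.proj j

theorem lam_apply (v : B → ℝ) : lam v = ∑ j, v j := by simp [lam]

variable {cs} in
theorem IsRoot.lam_pos {β : B → ℝ} (h : IsRoot cs β) (hp : 0 ≤ β) : 0 < lam β := by
  rw [lam_apply]
  rcases (Finset.sum_nonneg (fun j _ => hp j) : 0 ≤ ∑ j, β j).lt_or_eq with h1 | h1
  · exact h1
  · exfalso
    apply h.ne_zero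
    rw [eq_comm, Finset.sum_eq_zero_iff_of_nonneg (fun j _ => hp j)] at h1
    funext j
    exact h1 j (Finset.mem_univ j)

variable {cs} in
theorem IsRoot.neg_of_lam {β : B → ℝ} (h : IsRoot cs β) (hp : lam β < 0) : β ≤ 0 := by
  rcases h.pos_or_neg with h1 | h1
  · have := h.lam_pos h1; linarith
  · exact h1

variable {cs} in
theorem IsRoot.simple_pos {β : B → ℝ} (h : IsRoot cs β) (hp : 0 ≤ β) (i : B) (hne : β ≠ al i) :
    0 ≤ GeoRep.rho cs (cs.simple i) β := by
  rcases (h.rho (cs.simple i)).pos_or_neg with h1 | h1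
  · exact h1
  exfalso
  apply hne
  have hb : β = β i • al i := by
    funext j
    by_cases hj : j = i
    · subst hj; simp [al]
    · have := h1 j
      rw [rho_simple_apply] at this
      simp only [Pi.sub_apply, Pi.smul_apply, al_ne (Ne.symm hj), smul_eq_mul, mul_zero, sub_zero,
        Pi.zero_apply] at this ⊢
      exact le_antisymm this (hp j)
  have hq : bl M β β = 2 := by
    obtain ⟨u, k, rfl⟩ := h
    rw [bl_rho, bl_al, fn_al_self]
  have hq2 : bl M β β = 2 * (β i) ^ 2 := by
    have e : bl M (β i • al i) (β i • al i) = 2 * (β i)^2 := by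
      have h0 : β i • (al i : B → ℝ) = 0 - (-β i) • al i := by module
      have hz : ∀ w, bl M 0 w = 0 := by intro w; simp [bl]
      rw [h0, bl_sub_smul, bl_symm (al i), bl_sub_smul, hz, hz, bl_al, fn_al_self]
      ring
    rwa [← hb] at e
  have : β i = 1 := by
    have h0 : 0 ≤ β i := hp i
    nlinarith
  rw [hb, this, one_smul]

theorem fin_neg (w : W) : {β : B → ℝ | IsRoot cs β ∧ 0 ≤ β ∧ rho cs w β ≤ 0}.Finite := by
  induction w using cs.simple_induction_left with
  | one =>
    convert Set.finite_empty
    ext β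
    simp only [map_one, LinearEquiv.coe_one, id_eq, Set.mem_ofPred_eq, Set.mem_empty_iff_false,
      iff_false]
    rintro ⟨h, h1, h2⟩
    exact h.ne_zero (le_antisymm h2 h1)
  | mul_simple_left w i ih =>
    refine (ih.union (Set.finite_singleton (rho cs w⁻¹ (al i)))).subset ?_
    rintro β ⟨h, h1, h2⟩
    by_cases h3 : rho cs w β ≤ 0
    · exact Or.inl ⟨h, h1, h3⟩
    · right
      have h4 : 0 ≤ rho cs w β := (h.rho w).pos_or_neg.resolve_right h3
      rw [Set.mem_singleton_iff]
      by_contra h5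
      have h6 : rho cs w β ≠ al i := by
        intro h6
        apply h5
        rw [← h6, ← LinearEquiv.mul_apply, ← map_mul]
        simp
      have h7 := (h.rho w).simple_pos h4 i h6
      rw [map_mul, LinearEquiv.mul_apply] at h2
      exact ((h.rho w).rho (cs.simple i)).ne_zero (le_antisymm h2 h7)

theorem nonneg_of_simple (y : (B → ℝ) →ₗ[ℝ] ℝ) (hy : ∀ i, 0 ≤ y (al i)) (v : B → ℝ) (hv : 0 ≤ v) :
    0 ≤ y v := by
  have : v = ∑ i, v i • al i := by
    funext j
    simp [al, Finset.sum_apply, Pi.single_apply]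
  rw [this, map_sum]
  refine Finset.sum_nonneg fun i _ => ?_
  rw [map_smul]
  exact mul_nonneg (hv i) (hy i)

theorem finite_subgroup (G : Subgroup W) [Finite G] : ∃ (w : W) (J : Set B),
    ((Subgroup.closure (cs.simple '' J) : Subgroup W) : Set W).Finite ∧
    ∀ g ∈ G, w⁻¹ * g * w ∈ Subgroup.closure (cs.simple '' J) := by
  classical
  have := Fintype.ofFinite G
  let x : (B → ℝ) →ₗ[ℝ] ℝ := ∑ g : G, lam ∘ₗ (rho cs (g : W)).toLinearMap
  have hx : ∀ v, x v = ∑ g : G, lam (rho cs (g : W) v) := by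
    intro v; simp [x]
  have hxG : ∀ g ∈ G, ∀ v, x (rho cs g v) = x v := by
    intro g hg v
    rw [hx, hx]
    refine Fintype.sum_equiv (Equiv.mulRight (⟨g, hg⟩ : G)) _ _ ?_
    intro h
    simp
  -- the finite sets of roots on which `x` is nonpositive
  have hfin : ∀ w : W, {β : B → ℝ | IsRoot cs β ∧ 0 ≤ β ∧ x (rho cs w β) ≤ 0}.Finite := by
    intro w
    refine (Set.finite_iUnion (fun g : G => fin_neg cs (g * w))).subset ?_
    rintro β ⟨h, h1, h2⟩
    rw [Set.mem_iUnion]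
    by_contra hcon
    push Not at hcon
    rw [hx] at h2
    have : 0 < ∑ g : G, lam (rho cs (g : W) (rho cs w β)) := by
      apply Finset.sum_pos _ ⟨1, Finset.mem_univ _⟩
      intro g _
      rw [← LinearEquiv.mul_apply, ← map_mul]
      apply (h.rho _).lam_pos
      apply (h.rho _).pos_or_neg.resolve_right
      intro h3
      exact hcon g ⟨h, h1, h3⟩
    linarith
  have hfin' : ∀ w : W, {β : B → ℝ | IsRoot cs β ∧ 0 ≤ β ∧ x (rho cs w β) < 0}.Finite :=
    fun w => (hfin w).subset fun β hβ => ⟨hβ.1, hβ.2.1, hβ.2.2.le⟩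
  obtain ⟨w, hw⟩ : ∃ w : W, ∀ u : W, {β : B → ℝ | IsRoot cs β ∧ 0 ≤ β ∧ x (rho cs w β) < 0}.ncard
      ≤ {β : B → ℝ | IsRoot cs β ∧ 0 ≤ β ∧ x (rho cs u β) < 0}.ncard := by
    exact ⟨_, fun u => Function.argmin_le
      (fun w : W => {β : B → ℝ | IsRoot cs β ∧ 0 ≤ β ∧ x (rho cs w β) < 0}.ncard) u⟩
  have hdom : ∀ i, 0 ≤ x (rho cs w (al i)) := by
    intro i
    by_contra hneg
    push Not at hneg
    have h1 := hw (w * cs.simple i)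
    have hmap : Set.MapsTo (rho cs (cs.simple i))
        {β : B → ℝ | IsRoot cs β ∧ 0 ≤ β ∧ x (rho cs (w * cs.simple i) β) < 0}
        ({β : B → ℝ | IsRoot cs β ∧ 0 ≤ β ∧ x (rho cs w β) < 0} \ {al i}) := by
      rintro β ⟨h, hp, hβ⟩
      rw [map_mul, LinearEquiv.mul_apply] at hβ
      have hne : β ≠ al i := by
        rintro rfl
        rw [rho_simple_al, map_neg, map_neg] at hβ
        linarith
      refine ⟨⟨h.rho _, h.simple_pos hp i hne, hβ⟩, ?_⟩
      intro h2
      rw [Set.mem_singleton_iff] at h2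
      have h3 : β = - al i := by
        rw [← rho_simple_al cs i, ← h2, ← LinearEquiv.mul_apply, ← map_mul]
        simp
      have h4 := hp i
      rw [h3] at h4
      simp [al] at h4
      linarith
    have h2 := Set.ncard_le_ncard_of_injOn (rho cs (cs.simple i)) hmap
      ((rho cs (cs.simple i)).injective.injOn) ((hfin' w).sdiff)
    have h3 : al i ∈ {β : B → ℝ | IsRoot cs β ∧ 0 ≤ β ∧ x (rho cs w β) < 0} :=
      ⟨isRoot_al cs i, by
        intro j
        by_cases h : j = i
        · subst h; simp [al]
        · simp [al, h], hneg⟩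
    have h4 := Set.ncard_sdiff_singleton_lt_of_mem h3 (hfin' w)
    omega
  let y : (B → ℝ) →ₗ[ℝ] ℝ := x ∘ₗ (rho cs w).toLinearMap
  have hy : ∀ v, y v = x (rho cs w v) := fun v => rfl
  let J : Set B := {i | y (al i) = 0}
  have hsJ : ∀ i ∈ J, ∀ v, y (rho cs (cs.simple i) v) = y v := by
    intro i hi v
    have : y (al i) = 0 := hi
    rw [rho_simple_apply, map_sub, map_smul, this]; simp
  have hdesc : ∀ u : W, (∀ v, y (rho cs u v) = y v) → ∀ i,
      cs.length (u * cs.simple i) < cs.length u → i ∈ J := by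
    intro u hu i hi
    have h1 := neg_of_lt cs u i hi
    have h2 : 0 ≤ y (- rho cs u (al i)) := nonneg_of_simple y hdom _ (by simpa using h1)
    rw [map_neg, hu] at h2
    have h3 : 0 ≤ y (al i) := hdom i
    exact le_antisymm (by linarith) h3
  have hstab : ∀ (n : ℕ) (u : W), cs.length u = n → (∀ v, y (rho cs u v) = y v) →
      u ∈ Subgroup.closure (cs.simple '' J) := by
    intro n
    induction n with
    | zero =>
      intro u hu _
      rw [cs.length_eq_zero_iff] at hu
      rw [hu]; exact one_mem _
    | succ n ih =>
      intro u hu huy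
      have hu1 : u ≠ 1 := by
        rintro rfl; simp at hu
      obtain ⟨i, hi⟩ := cs.exists_rightDescent_of_ne_one hu1
      have hi' : cs.length (u * cs.simple i) < cs.length u := hi
      have hiJ := hdesc u huy i hi'
      have h1 : u * cs.simple i ∈ Subgroup.closure (cs.simple '' J) := by
        apply ih
        · rcases cs.length_mul_simple u i with h | h <;> omega
        · intro v
          rw [map_mul, LinearEquiv.mul_apply, huy, hsJ i hiJ]
      have h2 := mul_mem h1 (Subgroup.subset_closure (Set.mem_image_of_mem cs.simple hiJ))
      simpa using h2
  have hJfix : ∀ u ∈ Subgroup.closure (cs.simple '' J), ∀ v, y (rho cs u v) = y v := by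
    intro u hu
    induction hu using Subgroup.closure_induction with
    | mem z hz =>
      obtain ⟨i, hi, rfl⟩ := hz
      exact hsJ i hi
    | one => intro v; simp
    | mul a b _ _ ha hb => intro v; rw [map_mul, LinearEquiv.mul_apply, ha, hb]
    | inv a _ ha =>
      intro v
      rw [← ha (rho cs a⁻¹ v), ← LinearEquiv.mul_apply, ← map_mul]; simp
  refine ⟨w, J, ?_, ?_⟩
  · -- finiteness
    set Z : Set (B → ℝ) := {β | IsRoot cs β ∧ y β = 0} with hZ
    have hZf : Z.Finite := by
      have hneg : (Neg.neg '' {β : B → ℝ | IsRoot cs β ∧ 0 ≤ β ∧ x (rho cs w β) ≤ 0}).Finite :=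
        (hfin w).image _
      refine ((hfin w).union hneg).subset ?_
      rintro β ⟨h, h0⟩
      rcases h.pos_or_neg with h1 | h1
      · exact Or.inl ⟨h, h1, h0.le⟩
      · right
        refine ⟨-β, ⟨?_, by simpa using h1, ?_⟩, by simp⟩
        · obtain ⟨u, i, rfl⟩ := h
          refine ⟨u * cs.simple i, i, ?_⟩
          rw [map_mul, LinearEquiv.mul_apply, rho_simple_al, map_neg]
        · rw [map_neg, map_neg]
          have : x (rho cs w β) = 0 := h0
          linarith
    have : Finite Z := hZf
    let F : (Subgroup.closure (cs.simple '' J) : Subgroup W) → (J → Z) := fun u i =>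
      ⟨rho cs (u : W) (al i), (isRoot_al cs i).rho _, by rw [hJfix u u.2]; exact i.2⟩
    have hF : Function.Injective F := by
      intro a b hab
      have h1 : ∀ i ∈ J, rho cs (a : W) (al i) = rho cs (b : W) (al i) := by
        intro i hi
        have := congrFun hab ⟨i, hi⟩
        exact congrArg Subtype.val this
      have h2 : ((b⁻¹ * a : (Subgroup.closure (cs.simple '' J) : Subgroup W)) : W) = 1 := by
        by_contra hne
        obtain ⟨i, hi⟩ := cs.exists_rightDescent_of_ne_one hne
        have hiJ := hdesc _ (hJfix _ (b⁻¹ * a).2) i hi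
        have h3 := neg_of_lt cs _ i hi
        have h4 : rho cs ((b⁻¹ * a : (Subgroup.closure (cs.simple '' J) : Subgroup W)) : W) (al i)
            = al i := by
          rw [Subgroup.coe_mul, map_mul, LinearEquiv.mul_apply, h1 i hiJ, ← LinearEquiv.mul_apply,
            ← map_mul]
          simp
        rw [h4] at h3
        have := h3 i
        simp [al] at this
        linarith
      have h3 : b⁻¹ * a = 1 := by ext; exact h2
      exact (inv_mul_eq_one.mp h3).symm
    exact Finite.of_injective F hF
  · intro g hg
    apply hstab _ _ rfl
    intro v
    rw [hy, hy, ← LinearEquiv.mul_apply, ← map_mul]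
    have : w * (w⁻¹ * g * w) = g * w := by group
    rw [this, map_mul, LinearEquiv.mul_apply, hxG g hg]

end GeoRep

/-- lifting with orders -/
theorem cox_lift {W : Type} [Group W] {S : Set W}
    (hS : S.Finite ∧ ∃ (M : CoxeterMatrix S) (cs : CoxeterSystem M W), ∀ s : S, cs.simple s = (s : W))
    {H : Type} [Group H] (f : W → H)
    (hf : ∀ s ∈ S, ∀ t ∈ S, (f s * f t) ^ orderOf (s * t) = 1) :
    ∃ F : W →* H, ∀ s ∈ S, F s = f s := by
  classical
  obtain ⟨hfin, M, cs, hcs⟩ := hS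
  have := hfin.fintype
  have hl : M.IsLiftable (fun s : S => f s) := by
    intro s t
    have := hf s s.2 t t.2
    rwa [← hcs s, ← hcs t, GeoRep.orderOf_simple_mul, hcs, hcs] at this
  refine ⟨cs.lift ⟨_, hl⟩, fun s hs => ?_⟩
  have := cs.lift_apply_simple hl ⟨s, hs⟩
  rwa [hcs] at this

theorem cox_finite {W : Type} [Group W] {S : Set W}
    (hS : S.Finite ∧ ∃ (M : CoxeterMatrix S) (cs : CoxeterSystem M W), ∀ s : S, cs.simple s = (s : W))
    (G : Subgroup W) (hG : (G : Set W).Finite) :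
    ∃ (w : W) (J : Set W), J ⊆ S ∧ ((Subgroup.closure J : Subgroup W) : Set W).Finite ∧
      ∀ g ∈ G, w⁻¹ * g * w ∈ Subgroup.closure J := by
  classical
  obtain ⟨hfin, M, cs, hcs⟩ := hS
  have := hfin.fintype
  have : Finite G := hG
  obtain ⟨w, J, h1, h2⟩ := GeoRep.finite_subgroup cs G
  refine ⟨w, cs.simple '' J, ?_, h1, h2⟩
  rintro _ ⟨i, _, rfl⟩
  rw [hcs]; exact i.2

theorem cox_sq {W : Type} [Group W] {S : Set W}
    (hS : S.Finite ∧ ∃ (M : CoxeterMatrix S) (cs : CoxeterSystem M W), ∀ s : S, cs.simple s = (s : W))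
    (s : W) (hs : s ∈ S) : s * s = 1 ∧ s ≠ 1 := by
  obtain ⟨hfin, M, cs, hcs⟩ := hS
  have e : cs.simple ⟨s, hs⟩ = s := hcs ⟨s, hs⟩
  rw [← e]
  refine ⟨by simp, ?_⟩
  intro h
  have := cs.length_simple ⟨s, hs⟩
  rw [h] at this
  simp at this

/-- strong even maximal spherical -/
def SE {W : Type} [Group W] (S U : Set W) : Prop := IsMaxSpherical S U ∧ IsStrongEvenSet U

section one

variable {W : Type} [Group W] {S : Set W}

theorem ord_comm (s t : W) : orderOf (s * t) = orderOf (t * s) := by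
  have : t * s = s⁻¹ * (s * t) * s⁻¹⁻¹ := by group
  rw [this]
  exact (orderOf_injective (MulAut.conj s⁻¹).toMonoidHom (MulAut.conj s⁻¹).injective (s * t)).symm

theorem SE.sub_bar {U : Set W} (h : SE S U) : U ⊆ Sbar S := fun _ hx => ⟨U, h, hx⟩

theorem bar_sub : Sbar S ⊆ S := by
  rintro x ⟨U, h, hx⟩
  exact h.1.1.1 hx

theorem SE.sub {U : Set W} (h : SE S U) : U ⊆ S := h.1.1.1

theorem sph_ext (hS : IsCoxGenSet S) {T : Set W} (hT : IsSpherical S T) :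
    ∃ U, IsMaxSpherical S U ∧ T ⊆ U := by
  have hf : {U | IsSpherical S U}.Finite :=
    hS.1.finite_subsets.subset fun U hU => hU.1
  obtain ⟨U, hTU, hU⟩ := hf.exists_le_maximal hT
  exact ⟨U, ⟨hU.1, fun V hV hUV => Set.Subset.antisymm (hU.2 hV hUV) hUV⟩, hTU⟩

theorem ind_ext (hS : IsCoxGenSet S) {T : Set W} (hT : IsIndep T) (hTS : T ⊆ Sbar S) :
    ∃ U, IsMaxIndep (Sbar S) U ∧ T ⊆ U := by
  have hf : {U | IsIndep U ∧ U ⊆ Sbar S}.Finite :=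
    hS.1.finite_subsets.subset fun U hU => hU.2.trans bar_sub
  obtain ⟨U, hTU, hU⟩ := hf.exists_le_maximal ⟨hT, hTS⟩
  exact ⟨U, ⟨hU.1.1, hU.1.2, fun V hV hVS hUV => Set.Subset.antisymm (hU.2 ⟨hV, hVS⟩ hUV) hUV⟩, hTU⟩

theorem dih_conj {s t : W} (hs : s * s = 1) (ht : t * t = 1) (k : ℤ) :
    s * (s * t) ^ k = (s * t) ^ (-k) * s := by
  have h1 : s⁻¹ = s := inv_eq_of_mul_eq_one_left hs
  have h2 : t⁻¹ = t := inv_eq_of_mul_eq_one_left ht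
  have h : s * (s * t) * s⁻¹ = (s * t)⁻¹ := by
    rw [mul_inv_rev, h2, h1, ← mul_assoc, hs, one_mul]
  have h3 : s * (s * t) ^ k * s⁻¹ = (s * t) ^ (-k) := by
    rw [← conj_zpow, h, inv_zpow, zpow_neg]
  rw [← h3]; group

theorem dih_mem {s t : W} (hs : s * s = 1) (ht : t * t = 1) {x : W}
    (hx : x ∈ Subgroup.closure ({s, t} : Set W)) :
    ∃ i : ℤ, x = (s * t) ^ i ∨ x = (s * t) ^ i * s := by
  have hc := dih_conj hs ht
  induction hx using Subgroup.closure_induction with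
  | mem z hz =>
    rcases hz with rfl | hz
    · exact ⟨0, Or.inr (by simp)⟩
    · rw [Set.mem_singleton_iff] at hz
      subst hz
      refine ⟨-1, Or.inr ?_⟩
      have h1 : s⁻¹ = s := inv_eq_of_mul_eq_one_left hs
      have h2 : z⁻¹ = z := inv_eq_of_mul_eq_one_left ht
      rw [zpow_neg_one, mul_inv_rev, h1, h2, mul_assoc, hs, mul_one]
  | one => exact ⟨0, Or.inl (by simp)⟩
  | mul a b _ _ ha hb =>
    obtain ⟨i, rfl | rfl⟩ := ha <;> obtain ⟨j, rfl | rfl⟩ := hb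
    · exact ⟨i + j, Or.inl (by rw [zpow_add])⟩
    · exact ⟨i + j, Or.inr (by rw [zpow_add, mul_assoc])⟩
    · exact ⟨i + -j, Or.inr (by rw [zpow_add, mul_assoc, hc, mul_assoc])⟩
    · exact ⟨i + -j, Or.inl (by
        rw [zpow_add, mul_assoc, ← mul_assoc s, hc, mul_assoc, hs, mul_one])⟩
  | inv a _ ha =>
    have h1 : s⁻¹ = s := inv_eq_of_mul_eq_one_left hs
    obtain ⟨i, rfl | rfl⟩ := ha
    · exact ⟨-i, Or.inl (by rw [zpow_neg])⟩
    · refine ⟨i, Or.inr ?_⟩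
      rw [mul_inv_rev, h1, ← zpow_neg, hc, neg_neg]

theorem sq_one (hS : IsCoxGenSet S) {s : W} (hs : s ∈ S) : s * s = 1 := (cox_sq hS s hs).1

theorem pair_sph (hS : IsCoxGenSet S) {s t : W} (hs : s ∈ S) (ht : t ∈ S)
    (h : orderOf (s * t) ≠ 0) : IsSpherical S {s, t} := by
  refine ⟨?_, ?_⟩
  · rintro x (rfl | hx)
    · exact hs
    · rw [Set.mem_singleton_iff] at hx; rwa [hx]
  · have hf : ((Subgroup.zpowers (s * t) : Subgroup W) : Set W).Finite :=
      finite_zpowers.mpr (orderOf_ne_zero_iff.mp h)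
    refine (hf.union (hf.image (fun x => x * s))).subset ?_
    intro x hx
    obtain ⟨i, rfl | rfl⟩ := dih_mem (sq_one hS hs) (sq_one hS ht) hx
    · exact Or.inl ⟨i, rfl⟩
    · exact Or.inr ⟨_, ⟨i, rfl⟩, rfl⟩

theorem sph_ord {T : Set W} (hT : IsSpherical S T) {s t : W} (hs : s ∈ T) (ht : t ∈ T) :
    orderOf (s * t) ≠ 0 := by
  rw [orderOf_ne_zero_iff]
  have hst : s * t ∈ Subgroup.closure T :=
    mul_mem (Subgroup.subset_closure hs) (Subgroup.subset_closure ht)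
  have : Finite (Subgroup.closure T : Subgroup W) := hT.2
  have h := isOfFinOrder_of_finite (⟨s * t, hst⟩ : (Subgroup.closure T : Subgroup W))
  exact (Submonoid.isOfFinOrder_coe).mpr h

theorem maxSph_cases (hc : Conds S) {U : Set W} (hU : IsMaxSpherical S U) :
    SE S U ∨ ∃ s ∈ S, ∃ t ∈ S, s ≠ t ∧ Odd (orderOf (s * t)) ∧ U = {s, t} := by
  by_cases h : IsStrongEvenSet U
  · exact Or.inl ⟨hU, h⟩
  · right
    unfold IsStrongEvenSet at h
    push Not at h
    obtain ⟨s, hs, t, ht, hne, h2, h4⟩ := h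
    have hsS := hU.1.1 hs
    have htS := hU.1.1 ht
    have hodd : Odd (orderOf (s * t)) := by
      rw [← Nat.not_even_iff_odd]
      intro he
      rcases hc.1 s hsS t htS hne he with h | h
      · exact h2 h
      · exact h4 h
    refine ⟨s, hsS, t, htS, hne, hodd, ?_⟩
    apply (hc.2.1 s hsS t htS hne hodd).2 U hU.1
    rintro x (rfl | hx)
    · exact hs
    · rw [Set.mem_singleton_iff] at hx; rwa [hx]

theorem SE.even {U : Set W} (h : SE S U) {s t : W} (hs : s ∈ U) (ht : t ∈ U) (hne : s ≠ t) :
    Even (orderOf (s * t)) := by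
  rcases h.2 s hs t ht hne with h | h
  · rw [h]; decide
  · exact even_iff_two_dvd.mpr (dvd_trans (by norm_num) h)

theorem bar_not_odd (hc : Conds S) {s t : W} (hs : s ∈ Sbar S) (ht : t ∈ Sbar S) (hne : s ≠ t) :
    ¬ Odd (orderOf (s * t)) := by
  intro hodd
  obtain ⟨T1, h1, hs1⟩ := hs
  obtain ⟨T2, h2, ht2⟩ := ht
  have hs' := h1.1.1.1 hs1
  have ht' := h2.1.1.1 ht2
  have key : ∀ T, SE S T → T ≠ {s, t} := by
    rintro T hT rfl
    have := hT.even (s := s) (t := t) (by simp) (by simp) hne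
    exact (Nat.not_even_iff_odd.mpr hodd) this
  rcases hc.2.2.2 s hs' t ht' hne hodd T1 T2 {s, t} ⟨h1.1, s, hs1, by simp⟩ ⟨h2.1, t, ht2, by simp⟩
    ⟨hc.2.1 s hs' t ht' hne hodd, s, by simp⟩ with h | h | h
  · subst h
    exact (Nat.not_even_iff_odd.mpr hodd) (SE.even h1 hs1 ht2 hne)
  · exact key _ h1 h
  · exact key _ h2 h

theorem odd_trans (hS : IsCoxGenSet S) (hc : Conds S) {s t u : W} (hs : s ∈ S) (ht : t ∈ S) (hu : u ∈ S)
    (h1 : Odd (orderOf (s * t))) (h2 : Odd (orderOf (t * u))) : Odd (orderOf (s * u)) := by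
  by_cases a : s = t
  · subst a; exact h2
  by_cases b : t = u
  · subst b; exact h1
  by_cases c : s = u
  · subst c
    rw [sq_one hS hs, orderOf_one]; exact odd_one
  exact absurd ⟨s, hs, t, ht, u, hu, a, b, c, h1, h2⟩ hc.2.2.1

end one

section two

variable {W : Type} [Group W] {S : Set W}

theorem unit_sq (x : ℤˣ) : x * x = 1 := by rw [← sq]; exact Int.units_sq x

theorem unit_cases (x : ℤˣ) : x = 1 ∨ x = -1 := Int.units_eq_one_or x

theorem unit_ne : (1 : ℤˣ) ≠ -1 := by decide

/-- family of characters detecting odd classes -/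
def IsChi (S : Set W) (χ : W → (W →* ℤˣ)) : Prop :=
  ∀ s ∈ S, ∀ t ∈ S, (χ s t = -1 ↔ Odd (orderOf (s * t)))

theorem exists_chi (hS : IsCoxGenSet S) (hc : Conds S) : ∃ χ, IsChi S χ := by
  classical
  have key : ∀ s : W, ∃ c : W →* ℤˣ, s ∈ S → ∀ t ∈ S, (c t = -1 ↔ Odd (orderOf (s * t))) := by
    intro s
    by_cases hs : s ∈ S
    swap
    · exact ⟨1, fun h => absurd h hs⟩
    obtain ⟨F, hF⟩ := cox_lift hS (H := ℤˣ)
      (fun t => if Odd (orderOf (s * t)) then -1 else 1) (by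
        intro a ha b hb
        rcases Nat.even_or_odd (orderOf (a * b)) with he | ho
        · obtain ⟨k, hk⟩ := he
          rw [hk, pow_add, ← mul_pow, unit_sq, one_pow]
        · have : Odd (orderOf (s * a)) ↔ Odd (orderOf (s * b)) :=
            ⟨fun h => odd_trans hS hc hs ha hb h ho,
              fun h => odd_trans hS hc hs hb ha h (by rwa [ord_comm])⟩
          simp only [this]
          rw [unit_sq, one_pow])
    refine ⟨F, fun _ t ht => ?_⟩
    rw [hF t ht]
    split_ifs with h
    · simp [h]
    · simp [h]
  choose χ hχ using key
  exact ⟨χ, fun s hs => hχ s hs⟩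

theorem IsChi.bar {χ : W → (W →* ℤˣ)} (h : IsChi S χ) (hS : IsCoxGenSet S) (hc : Conds S)
    {s t : W} (hs : s ∈ Sbar S) (ht : t ∈ Sbar S) : χ s t = -1 ↔ s = t := by
  rw [h s (bar_sub hs) t (bar_sub ht)]
  constructor
  · intro ho
    by_contra hne
    exact bar_not_odd hc hs ht hne ho
  · rintro rfl
    rw [sq_one hS (bar_sub hs), orderOf_one]; exact odd_one

theorem fold_key (hS : IsCoxGenSet S) (hc : Conds S) {U : Set W} (hU : SE S U) {v p w : W}
    (hv : v ∈ S) (hvU : v ∉ U) (hp : p ∈ U) (ho : Odd (orderOf (v * p))) (hw : w ∈ S)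
    (h0 : orderOf (v * w) ≠ 0) : w = v ∨ w = p := by
  have hne : v ≠ p := by rintro rfl; exact hvU hp
  obtain ⟨X, hX, hXs⟩ := sph_ext hS (pair_sph hS hv hw h0)
  have hvX : v ∈ X := hXs (by simp)
  have hwX : w ∈ X := hXs (by simp)
  rcases hc.2.2.2 v hv p (hU.sub hp) hne ho {v, p} U X
    ⟨hc.2.1 v hv p (hU.sub hp) hne ho, v, by simp⟩ ⟨hU.1, p, hp, by simp⟩ ⟨hX, v, hvX, by simp⟩
    with h | h | h
  · exact absurd (h ▸ (by simp) : v ∈ U) hvU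
  · rw [← h] at hwX
    simpa using hwX
  · exact absurd (h ▸ hvX) hvU

theorem fold (hS : IsCoxGenSet S) (hc : Conds S) {U : Set W} (hU : SE S U)
    {H : Type} [Group H] (f : W → H)
    (hf : ∀ s ∈ U, ∀ t ∈ U, (f s * f t) ^ orderOf (s * t) = 1) :
    ∃ F : W →* H, ∀ s ∈ U, F s = f s := by
  classical
  have hf1 : ∀ s ∈ U, f s * f s = 1 := by
    intro s hs
    have := hf s hs s hs
    rwa [sq_one hS (hU.sub hs), orderOf_one, pow_one] at this
  let g : W → H := fun v => if h : ∃ p ∈ U, Odd (orderOf (v * p)) then f h.choose else 1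
  have hg : ∀ v ∈ S, ∀ p ∈ U, Odd (orderOf (v * p)) → g v = f p := by
    intro v hv p hp ho
    have h : ∃ p ∈ U, Odd (orderOf (v * p)) := ⟨p, hp, ho⟩
    have h1 : g v = f h.choose := dif_pos h
    obtain ⟨h2, h3⟩ := h.choose_spec
    rw [h1]
    by_contra hne
    have hne' : h.choose ≠ p := fun e => hne (by rw [e])
    exact bar_not_odd hc (hU.sub_bar h2) (hU.sub_bar hp) hne'
      (odd_trans hS hc (hU.sub h2) hv (hU.sub hp) (by rwa [ord_comm]) ho)
  have hself : ∀ v ∈ U, Odd (orderOf (v * v)) := by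
    intro v hv
    rw [sq_one hS (hU.sub hv), orderOf_one]; exact odd_one
  have hgU : ∀ v ∈ U, g v = f v := fun v hv => hg v (hU.sub hv) v hv (hself v hv)
  have hg0 : ∀ v, (¬ ∃ p ∈ U, Odd (orderOf (v * p))) → g v = 1 := fun v h => dif_neg h
  have hev : ∀ a ∈ U, ∀ n : ℕ, Even n → f a ^ n = 1 := by
    rintro a ha n ⟨k, rfl⟩
    rw [← two_mul, pow_mul, sq, hf1 a ha, one_pow]
  obtain ⟨F, hF⟩ := cox_lift hS g (by
    intro a ha b hb
    by_cases h0 : orderOf (a * b) = 0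
    · rw [h0, pow_zero]
    have h0' : orderOf (b * a) ≠ 0 := by rwa [ord_comm]
    by_cases hpa : ∃ p ∈ U, Odd (orderOf (a * p)) <;>
      by_cases hpb : ∃ q ∈ U, Odd (orderOf (b * q))
    · obtain ⟨p, hp, hap⟩ := hpa
      obtain ⟨q, hq, hbq⟩ := hpb
      by_cases haU : a ∈ U
      · by_cases hbU : b ∈ U
        · rw [hgU a haU, hgU b hbU]; exact hf a haU b hbU
        · rcases fold_key hS hc hU hb hbU hq hbq ha h0' with e | e
          · exact absurd (e ▸ haU) hbU
          · rw [hgU a haU, hg b hb q hq hbq, e, hf1 q hq, one_pow]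
      · rcases fold_key hS hc hU ha haU hp hap hb h0 with e | e
        · rw [e, hg a ha p hp hap, hf1 p hp, one_pow]
        · have hbU : b ∈ U := e ▸ hp
          rw [hgU b hbU, hg a ha p hp hap, e, hf1 p hp, one_pow]
    · obtain ⟨p, hp, hap⟩ := hpa
      have haU : a ∈ U := by
        by_contra haU
        rcases fold_key hS hc hU ha haU hp hap hb h0 with e | e
        · exact hpb ⟨p, hp, e ▸ hap⟩
        · exact hpb ⟨p, hp, e ▸ hself p hp⟩
      rw [hg0 b hpb, mul_one, hgU a haU]
      apply hev a haU
      rw [← Nat.not_odd_iff_even]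
      intro ho
      exact hpb ⟨a, haU, by rwa [ord_comm]⟩
    · obtain ⟨q, hq, hbq⟩ := hpb
      have hbU : b ∈ U := by
        by_contra hbU
        rcases fold_key hS hc hU hb hbU hq hbq ha h0' with e | e
        · exact hpa ⟨q, hq, e ▸ hbq⟩
        · exact hpa ⟨q, hq, e ▸ hself q hq⟩
      rw [hg0 a hpa, one_mul, hgU b hbU]
      apply hev b hbU
      rw [← Nat.not_odd_iff_even]
      intro ho
      exact hpa ⟨b, hbU, ho⟩
    · rw [hg0 a hpa, hg0 b hpb, one_mul, one_pow])
  exact ⟨F, fun s hs => by rw [hF s (hU.sub hs), hgU s hs]⟩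

/-- retraction onto a dihedral factor -/
theorem fold_pair (hS : IsCoxGenSet S) (hc : Conds S) {U : Set W} (hU : SE S U) {s t : W}
    (hs : s ∈ U) (ht : t ∈ U) :
    ∃ p : W →* W, p s = s ∧ p t = t ∧ ∀ u ∈ U, u ≠ s → u ≠ t → p u = 1 := by
  classical
  have hev : ∀ a ∈ U, ∀ n : ℕ, Even n → a ^ n = 1 := by
    rintro a ha n ⟨k, rfl⟩
    rw [← two_mul, pow_mul, sq, sq_one hS (hU.sub ha), one_pow]
  obtain ⟨F, hF⟩ := fold hS hc hU (fun v => if v = s ∨ v = t then v else 1) (by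
    intro a ha b hb
    by_cases hab : a = b
    · subst hab
      split_ifs
      · rw [sq_one hS (hU.sub ha), one_pow]
      · simp
    have he := hU.even ha hb hab
    split_ifs
    · exact pow_orderOf_eq_one _
    · rw [mul_one]; exact hev a ha _ he
    · rw [one_mul]; exact hev b hb _ he
    · simp)
  refine ⟨F, ?_, ?_, ?_⟩
  · rw [hF s hs]; simp
  · rw [hF t ht]; simp
  · intro u hu h1 h2
    rw [hF u hu]; simp [h1, h2]

theorem se_four {U : Set W} (hU : SE S U) {s t : W} (hs : s ∈ U) (ht : t ∈ U) (hne : s ≠ t)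
    (h : orderOf (s * t) ≠ 2) : 4 ∣ orderOf (s * t) :=
  (hU.2 s hs t ht hne).resolve_left h

theorem struct_pair (hS : IsCoxGenSet S) (hc : Conds S) {U : Set W} (hU : SE S U) {s t u : W}
    (hs : s ∈ U) (ht : t ∈ U) (hu : u ∈ U) (h1 : s ≠ t) (h2 : t ≠ u) (h3 : s ≠ u)
    (hst : orderOf (s * t) ≠ 2) (htu : orderOf (t * u) ≠ 2) : False := by
  classical
  let A : Equiv.Perm (ℤ × ℤ) := ⟨fun p => (1 - p.1, p.2), fun p => (1 - p.1, p.2),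
    fun p => by ext <;> simp, fun p => by ext <;> simp⟩
  let B : Equiv.Perm (ℤ × ℤ) := ⟨fun p => (p.2, p.1), fun p => (p.2, p.1),
    fun p => by ext <;> simp, fun p => by ext <;> simp⟩
  let C : Equiv.Perm (ℤ × ℤ) := ⟨fun p => (p.1, -p.2), fun p => (p.1, -p.2),
    fun p => by ext <;> simp, fun p => by ext <;> simp⟩
  have hAA : A * A = 1 := by ext p <;> simp [A]
  have hBB : B * B = 1 := by ext p <;> simp [B]
  have hCC : C * C = 1 := by ext p <;> simp [C]
  have hAC : (A * C) ^ 2 = 1 := by ext p <;> simp [A, C, sq]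
  have hCA : (C * A) ^ 2 = 1 := by ext p <;> simp [A, C, sq]
  have hAB : (A * B) ^ 4 = 1 := by ext p <;> simp [A, B, pow_succ]
  have hBA : (B * A) ^ 4 = 1 := by ext p <;> simp [A, B, pow_succ]
  have hBC : (B * C) ^ 4 = 1 := by ext p <;> simp [B, C, pow_succ]
  have hCB : (C * B) ^ 4 = 1 := by ext p <;> simp [B, C, pow_succ]
  have pd : ∀ (x : Equiv.Perm (ℤ × ℤ)) (k n : ℕ), x ^ k = 1 → k ∣ n → x ^ n = 1 := by
    rintro x k n hx ⟨m, rfl⟩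
    rw [pow_mul, hx, one_pow]
  have e2 : ∀ a ∈ U, ∀ b ∈ U, a ≠ b → 2 ∣ orderOf (a * b) := fun a ha b hb h =>
    even_iff_two_dvd.mp (hU.even ha hb h)
  have f1 := se_four hU hs ht h1 hst
  have f2 := se_four hU ht hu h2 htu
  let f : W → Equiv.Perm (ℤ × ℤ) := fun v =>
    if v = s then A else if v = t then B else if v = u then C else 1
  have fs : f s = A := by simp [f]
  have ft : f t = B := by simp [f, h1.symm]
  have fu : f u = C := by simp [f, h2.symm, h3.symm]
  have fo : ∀ v, v ≠ s → v ≠ t → v ≠ u → f v = 1 := fun v a b c => by simp [f, a, b, c]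
  have f4 : ∀ v, v = s ∨ v = t ∨ v = u ∨ f v = 1 := fun v => by
    by_cases a : v = s
    · exact Or.inl a
    by_cases b : v = t
    · exact Or.inr (Or.inl b)
    by_cases c : v = u
    · exact Or.inr (Or.inr (Or.inl c))
    exact Or.inr (Or.inr (Or.inr (fo v a b c)))
  have ff : ∀ v, f v * f v = 1 := fun v => by
    rcases f4 v with rfl | rfl | rfl | h
    · rw [fs, hAA]
    · rw [ft, hBB]
    · rw [fu, hCC]
    · rw [h, one_mul]
  obtain ⟨F, hF⟩ := fold hS hc hU f (by
    intro a ha b hb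
    by_cases hab : a = b
    · subst hab; rw [ff, one_pow]
    have hd := e2 a ha b hb hab
    have g1 : f a = 1 → (f a * f b) ^ orderOf (a * b) = 1 := fun h => by
      rw [h, one_mul]; exact pd _ 2 _ (by rw [sq, ff]) hd
    have g2 : f b = 1 → (f a * f b) ^ orderOf (a * b) = 1 := fun h => by
      rw [h, mul_one]; exact pd _ 2 _ (by rw [sq, ff]) hd
    rcases f4 a with rfl | rfl | rfl | h
    · rcases f4 b with rfl | rfl | rfl | h
      · exact absurd rfl hab
      · rw [fs, ft]; exact pd _ 4 _ hAB f1
      · rw [fs, fu]; exact pd _ 2 _ hAC hd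
      · exact g2 h
    · rcases f4 b with rfl | rfl | rfl | h
      · rw [fs, ft]; exact pd _ 4 _ hBA (by rwa [ord_comm])
      · exact absurd rfl hab
      · rw [ft, fu]; exact pd _ 4 _ hBC f2
      · exact g2 h
    · rcases f4 b with rfl | rfl | rfl | h
      · rw [fs, fu]; exact pd _ 2 _ hCA hd
      · rw [ft, fu]; exact pd _ 4 _ hCB (by rwa [ord_comm])
      · exact absurd rfl hab
      · exact g2 h
    · exact g1 h)
  have hx : s * t * u * t ∈ Subgroup.closure U :=
    mul_mem (mul_mem (mul_mem (Subgroup.subset_closure hs) (Subgroup.subset_closure ht))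
      (Subgroup.subset_closure hu)) (Subgroup.subset_closure ht)
  have : Finite (Subgroup.closure U : Subgroup W) := hU.1.1.2
  have h := isOfFinOrder_of_finite (⟨_, hx⟩ : (Subgroup.closure U : Subgroup W))
  have h' : IsOfFinOrder (s * t * u * t) := (Submonoid.isOfFinOrder_coe).mpr h
  have h'' := MonoidHom.isOfFinOrder F h'
  rw [map_mul, map_mul, map_mul, hF s hs, hF t ht, hF u hu, fs, ft, fu] at h''
  obtain ⟨n, hn, hn'⟩ := isOfFinOrder_iff_pow_eq_one.mp h''
  have tr : ∀ k : ℕ, ((A * B * C * B) ^ k) (0, 0) = ((k : ℤ), 0) := by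
    intro k
    induction k with
    | zero => simp
    | succ k ih =>
      rw [pow_succ', Equiv.Perm.mul_apply, ih]
      simp [A, B, C]
      ring
  have := tr n
  rw [hn'] at this
  simp at this
  omega

end two

section three

variable {W W' : Type} [Group W] [Group W'] {S : Set W} {S' : Set W'}

theorem char_of (c : W →* ℤˣ) {a b : W} (h : Abelianization.of a = Abelianization.of b) :
    c a = c b := by
  have h1 := congrArg (Abelianization.lift c) h
  simpa using h1

theorem char_one (c : W →* ℤˣ) {V : Set W} (h : ∀ v ∈ V, c v = 1) {x : W}
    (hx : x ∈ Subgroup.closure V) : c x = 1 := by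
  have : Subgroup.closure V ≤ c.ker := (Subgroup.closure_le _).mpr fun v hv => h v hv
  exact this hx

theorem hom_eq {H : Type} [Group H] (c d : W →* H) {V : Set W} (h : ∀ v ∈ V, c v = d v) {x : W}
    (hx : x ∈ Subgroup.closure V) : c x = d x := by
  have : Subgroup.closure V ≤ c.eqLocus d := (Subgroup.closure_le _).mpr fun v hv => h v hv
  exact this hx

theorem ab_split {B : Set W} {d : W} (hd : d * d = 1) {x : W}
    (hx : x ∈ Subgroup.closure (insert d B)) :
    ∃ y ∈ Subgroup.closure B, Abelianization.of x = Abelianization.of y ∨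
      Abelianization.of x = Abelianization.of y * Abelianization.of d := by
  have hdd : Abelianization.of d * Abelianization.of d = 1 := by rw [← map_mul, hd, map_one]
  have hdi : (Abelianization.of d)⁻¹ = Abelianization.of d := inv_eq_of_mul_eq_one_left hdd
  induction hx using Subgroup.closure_induction with
  | mem z hz =>
    rcases hz with rfl | hz
    · exact ⟨1, one_mem _, Or.inr (by simp)⟩
    · exact ⟨z, Subgroup.subset_closure hz, Or.inl rfl⟩
  | one => exact ⟨1, one_mem _, Or.inl rfl⟩
  | mul a b _ _ ha hb =>
    obtain ⟨y, hy, h1⟩ := ha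
    obtain ⟨z, hz, h2⟩ := hb
    refine ⟨y * z, mul_mem hy hz, ?_⟩
    rw [map_mul, map_mul]
    rcases h1 with h1 | h1 <;> rcases h2 with h2 | h2 <;> rw [h1, h2]
    · exact Or.inl rfl
    · exact Or.inr (by rw [mul_assoc])
    · exact Or.inr (by rw [mul_right_comm])
    · exact Or.inl (by rw [mul_mul_mul_comm, hdd, mul_one])
  | inv a _ ha =>
    obtain ⟨y, hy, h1⟩ := ha
    refine ⟨y⁻¹, inv_mem hy, ?_⟩
    rw [map_inv, map_inv]
    rcases h1 with h1 | h1 <;> rw [h1]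
    · exact Or.inl rfl
    · exact Or.inr (by rw [mul_inv, hdi])

theorem ab_mem {U A : Set W} (hfin : U.Finite) (hsq : ∀ s ∈ U, s * s = 1)
    (χ : W → (W →* ℤˣ)) (hχ : ∀ s ∈ U, ∀ t ∈ U, (χ s t = -1 ↔ s = t)) (hA : A ⊆ U) {x : W}
    (hx : x ∈ Subgroup.closure U) (h : ∀ s ∈ U, s ∉ A → χ s x = 1) :
    ∃ y ∈ Subgroup.closure A, Abelianization.of x = Abelianization.of y := by
  have main : ∀ D : Set W, D.Finite → D ⊆ U → ∀ x ∈ Subgroup.closure (A ∪ D),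
      (∀ s ∈ U, s ∉ A → χ s x = 1) →
      ∃ y ∈ Subgroup.closure A, Abelianization.of x = Abelianization.of y := by
    intro D hD
    induction D, hD using Set.Finite.induction_on with
    | empty =>
      intro _ x hx _
      rw [Set.union_empty] at hx
      exact ⟨x, hx, rfl⟩
    | @insert d D hdD _ ih =>
      intro hDU x hx h
      have hdU : d ∈ U := hDU (Set.mem_insert _ _)
      have hDU' : D ⊆ U := fun z hz => hDU (Set.mem_insert_of_mem _ hz)
      rw [Set.union_insert] at hx
      by_cases hdA : d ∈ A
      · rw [Set.insert_eq_of_mem (Set.mem_union_left D hdA)] at hx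
        exact ih hDU' x hx h
      obtain ⟨y, hy, h1⟩ := ab_split (hsq d hdU) hx
      have hdy : χ d y = 1 := by
        refine char_one (χ d) (fun v hv => ?_) hy
        have hvU : v ∈ U := hv.elim (fun a => hA a) (fun a => hDU' a)
        have hne : d ≠ v := by
          rintro rfl
          exact hv.elim hdA hdD
        exact (unit_cases _).resolve_right fun e => hne ((hχ d hdU v hvU).mp e)
      rcases h1 with h1 | h1
      · obtain ⟨z, hz, h2⟩ := ih hDU' y hy (fun s hs hsA => by
          rw [← char_of (χ s) h1]; exact h s hs hsA)
        exact ⟨z, hz, h1.trans h2⟩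
      · exfalso
        rw [← map_mul] at h1
        have h3 := char_of (χ d) h1
        rw [h d hdU hdA, map_mul, hdy, one_mul, (hχ d hdU d hdU).mpr rfl] at h3
        exact unit_ne h3
  exact main U hfin subset_rfl x (Subgroup.closure_mono Set.subset_union_right hx) h

theorem comm_one' {H : Type} [Group H] (θ : W →* H) {U : Set W} (a : H)
    (h : ∀ u ∈ U, Commute (θ u) a) {x : W} (hx : x ∈ Subgroup.closure U) : Commute (θ x) a := by
  have : Subgroup.closure U ≤ (Subgroup.centralizer {a}).comap θ := by
    refine (Subgroup.closure_le _).mpr fun u hu => ?_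
    simp only [Subgroup.coe_comap, Set.mem_preimage, SetLike.mem_coe,
      Subgroup.mem_centralizer_singleton_iff]
    exact h u hu
  have := this hx
  rw [Subgroup.mem_comap, Subgroup.mem_centralizer_singleton_iff] at this
  exact this

theorem comm_two {H : Type} [Group H] (θ : W →* H) {U : Set W}
    (h : ∀ u ∈ U, ∀ v ∈ U, Commute (θ u) (θ v)) {x y : W} (hx : x ∈ Subgroup.closure U)
    (hy : y ∈ Subgroup.closure U) : Commute (θ x) (θ y) :=
  comm_one' θ _ (fun u hu => (comm_one' θ (θ u) (fun v hv => h v hv u hu) hy).symm) hx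

theorem P1 (hS : IsCoxGenSet S) (hS' : IsCoxGenSet S') (hc : Conds S) (hc' : Conds S')
    (φ : W ≃* W') {U : Set W} (hU : SE S U) :
    ∃ (U' : Set W') (Φ : W ≃* W'), SE S' U' ∧
      (∀ x, Abelianization.of (Φ x) = Abelianization.of (φ x)) ∧
      ∀ x, x ∈ Subgroup.closure U ↔ Φ x ∈ Subgroup.closure U' := by
  obtain ⟨χ, hχ⟩ := exists_chi hS hc
  have hb : ∀ s ∈ U, ∀ t ∈ U, (χ s t = -1 ↔ s = t) := fun s hs t ht =>
    hχ.bar hS hc (hU.sub_bar hs) (hU.sub_bar ht)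
  obtain ⟨w', J', hJ', hJf', hw'⟩ := cox_finite hS' ((Subgroup.closure U).map φ.toMonoidHom) (by
    rw [Subgroup.coe_map]; exact hU.1.1.2.image _)
  obtain ⟨U', hU', hJU'⟩ := sph_ext hS' (T := J') ⟨hJ', hJf'⟩
  let Φ : W ≃* W' := φ.trans (MulAut.conj w'⁻¹)
  have hΦ : ∀ x, Φ x = w'⁻¹ * φ x * w' := fun x => by simp [Φ]
  have hΦ1 : ∀ x ∈ Subgroup.closure U, Φ x ∈ Subgroup.closure U' := fun x hx => by
    rw [hΦ]
    exact Subgroup.closure_mono hJU' (hw' (φ x) ⟨x, hx, rfl⟩)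
  obtain ⟨w, J, hJ, hJf, hw⟩ := cox_finite hS ((Subgroup.closure U').map Φ.symm.toMonoidHom) (by
    rw [Subgroup.coe_map]; exact hU'.1.2.image _)
  obtain ⟨V, hV, hJV⟩ := sph_ext hS (T := J) ⟨hJ, hJf⟩
  have hVm : ∀ x, Φ x ∈ Subgroup.closure U' → w⁻¹ * x * w ∈ Subgroup.closure V := fun x hx =>
    Subgroup.closure_mono hJV (hw x ⟨Φ x, hx, by simp⟩)
  have hconj : ∀ (c : W →* ℤˣ) (x : W), c (w⁻¹ * x * w) = c x := fun c x => by
    rw [map_mul, map_mul, map_inv, mul_right_comm, inv_mul_cancel, one_mul]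
  have hUV : U ⊆ V := by
    intro u hu
    have hex : ∃ v ∈ V, χ u v = -1 := by
      by_contra hno
      push Not at hno
      have h1 := char_one (χ u) (fun v hv => (unit_cases _).resolve_right (hno v hv))
        (hVm u (hΦ1 u (Subgroup.subset_closure hu)))
      rw [hconj, (hb u hu u hu).mpr rfl] at h1
      exact unit_ne h1.symm
    obtain ⟨v, hv, huv⟩ := hex
    by_cases hne : u = v
    · rwa [hne]
    have ho := (hχ u (hU.sub hu) v (hV.1.1 hv)).mp huv
    rcases hc.2.2.2 u (hU.sub hu) v (hV.1.1 hv) hne ho U V {u, v} ⟨hU.1, u, hu, by simp⟩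
      ⟨hV, v, hv, by simp⟩ ⟨hc.2.1 u (hU.sub hu) v (hV.1.1 hv) hne ho, u, by simp⟩ with h | h | h
    · rwa [← h]
    · have hvU : v ∈ U := by rw [h]; simp
      exact absurd ((hb u hu v hvU).mp huv) hne
    · rw [h]; simp
  have hVU : V = U := hU.1.2 V hV.1 hUV
  subst hVU
  have hfin : Finite (Subgroup.closure V : Subgroup W) := hV.1.2
  have hcl : ∀ x, Φ x ∈ Subgroup.closure U' → x ∈ Subgroup.closure V := by
    let g : ↥(Subgroup.closure V) → ↥(Subgroup.closure V) :=
      fun x => ⟨w⁻¹ * x * w, hVm x (hΦ1 x x.2)⟩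
    have ginj : Function.Injective g := by
      intro x y hxy
      have := congrArg Subtype.val hxy
      simp only [g] at this
      exact Subtype.ext (by simpa using this)
    have gsurj := Finite.surjective_of_injective ginj
    intro x hx
    obtain ⟨y, hy⟩ := gsurj ⟨_, hVm x hx⟩
    have := congrArg Subtype.val hy
    simp only [g] at this
    have h2 : (y : W) = x := by simpa using this
    rw [← h2]; exact y.2
  refine ⟨U', Φ, ?_, ?_, fun x => ⟨hΦ1 x, hcl x⟩⟩
  swap
  · intro x
    rw [hΦ, map_mul, map_mul, map_inv, mul_right_comm, inv_mul_cancel, one_mul]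
  rcases maxSph_cases hc' hU' with h | ⟨s, hs, t, ht, hne, ho, hst⟩
  · exact h
  exfalso
  have hsU : s ∈ U' := by rw [hst]; simp
  have htU : t ∈ U' := by rw [hst]; simp
  have hagree : ∀ c : W' →* ℤˣ, c s = c t := by
    intro c
    have h1 : c (s * t) ^ orderOf (s * t) = 1 := by rw [← map_pow, pow_orderOf_eq_one, map_one]
    rw [map_mul] at h1
    rcases unit_cases (c s) with h2 | h2 <;> rcases unit_cases (c t) with h3 | h3 <;>
      rw [h2, h3] at h1 ⊢
    · rw [one_mul, ho.neg_one_pow] at h1; exact absurd h1.symm unit_ne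
    · rw [mul_one, ho.neg_one_pow] at h1; exact absurd h1.symm unit_ne
  by_cases hUs : ∃ u ∈ V, ∃ v ∈ V, u ≠ v
  · obtain ⟨u, hu, v, hv, huv⟩ := hUs
    have hneg : ∀ a ∈ V, (χ a).comp Φ.symm.toMonoidHom s = -1 := by
      intro a ha
      refine (unit_cases _).resolve_left fun h1 => ?_
      have h2 := char_one ((χ a).comp Φ.symm.toMonoidHom) (V := U') (by
        intro z hz
        rw [hst] at hz
        rcases hz with rfl | hz
        · exact h1
        · rw [Set.mem_singleton_iff] at hz
          rw [hz, ← hagree]; exact h1) (hΦ1 a (Subgroup.subset_closure ha))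
      have h3 : χ a a = 1 := by simpa using h2
      rw [(hb a ha a ha).mpr rfl] at h3
      exact unit_ne h3.symm
    have h2 := hom_eq ((χ u).comp Φ.symm.toMonoidHom) ((χ v).comp Φ.symm.toMonoidHom) (V := U') (by
      intro z hz
      rw [hst] at hz
      rcases hz with rfl | hz
      · rw [hneg u hu, hneg v hv]
      · rw [Set.mem_singleton_iff] at hz
        rw [hz, ← hagree, ← hagree, hneg u hu, hneg v hv]) (hΦ1 u (Subgroup.subset_closure hu))
    have h3 : χ u u = χ v u := by simpa using h2
    rw [(hb u hu u hu).mpr rfl] at h3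
    exact huv ((hb v hv u hu).mp h3.symm).symm
  · push Not at hUs
    have hcomm := comm_two Φ.toMonoidHom (U := V)
      (x := Φ.symm s) (y := Φ.symm t) (fun u hu v hv => by rw [hUs u hu v hv])
      (hcl _ (by simpa using Subgroup.subset_closure hsU))
      (hcl _ (by simpa using Subgroup.subset_closure htU))
    have hcm : s * t = t * s := by simpa using hcomm.eq
    have h2 : (s * t) ^ 2 = 1 := by
      rw [sq]
      nth_rw 2 [hcm]
      rw [mul_assoc, ← mul_assoc t, sq_one hS' ht, one_mul, sq_one hS' hs]
    have h3 := orderOf_dvd_of_pow_eq_one h2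
    have h4 : orderOf (s * t) = 1 := by
      rcases (Nat.dvd_prime Nat.prime_two).mp h3 with h | h
      · exact h
      · rw [h] at ho; exact absurd ho (by decide)
    rw [orderOf_eq_one_iff] at h4
    apply hne
    have := eq_inv_of_mul_eq_one_left h4
    rw [this]
    exact inv_eq_of_mul_eq_one_left (sq_one hS' ht)

end three

section four

variable {W W' : Type} [Group W] [Group W'] {S : Set W} {S' : Set W'}

theorem comm_of_sq {a b : W} (ha : a * a = 1) (hb : b * b = 1) (h : (a * b) ^ 2 = 1) :
    a * b = b * a := by
  have h1 : a⁻¹ = a := inv_eq_of_mul_eq_one_left ha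
  have h2 : b⁻¹ = b := inv_eq_of_mul_eq_one_left hb
  rw [sq] at h
  have h3 := eq_inv_of_mul_eq_one_left h
  rw [mul_inv_rev, h1, h2] at h3
  exact h3

theorem sq_of_comm {a b : W} (ha : a * a = 1) (hb : b * b = 1) (h : a * b = b * a) :
    (a * b) ^ 2 = 1 := by
  rw [sq]
  nth_rw 2 [h]
  rw [mul_assoc, ← mul_assoc b, hb, one_mul, ha]

theorem pairs (hS : IsCoxGenSet S) (hS' : IsCoxGenSet S') (hc : Conds S) (hc' : Conds S')
    {U : Set W} {U' : Set W'} (hU : SE S U) (hU' : SE S' U') (Φ : W ≃* W')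
    (hΦ : ∀ x, x ∈ Subgroup.closure U ↔ Φ x ∈ Subgroup.closure U')
    {χ : W' → (W' →* ℤˣ)} (hχ : IsChi S' χ) {s t : W'} (hs : s ∈ U') (ht : t ∈ U')
    (hne : s ≠ t) (h2 : orderOf (s * t) ≠ 2) :
    ∃ u ∈ U, ∃ v ∈ U, u ≠ v ∧ orderOf (u * v) ≠ 2 ∧ orderOf (s * t) ∣ orderOf (u * v) ∧
      (∀ w ∈ U, w ≠ u → w ≠ v → χ s (Φ w) = 1 ∧ χ t (Φ w) = 1) ∧
      (∀ w ∈ U, w = u ∨ w = v → χ s (Φ w) * χ t (Φ w) = -1) := by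
  have hb : ∀ s ∈ U', ∀ t ∈ U', (χ s t = -1 ↔ s = t) := fun s hs t ht =>
    hχ.bar hS' hc' (hU'.sub_bar hs) (hU'.sub_bar ht)
  have hb1 : ∀ s ∈ U', ∀ t ∈ U', s ≠ t → χ s t = 1 := fun s hs t ht h =>
    (unit_cases _).resolve_right fun e => h ((hb s hs t ht).mp e)
  have h4 := se_four hU' hs ht hne h2
  have hss := sq_one hS' (hU'.sub hs)
  have htt := sq_one hS' (hU'.sub ht)
  obtain ⟨p, ps, pt, po⟩ := fold_pair hS' hc' hU' hs ht
  let θ : W →* W' := p.comp Φ.toMonoidHom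
  have hθ : ∀ x, θ x = p (Φ x) := fun x => rfl
  have cs := (hb s hs s hs).mpr rfl
  have ct := hb1 s hs t ht hne
  have ds := hb1 t ht s hs hne.symm
  have dt := (hb t ht t ht).mpr rfl
  -- values of the retraction
  have pmem : ∀ y ∈ Subgroup.closure U', p y ∈ Subgroup.closure ({s, t} : Set W') := by
    intro y hy
    have : Subgroup.closure U' ≤ (Subgroup.closure ({s, t} : Set W')).comap p := by
      refine (Subgroup.closure_le _).mpr fun z hz => ?_
      rw [SetLike.mem_coe, Subgroup.mem_comap]
      by_cases e1 : z = s
      · rw [e1, ps]; exact Subgroup.subset_closure (by simp)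
      by_cases e2 : z = t
      · rw [e2, pt]; exact Subgroup.subset_closure (by simp)
      · rw [po z hz e1 e2]; exact one_mem _
    exact this hy
  have pc : ∀ a ∈ U', (a = s ∨ a = t) → ∀ y ∈ Subgroup.closure U', χ a (p y) = χ a y := by
    intro a ha hast y hy
    refine hom_eq ((χ a).comp p) (χ a) (fun z hz => ?_) hy
    by_cases e1 : z = s
    · rw [e1, MonoidHom.comp_apply, ps]
    by_cases e2 : z = t
    · rw [e2, MonoidHom.comp_apply, pt]
    rw [MonoidHom.comp_apply, po z hz e1 e2, map_one, hb1 a ha z hz]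
    rintro rfl
    exact hast.elim e1 e2
  have hUc : ∀ w ∈ U, Φ w ∈ Subgroup.closure U' := fun w hw =>
    (hΦ w).mp (Subgroup.subset_closure hw)
  have θc : ∀ w ∈ U, χ s (θ w) = χ s (Φ w) := fun w hw => pc s hs (Or.inl rfl) _ (hUc w hw)
  have θd : ∀ w ∈ U, χ t (θ w) = χ t (Φ w) := fun w hw => pc t ht (Or.inr rfl) _ (hUc w hw)
  have θsq : ∀ w ∈ U, θ w * θ w = 1 := fun w hw => by
    rw [← map_mul, sq_one hS (hU.sub hw), map_one]
  obtain ⟨r, hr⟩ : ∃ r, r = s * t := ⟨_, rfl⟩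
  have θform : ∀ w ∈ U, ∃ i : ℤ, θ w = r ^ i ∨ θ w = r ^ i * s := fun w hw => by
    rw [hr]; exact dih_mem hss htt (pmem _ (hUc w hw))
  have hconj : ∀ k : ℤ, s * r ^ k = r ^ (-k) * s := fun k => by rw [hr]; exact dih_conj hss htt k
  rw [← hr] at h4 ⊢
  have cr : χ s r = -1 := by rw [hr, map_mul, cs, ct, mul_one]
  have dr : χ t r = -1 := by rw [hr, map_mul, ds, dt, one_mul]
  -- rotation involutions
  have rot : ∀ i : ℤ, r ^ i * r ^ i = 1 → χ s (r ^ i) = 1 ∧ χ t (r ^ i) = 1 ∧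
      Commute (r ^ i) s := by
    intro i hi
    have hd : (orderOf r : ℤ) ∣ i + i := orderOf_dvd_iff_zpow_eq_one.mpr (by rw [zpow_add, hi])
    have h5 : (4 : ℤ) ∣ i + i := dvd_trans (by exact_mod_cast h4) hd
    have he : Even i := by
      rw [Int.even_iff]; omega
    refine ⟨?_, ?_, ?_⟩
    · rw [map_zpow, cr, he.neg_one_zpow]
    · rw [map_zpow, dr, he.neg_one_zpow]
    · have := hconj i
      have h6 : r ^ (-i) = r ^ i := by
        rw [zpow_neg]; exact inv_eq_of_mul_eq_one_left hi
      rw [h6] at this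
      exact this.symm
  have refl_mul : ∀ i j : ℤ, (r ^ i * s) * (r ^ j * s) = r ^ (i - j) := by
    intro i j
    rw [mul_assoc, ← mul_assoc s, hconj, mul_assoc, hss, mul_one, ← zpow_add, sub_eq_add_neg]
  have rotcomm : ∀ i j : ℤ, r ^ i * r ^ i = 1 → Commute (r ^ i) (r ^ j) ∧
      Commute (r ^ i) (r ^ j * s) := by
    intro i j hi
    have h1 : Commute (r ^ i) (r ^ j) := (Commute.refl r).zpow_zpow i j
    exact ⟨h1, h1.mul_right (rot i hi).2.2⟩
  -- two generators with non-commuting images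
  have hex : ∃ u ∈ U, ∃ v ∈ U, ¬ Commute (θ u) (θ v) := by
    by_contra hno
    push Not at hno
    have h5 := comm_two θ (x := Φ.symm s) (y := Φ.symm t) hno
      ((hΦ _).mpr (by simpa using Subgroup.subset_closure hs))
      ((hΦ _).mpr (by simpa using Subgroup.subset_closure ht))
    rw [hθ, hθ, MulEquiv.apply_symm_apply, MulEquiv.apply_symm_apply, ps, pt] at h5
    have h6 := orderOf_dvd_of_pow_eq_one (sq_of_comm hss htt h5.eq)
    rw [← hr] at h6
    have := Nat.le_of_dvd (by norm_num) (h4.trans h6)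
    omega
  obtain ⟨u, hu, v, hv, hnc⟩ := hex
  have huv : u ≠ v := by
    rintro rfl
    exact hnc (Commute.refl _)
  have ho2 : orderOf (u * v) ≠ 2 := by
    intro h
    apply hnc
    have := comm_of_sq (sq_one hS (hU.sub hu)) (sq_one hS (hU.sub hv)) (h ▸ pow_orderOf_eq_one _)
    exact (show Commute u v from this).map θ
  have hisrefl : ∀ a ∈ U, ∀ b ∈ U, ¬ Commute (θ a) (θ b) → ∃ i : ℤ, θ a = r ^ i * s := by
    intro a ha b hb hab
    obtain ⟨i, hi | hi⟩ := θform a ha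
    · exfalso
      apply hab
      have h5 : r ^ i * r ^ i = 1 := by rw [← hi]; exact θsq a ha
      obtain ⟨j, hj | hj⟩ := θform b hb
      · rw [hi, hj]; exact (rotcomm i j h5).1
      · rw [hi, hj]; exact (rotcomm i j h5).2
    · exact ⟨i, hi⟩
  obtain ⟨i, hi⟩ := hisrefl u hu v hv hnc
  obtain ⟨j, hj⟩ := hisrefl v hv u hu fun h => hnc h.symm
  have hother : ∀ w ∈ U, w ≠ u → w ≠ v → ∃ l : ℤ, θ w = r ^ l ∧ r ^ l * r ^ l = 1 := by
    intro w hw hwu hwv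
    have o1 : orderOf (w * u) = 2 := by
      by_contra h
      exact struct_pair hS hc hU hw hu hv hwu huv hwv h ho2
    have o2 : orderOf (w * v) = 2 := by
      by_contra h
      exact struct_pair hS hc hU hw hv hu hwv huv.symm hwu h (by rwa [ord_comm])
    have e1 : (θ w * θ u) ^ 2 = 1 := by
      rw [← map_mul, ← map_pow, ← o1, pow_orderOf_eq_one, map_one]
    have e2 : (θ w * θ v) ^ 2 = 1 := by
      rw [← map_mul, ← map_pow, ← o2, pow_orderOf_eq_one, map_one]
    obtain ⟨l, hl | hl⟩ := θform w hw
    · exact ⟨l, hl, by rw [← hl]; exact θsq w hw⟩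
    · exfalso
      rw [hl, hi, refl_mul] at e1
      rw [hl, hj, refl_mul] at e2
      apply hnc
      have e3 : (θ u * θ v) ^ 2 = 1 := by
        rw [hi, hj, refl_mul]
        have : i - j = -(l - i) + (l - j) := by ring
        rw [this, zpow_add, ((Commute.refl r).zpow_zpow _ _).mul_pow, e2, zpow_neg, inv_pow, e1]
        simp
      exact comm_of_sq (θsq u hu) (θsq v hv) e3
  let ε : W' →* ℤˣ := χ s * χ t
  have hε : ∀ x, ε x = χ s x * χ t x := fun x => rfl
  have εr : ε r = 1 := by rw [hε, cr, dr]; rfl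
  have εs : ε s = -1 := by rw [hε, cs, ds]; rfl
  have εref : ∀ k : ℤ, ε (r ^ k * s) = -1 := fun k => by
    rw [map_mul, map_zpow, εr, one_zpow, one_mul, εs]
  refine ⟨u, hu, v, hv, huv, ho2, ?_, ?_, ?_⟩
  · -- divisibility
    obtain ⟨ρ, hρ⟩ : ∃ ρ, ρ = θ u * θ v := ⟨_, rfl⟩
    obtain ⟨σ, hσ⟩ : ∃ σ, σ = θ u := ⟨_, rfl⟩
    have hρr : ρ = r ^ (i - j) := by rw [hρ, hi, hj, refl_mul]
    have hσσ : σ * σ = 1 := by rw [hσ]; exact θsq u hu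
    have hv' : θ v = σ * ρ := by rw [hρ, hσ, ← mul_assoc, θsq u hu, one_mul]
    have dc : ∀ k : ℤ, σ * ρ ^ k = ρ ^ (-k) * σ := fun k => by
      rw [hρ, hσ]; exact dih_conj (θsq u hu) (θsq v hv) k
    have ecomm : ∀ e : W', e * e = 1 → (∃ l : ℤ, e = r ^ l) →
        (∀ a : ℤ, Commute e (ρ ^ a)) ∧ Commute e σ := by
      rintro e he ⟨l, rfl⟩
      refine ⟨fun a => ?_, ?_⟩
      · rw [hρr, ← zpow_mul]; exact (rotcomm l _ he).1
      · rw [hσ, hi]; exact (rotcomm l _ he).2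
    let P : W' → Prop := fun z => ∃ a : ℤ, ∃ e : W', e * e = 1 ∧ (∃ l : ℤ, e = r ^ l) ∧
      (z = ρ ^ a * e ∨ z = ρ ^ a * e * σ)
    have Pσ : ∀ z, P z → P (σ * z) := by
      rintro z ⟨a, e, he, hl, h | h⟩
      · refine ⟨-a, e, he, hl, Or.inr ?_⟩
        rw [h, ← mul_assoc, dc, mul_assoc, mul_assoc, ((ecomm e he hl).2).eq]
      · refine ⟨-a, e, he, hl, Or.inl ?_⟩
        rw [h, ← mul_assoc, ← mul_assoc, dc, mul_assoc, mul_assoc, ← mul_assoc σ,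
          ← ((ecomm e he hl).2).eq, mul_assoc, hσσ, mul_one]
    have Pρ : ∀ z, P z → P (ρ * z) := by
      rintro z ⟨a, e, he, hl, h | h⟩
      · exact ⟨1 + a, e, he, hl, Or.inl (by rw [h, zpow_add, zpow_one, mul_assoc])⟩
      · exact ⟨1 + a, e, he, hl, Or.inr (by rw [h, zpow_add, zpow_one]; simp only [mul_assoc])⟩
    have Pe : ∀ f : W', f * f = 1 → (∃ l : ℤ, f = r ^ l) → ∀ z, P z → P (f * z) := by
      rintro f hf hfl z ⟨a, e, he, hl, h⟩
      have hfe : Commute f e := by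
        obtain ⟨l, rfl⟩ := hl
        obtain ⟨k, rfl⟩ := hfl
        exact (Commute.refl r).zpow_zpow k l
      refine ⟨a, f * e, ?_, ?_, ?_⟩
      · rw [hfe.symm.mul_mul_mul_comm, hf, he, one_mul]
      · obtain ⟨l, rfl⟩ := hl
        obtain ⟨k, rfl⟩ := hfl
        exact ⟨k + l, by rw [zpow_add]⟩
      · have h5 := ((ecomm f hf hfl).1 a).eq
        rcases h with h | h
        · left; rw [h, ← mul_assoc, h5, mul_assoc]
        · right; rw [h, ← mul_assoc, ← mul_assoc, h5]; simp only [mul_assoc]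
    have Pgen : ∀ w ∈ U, ∀ z, P z → P (θ w * z) := by
      intro w hw z hz
      by_cases e1 : w = u
      · rw [e1, ← hσ]; exact Pσ z hz
      by_cases e2 : w = v
      · rw [e2, hv', mul_assoc]; exact Pσ _ (Pρ z hz)
      obtain ⟨l, hl, hl2⟩ := hother w hw e1 e2
      exact Pe _ (θsq w hw) ⟨l, hl⟩ z hz
    have Pall : ∀ x ∈ Subgroup.closure U, P (θ x) := by
      intro x hx
      induction hx using Subgroup.closure_induction_left with
      | one => exact ⟨0, 1, one_mul 1, ⟨0, by simp⟩, Or.inl (by simp)⟩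
      | mul_left w hw y _ hy => rw [map_mul]; exact Pgen w hw _ hy
      | inv_mul_cancel w hw y _ hy =>
        rw [map_mul, map_inv, inv_eq_of_mul_eq_one_left (θsq w hw)]
        exact Pgen w hw _ hy
    obtain ⟨a, e, he, hl, h⟩ := Pall (Φ.symm r) ((hΦ _).mpr (by
      rw [MulEquiv.apply_symm_apply, hr]
      exact mul_mem (Subgroup.subset_closure hs) (Subgroup.subset_closure ht)))
    have hθr : θ (Φ.symm r) = r := by
      rw [hθ, MulEquiv.apply_symm_apply, hr, map_mul, ps, pt]
    rw [hθr] at h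
    rcases h with h | h
    · apply orderOf_dvd_of_pow_eq_one
      have hρn : ρ ^ orderOf (u * v) = 1 := by
        rw [hρ, ← map_mul, ← map_pow, pow_orderOf_eq_one, map_one]
      obtain ⟨k, hk⟩ := hU.even hu hv huv
      have hen : e ^ orderOf (u * v) = 1 := by
        rw [hk, ← two_mul, pow_mul, sq, he, one_pow]
      have h6 := ((ecomm e he hl).1 a).symm.mul_pow (orderOf (u * v))
      rw [← h] at h6
      rw [h6, hen, mul_one, ← zpow_natCast, ← zpow_mul, mul_comm, zpow_mul, zpow_natCast, hρn,
        one_zpow]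
    · exfalso
      obtain ⟨l, rfl⟩ := hl
      have h6 := congrArg ε h
      rw [map_mul, map_mul, map_zpow, map_zpow, hρr, map_zpow, εr, hσ, hi, εref] at h6
      simp at h6
  · intro w hw e1 e2
    obtain ⟨l, hl, hl2⟩ := hother w hw e1 e2
    rw [← θc w hw, ← θd w hw, hl]
    exact ⟨(rot l hl2).1, (rot l hl2).2.1⟩
  · intro w hw hwuv
    rw [← θc w hw, ← θd w hw, ← hε]
    rcases hwuv with rfl | rfl
    · rw [hi, εref]
    · rw [hj, εref]

end four

section five

variable {W W' : Type} [Group W] [Group W'] {S : Set W} {S' : Set W'}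

theorem of_map (f : W →* W') {a b : W} (h : Abelianization.of a = Abelianization.of b) :
    Abelianization.of (f a) = Abelianization.of (f b) := by
  have h1 := congrArg (Abelianization.map f) h
  simpa using h1

theorem pair_SE (hc : Conds S) {U : Set W} (hU : IsMaxSpherical S U) {a b : W} (ha : a ∈ Sbar S)
    (hb : b ∈ Sbar S) (hab : a ≠ b) (haU : a ∈ U) (hbU : b ∈ U) : SE S U := by
  rcases maxSph_cases hc hU with h | ⟨s, _, t, _, hne, ho, rfl⟩
  · exact h
  exfalso
  have hn := bar_not_odd hc ha hb hab
  simp only [Set.mem_insert_iff, Set.mem_singleton_iff] at haU hbU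
  rcases haU with rfl | rfl <;> rcases hbU with rfl | rfl
  · exact hab rfl
  · exact hn ho
  · exact hn (by rwa [ord_comm])
  · exact hab rfl

theorem fin_closure {D : Set W} (hD : D.Finite) :
    (∀ s ∈ D, s * s = 1) → (∀ s ∈ D, ∀ t ∈ D, s * t = t * s) →
    ((Subgroup.closure D : Subgroup W) : Set W).Finite := by
  induction D, hD using Set.Finite.induction_on with
  | empty => intro _ _; simp
  | @insert d D _ _ ih =>
    intro h1 h2
    have hf := ih (fun s hs => h1 s (Or.inr hs)) (fun s hs t ht => h2 s (Or.inr hs) t (Or.inr ht))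
    have hdd := h1 d (Or.inl rfl)
    refine (hf.union (hf.image (fun x => d * x))).subset ?_
    intro x hx
    have gen : ∀ w ∈ insert d D, ∀ y : W, (y ∈ Subgroup.closure D ∨
        ∃ z ∈ Subgroup.closure D, d * z = y) → (w * y ∈ Subgroup.closure D ∨
        ∃ z ∈ Subgroup.closure D, d * z = w * y) := by
      rintro w hw y hy
      rcases hw with rfl | hw
      · rcases hy with hy | ⟨z, hz, rfl⟩
        · exact Or.inr ⟨y, hy, rfl⟩
        · left; rwa [← mul_assoc, hdd, one_mul]
      · have hwc := Subgroup.subset_closure hw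
        rcases hy with hy | ⟨z, hz, rfl⟩
        · exact Or.inl (mul_mem hwc hy)
        · refine Or.inr ⟨w * z, mul_mem hwc hz, ?_⟩
          rw [← mul_assoc, ← mul_assoc, h2 d (Or.inl rfl) w (Or.inr hw)]
    have main : x ∈ Subgroup.closure D ∨ ∃ z ∈ Subgroup.closure D, d * z = x := by
      induction hx using Subgroup.closure_induction_left with
      | one => exact Or.inl (one_mem _)
      | mul_left w hw y _ hy => exact gen w hw y hy
      | inv_mul_cancel w hw y _ hy =>
        rw [inv_eq_of_mul_eq_one_left (h1 w hw)]; exact gen w hw y hy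
    exact main

theorem indep_SE (hS : IsCoxGenSet S) (hc : Conds S) {T : Set W} (hT : IsIndep T)
    (hTS : T ⊆ Sbar S) (hne : T.Nonempty) : ∃ U, SE S U ∧ T ⊆ U := by
  by_cases h : ∃ a ∈ T, ∃ b ∈ T, a ≠ b
  · obtain ⟨a, ha, b, hb, hab⟩ := h
    have hsq : ∀ s ∈ T, s * s = 1 := fun s hs => sq_one hS (bar_sub (hTS hs))
    have hsph : IsSpherical S T := by
      refine ⟨hTS.trans bar_sub, fin_closure (hS.1.subset (hTS.trans bar_sub)) hsq ?_⟩
      intro s hs t ht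
      by_cases e : s = t
      · rw [e]
      exact comm_of_sq (hsq s hs) (hsq t ht) (by rw [← hT s hs t ht e, pow_orderOf_eq_one])
    obtain ⟨U, hU, hTU⟩ := sph_ext hS hsph
    exact ⟨U, pair_SE hc hU (hTS ha) (hTS hb) hab (hTU ha) (hTU hb), hTU⟩
  · push Not at h
    obtain ⟨a, ha⟩ := hne
    obtain ⟨U, hU, haU⟩ := hTS ha
    exact ⟨U, hU, fun b hb => by rwa [h b hb a ha]⟩

theorem indep_step (hS : IsCoxGenSet S) (hS' : IsCoxGenSet S') (hc : Conds S) (hc' : Conds S')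
    (φ : W ≃* W') {T : Set W} (hT : IsIndep T) (hTS : T ⊆ Sbar S) :
    ∃ T' : Set W', IsIndep T' ∧ T' ⊆ Sbar S' ∧ ∀ x ∈ Subgroup.closure T,
      ∃ y ∈ Subgroup.closure T', Abelianization.of (φ x) = Abelianization.of y := by
  rcases T.eq_empty_or_nonempty with rfl | hne
  · refine ⟨∅, fun s hs => absurd hs (Set.notMem_empty s), Set.empty_subset _, fun x hx => ?_⟩
    rw [Subgroup.closure_empty, Subgroup.mem_bot] at hx
    exact ⟨1, one_mem _, by rw [hx, map_one]⟩
  obtain ⟨U, hU, hTU⟩ := indep_SE hS hc hT hTS hne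
  obtain ⟨U', Φ, hU', hof, hcl⟩ := P1 hS hS' hc hc' φ hU
  obtain ⟨χ, hχ⟩ := exists_chi hS' hc'
  refine ⟨{s | s ∈ U' ∧ ∃ x ∈ T, χ s (Φ x) = -1}, ?_, fun s hs => hU'.sub_bar hs.1, ?_⟩
  · rintro s ⟨hs, x, hx, hsx⟩ t ⟨ht, y, hy, hty⟩ hst
    by_contra h2
    obtain ⟨u, hu, v, hv, huv, ho, _, h3, h4⟩ := pairs hS hS' hc hc' hU hU' Φ hcl hχ hs ht hst h2
    have hxuv : x = u ∨ x = v := by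
      by_contra hn
      push Not at hn
      rw [(h3 x (hTU hx) hn.1 hn.2).1] at hsx
      exact unit_ne hsx
    have hyuv : y = u ∨ y = v := by
      by_contra hn
      push Not at hn
      rw [(h3 y (hTU hy) hn.1 hn.2).2] at hty
      exact unit_ne hty
    by_cases hxy : x = y
    · subst hxy
      have := h4 x (hTU hx) hxuv
      rw [hsx, hty] at this
      exact absurd this (by decide)
    · have h5 := hT x hx y hy hxy
      rcases hxuv with rfl | rfl <;> rcases hyuv with rfl | rfl
      · exact hxy rfl
      · exact ho h5
      · exact ho (by rwa [ord_comm])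
      · exact hxy rfl
  · intro x hx
    obtain ⟨y, hy, h⟩ := ab_mem (A := {s | s ∈ U' ∧ ∃ x ∈ T, χ s (Φ x) = -1})
      (hS'.1.subset hU'.sub) (fun s hs => sq_one hS' (hU'.sub hs)) χ
      (fun s hs t ht => hχ.bar hS' hc' (hU'.sub_bar hs) (hU'.sub_bar ht)) (fun s hs => hs.1)
      ((hcl x).mp (Subgroup.closure_mono hTU hx)) (by
        intro s hs hsT
        refine char_one ((χ s).comp Φ.toMonoidHom) (fun z hz => ?_) hx
        refine (unit_cases _).resolve_right fun e => hsT ⟨hs, z, hz, e⟩)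
    exact ⟨y, hy, by rw [← hof, h]⟩

theorem tau_iff (φ : W ≃* W') (A : Set W) (A' : Set W') : Tau φ.toMonoidHom A A' ↔
    (∀ x ∈ Subgroup.closure A, ∃ y ∈ Subgroup.closure A',
      Abelianization.of (φ x) = Abelianization.of y) ∧
    (∀ y ∈ Subgroup.closure A', ∃ x ∈ Subgroup.closure A,
      Abelianization.of (φ x) = Abelianization.of y) := by
  unfold Tau
  constructor
  · intro h
    refine ⟨fun x hx => ?_, fun y hy => ?_⟩
    · have : Abelianization.of (φ x) ∈ Subgroup.map Abelianization.of (Subgroup.closure A') := by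
        rw [← h]; exact ⟨x, hx, rfl⟩
      obtain ⟨y, hy, e⟩ := this
      exact ⟨y, hy, e.symm⟩
    · have : Abelianization.of y ∈
          Subgroup.map (Abelianization.of.comp φ.toMonoidHom) (Subgroup.closure A) := by
        rw [h]; exact ⟨y, hy, rfl⟩
      obtain ⟨x, hx, e⟩ := this
      exact ⟨x, hx, e⟩
  · rintro ⟨h1, h2⟩
    ext z
    constructor
    · rintro ⟨x, hx, rfl⟩
      obtain ⟨y, hy, e⟩ := h1 x hx
      exact ⟨y, hy, e.symm⟩
    · rintro ⟨y, hy, rfl⟩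
      obtain ⟨x, hx, e⟩ := h2 y hy
      exact ⟨x, hx, e⟩

theorem of_symm (φ : W ≃* W') {x : W} {y : W'} :
    Abelianization.of (φ x) = Abelianization.of y ↔
      Abelianization.of (φ.symm y) = Abelianization.of x := by
  constructor
  · intro h
    have := of_map φ.symm.toMonoidHom h
    simpa using this.symm
  · intro h
    have := of_map φ.toMonoidHom h
    simpa using this.symm

theorem tau_symm (φ : W ≃* W') {A : Set W} {A' : Set W'} (h : Tau φ.symm.toMonoidHom A' A) :
    Tau φ.toMonoidHom A A' := by
  rw [tau_iff] at h ⊢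
  refine ⟨fun x hx => ?_, fun y hy => ?_⟩
  · obtain ⟨y, hy, e⟩ := h.2 x hx
    exact ⟨y, hy, (of_symm φ).mpr e⟩
  · obtain ⟨x, hx, e⟩ := h.1 y hy
    exact ⟨x, hx, (of_symm φ).mpr e⟩

theorem chi_mem (hS : IsCoxGenSet S) (hc : Conds S) {χ : W → (W →* ℤˣ)} (hχ : IsChi S χ)
    {V : Set W} (hV : V ⊆ Sbar S) {q z : W} (hq : q ∈ Sbar S) (hz : z ∈ Subgroup.closure V)
    (h : χ q z = -1) : q ∈ V := by
  by_contra hn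
  have := char_one (χ q) (V := V) (fun v hv => (unit_cases _).resolve_right fun e => hn (by
    rwa [(hχ.bar hS hc hq (hV hv)).mp e])) hz
  rw [this] at h
  exact unit_ne h

theorem P2 (hS : IsCoxGenSet S) (hS' : IsCoxGenSet S') (hc : Conds S) (hc' : Conds S')
    (φ : W ≃* W') {T : Set W} (hT : IsMaxIndep (Sbar S) T) :
    ∃ T' : Set W', IsMaxIndep (Sbar S') T' ∧ Tau φ.toMonoidHom T T' := by
  obtain ⟨χ, hχ⟩ := exists_chi hS hc
  obtain ⟨T', hT', hTS', h1⟩ := indep_step hS hS' hc hc' φ hT.1 hT.2.1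
  obtain ⟨V', hV', hTV'⟩ := ind_ext hS' hT' hTS'
  obtain ⟨V, hV, hVS, h2⟩ := indep_step hS' hS hc' hc φ.symm hV'.1 hV'.2.1
  have h1' : ∀ x ∈ Subgroup.closure T, ∃ y ∈ Subgroup.closure V',
      Abelianization.of (φ x) = Abelianization.of y := fun x hx => by
    obtain ⟨y, hy, e⟩ := h1 x hx
    exact ⟨y, Subgroup.closure_mono hTV' hy, e⟩
  have hTV : T ⊆ V := by
    intro t ht
    obtain ⟨y, hy, e⟩ := h1' t (Subgroup.subset_closure ht)
    obtain ⟨z, hz, e'⟩ := h2 y hy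
    have e2 := (of_symm φ).mp e
    rw [e'] at e2
    refine chi_mem hS hc hχ hVS (hT.2.1 ht) hz ?_
    rw [char_of (χ t) e2]
    exact (hχ.bar hS hc (hT.2.1 ht) (hT.2.1 ht)).mpr rfl
  have hVT : V = T := hT.2.2 V hV hVS hTV
  subst hVT
  refine ⟨V', hV', (tau_iff _ _ _).mpr ⟨h1', fun y hy => ?_⟩⟩
  obtain ⟨z, hz, e⟩ := h2 y hy
  exact ⟨z, hz, (of_symm φ).mpr e⟩

theorem main_dvd (hS : IsCoxGenSet S) (hS' : IsCoxGenSet S') (hc : Conds S) (hc' : Conds S')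
    (φ : W ≃* W') (ψ : ↥(Sbar S) ≃ ↥(Sbar S'))
    (H : ∀ (T : Set W) (T' : Set W'), (SE S T ∨ IsMaxIndep (Sbar S) T) →
      (SE S' T' ∨ IsMaxIndep (Sbar S') T') → Tau φ.toMonoidHom T T' →
      ∀ s : ↥(Sbar S), (s : W) ∈ T ↔ (ψ s : W') ∈ T')
    (s t : ↥(Sbar S)) (hst : s ≠ t) (h0 : orderOf ((s : W) * t) ≠ 0) :
    orderOf ((ψ s : W') * ψ t) ∣ orderOf ((s : W) * t) := by
  obtain ⟨χ, hχ⟩ := exists_chi hS hc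
  obtain ⟨χ', hχ'⟩ := exists_chi hS' hc'
  have hne : (s : W) ≠ t := fun e => hst (Subtype.ext e)
  have hne' : (ψ s : W') ≠ ψ t := fun e => hst (ψ.injective (Subtype.ext e))
  obtain ⟨U, hUm, hsub⟩ := sph_ext hS (pair_sph hS (bar_sub s.2) (bar_sub t.2) h0)
  have hsU : (s : W) ∈ U := hsub (by simp)
  have htU : (t : W) ∈ U := hsub (by simp)
  have hU : SE S U := pair_SE hc hUm s.2 t.2 hne hsU htU
  obtain ⟨U', Φ, hU', hof, hcl⟩ := P1 hS hS' hc hc' φ hU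
  have hτ : Tau φ.toMonoidHom U U' := by
    rw [tau_iff]
    refine ⟨fun x hx => ⟨Φ x, (hcl x).mp hx, (hof x).symm⟩, fun y hy => ⟨Φ.symm y, ?_, ?_⟩⟩
    · rw [hcl]; simpa using hy
    · rw [← hof]; simp
  have hmem := H U U' (Or.inl hU) (Or.inl hU') hτ
  have hsU' := (hmem s).mp hsU
  have htU' := (hmem t).mp htU
  by_cases h2 : orderOf ((ψ s : W') * ψ t) = 2
  · rw [h2]; exact even_iff_two_dvd.mp (hU.even hsU htU hne)
  obtain ⟨u, hu, v, hv, huv, ho, hdvd, h3, _⟩ :=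
    pairs hS hS' hc hc' hU hU' Φ hcl hχ' hsU' htU' hne' h2
  have claim : ∀ a : ↥(Sbar S), (a : W) ∈ U →
      (∀ w ∈ U, w ≠ u → w ≠ v → χ' (ψ a) (Φ w) = 1) → (a : W) = u ∨ (a : W) = v := by
    intro a haU ha
    have haU' := (hmem a).mp haU
    obtain ⟨x, hx⟩ : ∃ x, x = Φ.symm (ψ a : W') := ⟨_, rfl⟩
    have hΦx : Φ x = ψ a := by rw [hx]; simp
    have hxU : x ∈ Subgroup.closure U := by
      rw [hcl, hΦx]; exact Subgroup.subset_closure haU'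
    have gen : ∀ q r, q ∈ U → r ∈ U → q ≠ r → orderOf (q * r) ≠ 2 → χ q x = -1 →
        (a : W) = q ∨ (a : W) = r := by
      intro q r hq hr hqr hoqr hqx
      by_contra hn
      push Not at hn
      have har : orderOf ((a : W) * r) = 2 := by
        by_contra h
        exact struct_pair hS hc hU haU hr hq hn.2 hqr.symm hn.1 h (by rwa [ord_comm])
      obtain ⟨T, hT, hsubT⟩ := ind_ext hS (T := {(a : W), r}) (by
        rintro y hy z hz hyz
        simp only [Set.mem_insert_iff, Set.mem_singleton_iff] at hy hz
        rcases hy with rfl | rfl <;> rcases hz with rfl | rfl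
        · exact absurd rfl hyz
        · exact har
        · rwa [ord_comm]
        · exact absurd rfl hyz) (by
        rintro y hy
        simp only [Set.mem_insert_iff, Set.mem_singleton_iff] at hy
        rcases hy with rfl | rfl
        · exact a.2
        · exact hU.sub_bar hr)
      obtain ⟨T', hT', hτT⟩ := P2 hS hS' hc hc' φ hT
      have haT' := (H T T' (Or.inr hT) (Or.inr hT') hτT a).mp (hsubT (by simp))
      obtain ⟨z, hz, e⟩ := ((tau_iff _ _ _).mp hτT).2 _ (Subgroup.subset_closure haT')
      rw [← hΦx, hof] at e
      have e2 := (of_symm φ).mp e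
      rw [MulEquiv.symm_apply_apply] at e2
      have hqT : q ∈ T := by
        refine chi_mem hS hc hχ hT.2.1 (hU.sub_bar hq) hz ?_
        rw [← char_of (χ q) e2, hqx]
      exact hoqr (hT.1 q hqT r (hsubT (by simp)) hqr)
    rcases unit_cases (χ u x) with hux | hux
    swap
    · exact gen u v hu hv huv ho hux
    rcases unit_cases (χ v x) with hvx | hvx
    swap
    · exact (gen v u hv hu huv.symm (by rwa [ord_comm]) hvx).symm
    exfalso
    obtain ⟨y, hy, e⟩ := ab_mem (A := U \ {u, v})
      (hS.1.subset hU.sub) (fun s hs => sq_one hS (hU.sub hs)) χ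
      (fun s hs t ht => hχ.bar hS hc (hU.sub_bar hs) (hU.sub_bar ht)) Set.sdiff_subset hxU (by
        intro z hz hzA
        have : z = u ∨ z = v := by
          by_contra hn
          exact hzA ⟨hz, by simpa using hn⟩
        rcases this with rfl | rfl
        · exact hux
        · exact hvx)
    have h5 := char_one ((χ' (ψ a)).comp Φ.toMonoidHom) (V := U \ {u, v}) (by
      rintro w ⟨hw, hwn⟩
      simp only [Set.mem_insert_iff, Set.mem_singleton_iff, not_or] at hwn
      exact ha w hw hwn.1 hwn.2) hy
    rw [← char_of _ e] at h5
    have h6 : χ' (ψ a) (Φ x) = 1 := h5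
    rw [hΦx, (hχ'.bar hS' hc' (ψ a).2 (ψ a).2).mpr rfl] at h6
    exact unit_ne h6.symm
  have c1 := claim s hsU fun w hw a b => (h3 w hw a b).1
  have c2 := claim t htU fun w hw a b => (h3 w hw a b).2
  rcases c1 with c1 | c1 <;> rcases c2 with c2 | c2
  · exact absurd (c1.trans c2.symm) hne
  · rwa [c1, c2]
  · rwa [c1, c2, ord_comm v u]
  · exact absurd (c1.trans c2.symm) hne

end five

/-- The bijection `ψ̄ : S̄ → S̄'` determined by the intersection pattern induces an
isomorphism of Coxeter systems `(W_{S̄}, S̄) ≅ (W'_{S̄'}, S̄')`. -/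
theorem psi_bar_iso {W W' : Type} [Group W] [Group W'] (S : Set W) (S' : Set W')
    (hS : IsCoxGenSet S) (hS' : IsCoxGenSet S') (hc : Conds S) (hc' : Conds S')
    (φ : W ≃* W') (ψ : ↥(Sbar S) ≃ ↥(Sbar S'))
    (hψ : ∀ (T : Set W) (T' : Set W'),
      (IsMaxSpherical S T ∨ IsMaxIndep (Sbar S) T) → T ⊆ Sbar S →
      (IsMaxSpherical S' T' ∨ IsMaxIndep (Sbar S') T') →
      Tau φ.toMonoidHom T T' →
      ∀ s : ↥(Sbar S), (s : W) ∈ T ↔ (ψ s : W') ∈ T') :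
    ∀ s t : ↥(Sbar S),
      orderOf ((s : W) * (t : W)) = orderOf ((ψ s : W') * (ψ t : W')) := by
  have H : ∀ (T : Set W) (T' : Set W'), (SE S T ∨ IsMaxIndep (Sbar S) T) →
      (SE S' T' ∨ IsMaxIndep (Sbar S') T') → Tau φ.toMonoidHom T T' →
      ∀ s : ↥(Sbar S), (s : W) ∈ T ↔ (ψ s : W') ∈ T' := by
    intro T T' hT hT' hτ
    refine hψ T T' (hT.imp_left fun h => h.1) ?_ (hT'.imp_left fun h => h.1) hτ
    rcases hT with h | h
    · exact h.sub_bar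
    · exact h.2.1
  have H' : ∀ (T' : Set W') (T : Set W), (SE S' T' ∨ IsMaxIndep (Sbar S') T') →
      (SE S T ∨ IsMaxIndep (Sbar S) T) → Tau φ.symm.toMonoidHom T' T →
      ∀ s : ↥(Sbar S'), (s : W') ∈ T' ↔ (ψ.symm s : W) ∈ T := by
    intro T' T hT' hT hτ s
    have := H T T' hT hT' (tau_symm φ hτ) (ψ.symm s)
    rw [Equiv.apply_symm_apply] at this
    exact this.symm
  intro s t
  by_cases hst : s = t
  · subst hst
    rw [sq_one hS (bar_sub s.2), sq_one hS' (bar_sub (ψ s).2), orderOf_one, orderOf_one]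
  have d1 := main_dvd hS hS' hc hc' φ ψ H s t hst
  have d2 := main_dvd hS' hS hc' hc φ.symm ψ.symm H' (ψ s) (ψ t) (fun e => hst (ψ.injective e))
  rw [Equiv.symm_apply_apply, Equiv.symm_apply_apply] at d2
  by_cases h0 : orderOf ((s : W) * (t : W)) = 0
  · by_cases h0' : orderOf ((ψ s : W') * (ψ t : W')) = 0
    · rw [h0, h0']
    · have := d2 h0'
      rw [h0, zero_dvd_iff] at this
      exact absurd this h0'
  · have h1 := d1 h0
    have h0' : orderOf ((ψ s : W') * (ψ t : W')) ≠ 0 := fun e => by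
      rw [e, zero_dvd_iff] at h1
      exact h0 h1
    exact Nat.dvd_antisymm (d2 h0') h1
end
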